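/- Let Ω be a bounded domain of an n-dimensional Alexandrov space with curvature ≥ k, let p > 1, Y a complete metric space, and u ∈ W^{1,p}(Ω,Y). Then for any sequence of numbers {ε_j} converging to 0 there exists a subsequence {ε'_j} ⊂ {ε_j} such that for almost every x₀ ∈ Ω the mean value property holds: ∫_{B_{x₀}(ε'_j)} d_Y^p(u(x₀),u(x)) dvol(x) = (c_{n,p}/(n+p))·|∇u|_p(x₀)·(ε'_j)^{n+p} + o((ε'_j)^{n+p}) as j → ∞. -/

import Mathlib

open MeasureTheory Metric Filter Set Asymptotics
open scoped Topology ENNReal NNReal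

noncomputable section

namespace Paper

/-- A unit-speed geodesic of length `L`. -/
def IsUnitGeodesic {M : Type*} [MetricSpace M] (γ : ℝ → M) (L : ℝ) : Prop :=
  0 ≤ L ∧ ∀ s ∈ Set.Icc (0:ℝ) L, ∀ t ∈ Set.Icc (0:ℝ) L, dist (γ s) (γ t) = |s - t|

/-- A geodesic metric space: every pair of points is joined by a unit-speed
shortest geodesic. -/
def GeodesicSpace (M : Type*) [MetricSpace M] : Prop :=
  ∀ x y : M, ∃ γ : ℝ → M, IsUnitGeodesic γ (dist x y) ∧ γ 0 = x ∧ γ (dist x y) = y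

/-- The comparison angle `∠̃_k` in the model plane `𝕄²_k` at the vertex between two
sides of lengths `a`, `b` whose opposite side has length `c`, given by the law of
cosines in the model plane of constant curvature `k`. -/
def cmpAngle (k a b c : ℝ) : ℝ :=
  if k = 0 then Real.arccos ((a ^ 2 + b ^ 2 - c ^ 2) / (2 * a * b))
  else if k < 0 then
    Real.arccos ((Real.cosh (Real.sqrt (-k) * a) * Real.cosh (Real.sqrt (-k) * b) -
        Real.cosh (Real.sqrt (-k) * c)) /
      (Real.sinh (Real.sqrt (-k) * a) * Real.sinh (Real.sqrt (-k) * b)))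
  else
    Real.arccos ((Real.cos (Real.sqrt k * c) -
        Real.cos (Real.sqrt k * a) * Real.cos (Real.sqrt k * b)) /
      (Real.sin (Real.sqrt k * a) * Real.sin (Real.sqrt k * b)))

/-- A (complete, locally compact) geodesic space has curvature `≥ k` in the sense of
Alexandrov: near every point, comparison angles along pairs of geodesics issuing from a common
point are non-increasing in each of the two parameters. -/
structure CurvBddBelow (M : Type*) [MetricSpace M] (k : ℝ) : Prop where
  locallyCompact : LocallyCompactSpace M
  geodesic : GeodesicSpace M
  comparison : ∀ x : M, ∃ U ∈ 𝓝 x,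
    ∀ (p : M) (γ σ : ℝ → M) (L₁ L₂ : ℝ),
      IsUnitGeodesic γ L₁ → IsUnitGeodesic σ L₂ →
      (∀ s ∈ Set.Icc (0:ℝ) L₁, γ s ∈ U) → (∀ t ∈ Set.Icc (0:ℝ) L₂, σ t ∈ U) →
      γ 0 = p → σ 0 = p →
      ∀ s t s' t' : ℝ, 0 < s → s ≤ s' → s' ≤ L₁ → 0 < t → t ≤ t' → t' ≤ L₂ →
        cmpAngle k s' t' (dist (γ s') (σ t')) ≤ cmpAngle k s t (dist (γ s) (σ t))

/-- An `n`-dimensional Alexandrov space with curvature `≥ k` (without boundary);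
its Hausdorff dimension equals `n` and it carries the `n`-dimensional Hausdorff
measure `μH[n]` as its volume. -/
structure AlexandrovSpace (M : Type*) [MetricSpace M] (n : ℕ) (k : ℝ) : Prop where
  curv : CurvBddBelow M k
  dim : dimH (Set.univ : Set M) = n

/-- An NPC space: a complete geodesic space which is globally non-positively curved in
the sense of Alexandrov (CAT(0)); the comparison inequality `d(P,S) ≤ |P̄S̄|` for the
midpoint `S` of the side `QR` is expressed through the Euclidean median formula. -/
structure NPCSpace (Y : Type*) [MetricSpace Y] : Prop where
  complete : CompleteSpace Y
  geodesic : GeodesicSpace Y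
  cat0 : ∀ p q r m : Y, dist q m = dist q r / 2 → dist r m = dist q r / 2 →
    dist p m ^ 2 ≤ (dist p q ^ 2 + dist p r ^ 2) / 2 - dist q r ^ 2 / 4

/-- `Lip_0(Ω)`: Lipschitz functions with compact support contained in `Ω`. -/
def IsLip0 {M : Type*} [MetricSpace M] (Ω : Set M) (φ : M → ℝ) : Prop :=
  (∃ c : ℝ≥0, LipschitzWith c φ) ∧ IsCompact (tsupport φ) ∧ tsupport φ ⊆ Ω

/-- `C_0(Ω)`: continuous functions with compact support contained in `Ω`. -/
def IsC0 {M : Type*} [MetricSpace M] (Ω : Set M) (φ : M → ℝ) : Prop :=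
  Continuous φ ∧ IsCompact (tsupport φ) ∧ tsupport φ ⊆ Ω

/-- `A ⊂⊂ B` : `A` is compactly contained in `B`. -/
def CptIn {M : Type*} [TopologicalSpace M] (A B : Set M) : Prop :=
  IsCompact (closure A) ∧ closure A ⊆ B

/-- An abstract first-order Sobolev calculus on the metric measure space `(M, d, μ)`:
it records the Sobolev spaces `W^{1,2}(Ω)`, `W^{1,2}_0(Ω)` and the pointwise inner
product of weak gradients `⟨∇f, ∇g⟩`, with the basic compatibility properties. -/
structure SobolevFramework (M : Type*) [MetricSpace M] [MeasurableSpace M]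
    (μ : Measure M) where
  memW12 : Set M → (M → ℝ) → Prop
  memW12_0 : Set M → (M → ℝ) → Prop
  innerGrad : (M → ℝ) → (M → ℝ) → M → ℝ
  innerGrad_symm : ∀ f g, innerGrad f g = innerGrad g f
  innerGrad_add_left : ∀ f g h, innerGrad (f + g) h = innerGrad f h + innerGrad g h
  innerGrad_smul_left : ∀ (c : ℝ) (f g : M → ℝ),
    innerGrad (fun x => c * f x) g = fun x => c * innerGrad f g x
  innerGrad_nonneg : ∀ f x, 0 ≤ innerGrad f f x
  innerGrad_lip_le : ∀ (f : M → ℝ) (c : ℝ≥0), LipschitzWith c f →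
    ∀ x, innerGrad f f x ≤ (c : ℝ) ^ 2
  lip_memW12 : ∀ (Ω : Set M) (f : M → ℝ), Bornology.IsBounded Ω →
    (∃ c : ℝ≥0, LipschitzWith c f) → memW12 Ω f
  lip0_memW12_0 : ∀ (Ω : Set M) (f : M → ℝ), IsLip0 Ω f → memW12_0 Ω f
  memW12_0_sub : ∀ (Ω : Set M) (f : M → ℝ), memW12_0 Ω f → memW12 Ω f

variable {M : Type*} [MetricSpace M] [MeasurableSpace M] {μ : Measure M}

/-- `f ∈ W^{1,2}_loc(Ω)`. -/
def memW12loc (F : SobolevFramework M μ) (Ω : Set M) (f : M → ℝ) : Prop :=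
  ∀ Ω' : Set M, IsOpen Ω' → CptIn Ω' Ω → F.memW12 Ω' f

/-- `f` is a super-solution of the Poisson equation `𝓛_f = h·vol` on `Ω`:
`𝓛_f(φ) = -∫_Ω ⟨∇f,∇φ⟩ ≤ ∫_Ω hφ` for all nonnegative `φ ∈ Lip_0(Ω)`. -/
def IsSupersolution (F : SobolevFramework M μ) (Ω : Set M) (f h : M → ℝ) : Prop :=
  ∀ φ : M → ℝ, IsLip0 Ω φ → (∀ x, 0 ≤ φ x) →
    -∫ x in Ω, F.innerGrad f φ x ∂μ ≤ ∫ x in Ω, h x * φ x ∂μ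

/-- `f` is a sub-solution of the Poisson equation `𝓛_f = h·vol` on `Ω`. -/
def IsSubsolution (F : SobolevFramework M μ) (Ω : Set M) (f h : M → ℝ) : Prop :=
  ∀ φ : M → ℝ, IsLip0 Ω φ → (∀ x, 0 ≤ φ x) →
    ∫ x in Ω, h x * φ x ∂μ ≤ -∫ x in Ω, F.innerGrad f φ x ∂μ

/-- `f` is a weak solution of `𝓛_f = h·vol` on `Ω`. -/
def IsWeakSolution (F : SobolevFramework M μ) (Ω : Set M) (f h : M → ℝ) : Prop :=
  IsSupersolution F Ω f h ∧ IsSubsolution F Ω f h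

/-- The normalizing constant `c_{n,p} = ∫_{𝕊^{n-1}} |x¹|^p dσ
    = 2 π^{(n-1)/2} Γ((p+1)/2) / Γ((n+p)/2)`. -/
def cnp (n : ℕ) (p : ℝ) : ℝ :=
  2 * Real.pi ^ (((n : ℝ) - 1) / 2) * Real.Gamma ((p + 1) / 2) /
    Real.Gamma (((n : ℝ) + p) / 2)

/-- `ω_{n-1}`, the volume of the standard unit sphere `𝕊^{n-1} ⊂ ℝⁿ`. -/
def sphereVol (n : ℕ) : ℝ := 2 * Real.pi ^ ((n : ℝ) / 2) / Real.Gamma ((n : ℝ) / 2)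

variable {Y : Type*} [MetricSpace Y]

/-- The approximating energy density
`e^u_{p,ε}(x) = ((n+p)/(c_{n,p} ε^{n+p})) ∫_{B_x(ε)∩Ω} d_Y^p(u(x),u(y)) dμ(y)`. -/
def ksDensity (n : ℕ) (p : ℝ) (μ : Measure M) (Ω : Set M) (u : M → Y) (ε : ℝ)
    (x : M) : ℝ :=
  ((n : ℝ) + p) / (cnp n p * ε ^ ((n : ℝ) + p)) *
    ∫ y in Metric.ball x ε ∩ Ω, dist (u x) (u y) ^ p ∂μ

/-- The approximating energy `E^u_{p,ε}(φ) = ∫_Ω φ e^u_{p,ε} dμ`. -/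
def ksApproxEnergy (n : ℕ) (p : ℝ) (μ : Measure M) (Ω : Set M) (u : M → Y)
    (φ : M → ℝ) (ε : ℝ) : ℝ :=
  ∫ x in Ω, φ x * ksDensity n p μ Ω u ε x ∂μ

/-- Membership in the Korevaar-Schoen type Sobolev space `W^{1,p}(Ω,Y)`:
`u ∈ L^p(Ω,Y)` is Borel with separable range, the energy functional
`E^u_p(φ) = lim_{ε→0⁺} E^u_{p,ε}(φ)` exists for every `φ ∈ C_0(Ω)`, and the total
energy `sup {E^u_p(φ) : φ ∈ C_0(Ω), 0 ≤ φ ≤ 1}` is finite. -/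
def MemKS (n : ℕ) (p : ℝ) (μ : Measure M) (Ω : Set M) (u : M → Y) : Prop :=
  (∀ P : Y, Measurable fun x => dist (u x) P) ∧
  TopologicalSpace.IsSeparable (Set.range u) ∧
  (∃ P : Y, IntegrableOn (fun x => dist (u x) P ^ p) Ω μ) ∧
  (∀ φ : M → ℝ, IsC0 Ω φ → ∃ e : ℝ,
    Tendsto (fun ε => ksApproxEnergy n p μ Ω u φ ε) (𝓝[>] (0:ℝ)) (𝓝 e)) ∧
  ∃ C : ℝ, ∀ (φ : M → ℝ) (e : ℝ), IsC0 Ω φ → (∀ x, 0 ≤ φ x ∧ φ x ≤ 1) →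
    Tendsto (fun ε => ksApproxEnergy n p μ Ω u φ ε) (𝓝[>] (0:ℝ)) (𝓝 e) → e ≤ C

/-- The total energy `E^u_p = sup {E^u_p(φ) : φ ∈ C_0(Ω), 0 ≤ φ ≤ 1}`. -/
def ksEnergy (n : ℕ) (p : ℝ) (μ : Measure M) (Ω : Set M) (u : M → Y) : ℝ :=
  sSup { e : ℝ | ∃ φ : M → ℝ, IsC0 Ω φ ∧ (∀ x, 0 ≤ φ x ∧ φ x ≤ 1) ∧
    Tendsto (fun ε => ksApproxEnergy n p μ Ω u φ ε) (𝓝[>] (0:ℝ)) (𝓝 e) }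

/-- `ν` is the (finite Borel) energy measure `E^u_p` of `u` on `Ω`:
`E^u_{p,ε}(φ) → ∫ φ dν` for every nonnegative `φ ∈ C_0(Ω)`. -/
def IsEnergyMeasure (n : ℕ) (p : ℝ) (μ : Measure M) (Ω : Set M) (u : M → Y)
    (ν : Measure M) : Prop :=
  IsFiniteMeasure ν ∧
  ∀ φ : M → ℝ, IsC0 Ω φ → (∀ x, 0 ≤ φ x) →
    Tendsto (fun ε => ksApproxEnergy n p μ Ω u φ ε) (𝓝[>] (0:ℝ)) (𝓝 (∫ x, φ x ∂ν))

/-- `|∇u|_p`, the density of the absolutely continuous part of the energy measure `ν`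
with respect to `μ` (the Radon–Nikodym derivative). -/
def ksDens (μ ν : Measure M) (x : M) : ℝ := (ν.rnDeriv μ x).toReal

/-- `u` is a harmonic map: `u ∈ W^{1,2}(Ω,Y)` minimizes the energy `E^w_2` among all
`w ∈ W^{1,2}(Ω,Y)` with `d_Y(w(·),u(·)) ∈ W^{1,2}_0(Ω)`. -/
def IsHarmonicMap (F : SobolevFramework M μ) (n : ℕ) (Ω : Set M) (u : M → Y) : Prop :=
  MemKS n 2 μ Ω u ∧
  ∀ w : M → Y, MemKS n 2 μ Ω w → F.memW12_0 Ω (fun x => dist (w x) (u x)) →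
    ksEnergy n 2 μ Ω u ≤ ksEnergy n 2 μ Ω w

/-- The oscillation `osc_A u = max_{x,y ∈ A} d_Y(u(x),u(y))`. -/
def oscOn (u : M → Y) (A : Set M) : ℝ :=
  sSup { d : ℝ | ∃ x ∈ A, ∃ y ∈ A, d = dist (u x) (u y) }

/-- The pointwise Lipschitz constant `Lip u(x) = limsup_{y→x} d_Y(u(x),u(y))/|xy|`. -/
def pLipMap (u : M → Y) (x : M) : ℝ :=
  Filter.limsup (fun y => dist (u x) (u y) / dist x y) (𝓝[≠] x)

/-- The volume `vol(Σ_x)` of the space of directions at `x`, recovered as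
`lim_{r→0⁺} n · vol(B_x(r)) / rⁿ`. -/
def dirVolume (μ : Measure M) (n : ℕ) (x : M) : ℝ :=
  limUnder (𝓝[>] (0:ℝ)) (fun r => (n : ℝ) * (μ (Metric.ball x r)).toReal / r ^ n)

/-- The model function `s_k`. -/
def snk (k r : ℝ) : ℝ :=
  if k < 0 then Real.sinh (Real.sqrt (-k) * r) / Real.sqrt (-k)
  else if k = 0 then r
  else Real.sin (Real.sqrt k * r) / Real.sqrt k

/-- The set `M^δ = {x : vol(Σ_x) > (1-δ)·vol(𝕊^{n-1})}` of `δ`-regular points. -/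
def Mdelta (μ : Measure M) (n : ℕ) (δ : ℝ) : Set M :=
  { x : M | (1 - δ) * sphereVol n < dirVolume μ n x }

/-- The auxiliary function
`f_t(x,λ) = inf_{y∈Ω'} { e^{-2nkλ} |xy|²/(2t) - d_Y(u(x),u(y)) }`. -/
def auxF (n : ℕ) (k : ℝ) (u : M → Y) (Ω' : Set M) (t : ℝ) (x : M) (l : ℝ) : ℝ :=
  sInf { v : ℝ | ∃ y ∈ Ω',
    v = Real.exp (-2 * (n : ℝ) * k * l) * dist x y ^ 2 / (2 * t) - dist (u x) (u y) }

/-- The set `S_t(x,λ)` of points realizing the infimum defining `f_t(x,λ)`. -/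
def auxS (n : ℕ) (k : ℝ) (u : M → Y) (Ω' : Set M) (t : ℝ) (l : ℝ) (x : M) : Set M :=
  { y ∈ Ω' | auxF n k u Ω' t x l
      = Real.exp (-2 * (n : ℝ) * k * l) * dist x y ^ 2 / (2 * t) - dist (u x) (u y) }

/-- `L_{t,λ}(x) = dist(x, S_t(x,λ))`. -/
def auxL (n : ℕ) (k : ℝ) (u : M → Y) (Ω' : Set M) (t : ℝ) (l : ℝ) (x : M) : ℝ :=
  Metric.infDist x (auxS n k u Ω' t l x)

/-- Distance between two sets. -/
def setDist (A B : Set M) : ℝ := sInf { d : ℝ | ∃ x ∈ A, ∃ y ∈ B, d = dist x y }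

/-- `g` is a (weak) super-solution of the heat equation `𝓛_g = ∂g/∂λ` on the parabolic
cylinder `Q = G×I`: `-∫_Q ⟨∇g,∇φ⟩ dν ≤ ∫_Q (∂g/∂λ)φ dν` for all nonnegative
`φ ∈ Lip_0(Q)`, with `ν = μ × 𝓛¹` and spatial weak gradients. -/
def IsHeatSupersolution (F : SobolevFramework M μ) (G : Set M) (I : Set ℝ)
    (g : M × ℝ → ℝ) : Prop :=
  ∀ φ : M × ℝ → ℝ, IsLip0 (G ×ˢ I) φ → (∀ z, 0 ≤ φ z) →
    -∫ z in G ×ˢ I, F.innerGrad (fun x => g (x, z.2)) (fun x => φ (x, z.2)) z.1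
        ∂(μ.prod volume) ≤
      ∫ z in G ×ˢ I, deriv (fun s => g (z.1, s)) z.2 * φ z ∂(μ.prod volume)

/-- `g` is a (weak) sub-solution of the heat equation `𝓛_g = ∂g/∂λ` on `Q = G×I`. -/
def IsHeatSubsolution (F : SobolevFramework M μ) (G : Set M) (I : Set ℝ)
    (g : M × ℝ → ℝ) : Prop :=
  ∀ φ : M × ℝ → ℝ, IsLip0 (G ×ˢ I) φ → (∀ z, 0 ≤ φ z) →
    ∫ z in G ×ˢ I, deriv (fun s => g (z.1, s)) z.2 * φ z ∂(μ.prod volume) ≤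
      -∫ z in G ×ˢ I, F.innerGrad (fun x => g (x, z.2)) (fun x => φ (x, z.2)) z.1
        ∂(μ.prod volume)

/-- `|∇⁺v|(x) = limsup_{r→0} sup_{y∈B_x(r)} (v(y)-v(x))_+ / r`. -/
def upGrad (v : M → ℝ) (x : M) : ℝ :=
  Filter.limsup
    (fun r => sSup { d : ℝ | ∃ y ∈ Metric.ball x r, d = max (v y - v x) 0 / r })
    (𝓝[>] (0:ℝ))

end Paper

namespace Paper

/-- In every model plane the comparison angle has the form
`arccos (1 - 2 F((c+e)/2) F((c-e)/2) / (F(a) F(b)))` with `e = a - b`, where `F` is the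
rescaled sine of the model plane. -/
theorem exists_cmpAngle_eq (k : ℝ) : ∃ (F : ℝ → ℝ) (κ r₀ : ℝ), 0 < κ ∧ 0 < r₀ ∧ F 0 = 0 ∧
    HasDerivAt F κ 0 ∧ MonotoneOn F (Icc 0 r₀) ∧
    ∀ a b c : ℝ, F a ≠ 0 → F b ≠ 0 → cmpAngle k a b c =
      Real.arccos (1 - 2 * (F ((c + (a - b)) / 2) * F ((c - (a - b)) / 2)) / (F a * F b)) := by
  rcases lt_trichotomy k 0 with hk | hk | hk
  · have hκ : 0 < Real.sqrt (-k) := Real.sqrt_pos.2 (by linarith)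
    refine ⟨fun x => Real.sinh (Real.sqrt (-k) * x), Real.sqrt (-k), 1, hκ, one_pos, by simp,
      ?_, ?_, ?_⟩
    · have h := (Real.hasDerivAt_sinh (Real.sqrt (-k) * 0)).comp (0 : ℝ)
        ((hasDerivAt_id (0 : ℝ)).const_mul (Real.sqrt (-k)))
      simpa [Function.comp_def] using h
    · intro x _ y _ hxy
      exact Real.sinh_strictMono.monotone (by gcongr)
    · intro a b c ha hb
      simp only [cmpAngle, hk.ne, hk, if_true, if_false]
      congr 1
      rw [eq_sub_iff_add_eq, ← add_div, div_eq_one_iff_eq (mul_ne_zero ha hb)]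
      generalize Real.sqrt (-k) = s
      have e1 : s * c = s * ((c + (a - b)) / 2) + s * ((c - (a - b)) / 2) := by ring
      have e2 : s * a - s * b = s * ((c + (a - b)) / 2) - s * ((c - (a - b)) / 2) := by ring
      have h2 := Real.cosh_sub (s * a) (s * b)
      rw [e2, Real.cosh_sub] at h2
      rw [e1, Real.cosh_add]
      linarith
  · refine ⟨id, 1, 1, one_pos, one_pos, rfl, hasDerivAt_id 0, monotone_id.monotoneOn _, ?_⟩
    intro a b c ha hb
    simp only [id] at *
    simp only [cmpAngle, hk, if_true]
    congr 1
    field_simp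
    ring
  · have hκ : 0 < Real.sqrt k := Real.sqrt_pos.2 hk
    refine ⟨fun x => Real.sin (Real.sqrt k * x), Real.sqrt k, 1 / Real.sqrt k, hκ, by positivity,
      by simp, ?_, ?_, ?_⟩
    · have h := (Real.hasDerivAt_sin (Real.sqrt k * 0)).comp (0 : ℝ)
        ((hasDerivAt_id (0 : ℝ)).const_mul (Real.sqrt k))
      simpa [Function.comp_def] using h
    · intro x hx y hy hxy
      have hpi := Real.pi_gt_three
      have hy1 : Real.sqrt k * y ≤ 1 := by
        have := mul_le_mul_of_nonneg_left hy.2 hκ.le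
        rwa [mul_one_div_cancel hκ.ne'] at this
      have hx0 : 0 ≤ Real.sqrt k * x := mul_nonneg hκ.le hx.1
      exact Real.sin_le_sin_of_le_of_le_pi_div_two (by linarith) (by linarith) (by gcongr)
    · intro a b c ha hb
      simp only [cmpAngle, hk.ne', not_lt.2 hk.le, if_false]
      congr 1
      rw [eq_sub_iff_add_eq, ← add_div, div_eq_one_iff_eq (mul_ne_zero ha hb)]
      generalize Real.sqrt k = s
      have e1 : s * c = s * ((c + (a - b)) / 2) + s * ((c - (a - b)) / 2) := by ring
      have e2 : s * a - s * b = s * ((c + (a - b)) / 2) - s * ((c - (a - b)) / 2) := by ring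
      have h2 := Real.cos_sub (s * a) (s * b)
      rw [e2, Real.cos_sub] at h2
      rw [e1, Real.cos_add]
      linarith

theorem exists_linear_bounds {F : ℝ → ℝ} {κ : ℝ} (hκ : 0 < κ) (hF0 : F 0 = 0)
    (hF : HasDerivAt F κ 0) {θ : ℝ} (hθ : 0 < θ) :
    ∃ r > 0, ∀ x, 0 ≤ x → x ≤ r → (1 - θ) * κ * x ≤ F x ∧ F x ≤ (1 + θ) * κ * x := by
  have h := hF.isLittleO.def (show 0 < θ * κ by positivity)
  obtain ⟨r, hr, H⟩ := Metric.eventually_nhds_iff.1 h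
  refine ⟨r / 2, by positivity, fun x hx hxr => ?_⟩
  have := H (y := x) (by rw [Real.dist_eq, sub_zero, abs_of_nonneg hx]; linarith)
  simp only [hF0, sub_zero, smul_eq_mul, Real.norm_eq_abs, abs_of_nonneg hx] at this
  rw [abs_le] at this
  constructor <;> nlinarith [this.1, this.2]

/-- The law of cosines turns the comparison of angles for two homothetic hinges into a lower
bound of the smaller opposite side, which is asymptotically sharp at small scales. -/
theorem exists_le_of_cmpAngle_le (k : ℝ) {l : ℝ} (hl : l < 1) :
    ∃ r > 0, ∀ a b c s c' : ℝ, 0 < a → a ≤ r → 0 < b → b ≤ r → 0 < s → s ≤ 1 →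
      |a - b| ≤ c → c ≤ a + b → s * |a - b| ≤ c' → c' ≤ s * (a + b) →
      cmpAngle k a b c ≤ cmpAngle k (s * a) (s * b) c' → l * s * c ≤ c' := by
  obtain ⟨F, κ, r₀, hκ, hr₀, hF0, hF, hmono, hang⟩ := exists_cmpAngle_eq k
  obtain ⟨θ, hθ, hθ1, hθl⟩ : ∃ θ : ℝ, 0 < θ ∧ θ < 1 ∧ l * (1 + θ) ^ 2 ≤ (1 - θ) ^ 2 := by
    by_cases h : l ≤ 0
    · exact ⟨1 / 2, by norm_num, by norm_num, by nlinarith⟩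
    · push Not at h
      refine ⟨(1 - l) / 8, by linarith, by linarith, ?_⟩
      nlinarith [mul_pos h h, sq_nonneg (1 - l), mul_pos h (sub_pos.2 hl),
        mul_pos (mul_pos h (sub_pos.2 hl)) (sub_pos.2 hl)]
  obtain ⟨r₁, hr₁, hb⟩ := exists_linear_bounds hκ hF0 hF hθ
  refine ⟨min r₀ r₁, lt_min hr₀ hr₁, ?_⟩
  intro a b c s c' ha har hb0 hbr hs hs1 hc1 hc2 hc1' hc2' hcmp
  have har₀ := har.trans (min_le_left _ _)
  have har₁ := har.trans (min_le_right _ _)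
  have hbr₀ := hbr.trans (min_le_left _ _)
  have hbr₁ := hbr.trans (min_le_right _ _)
  have hpos : ∀ x, 0 < x → x ≤ r₁ → 0 < F x := fun x hx hxr =>
    lt_of_lt_of_le (by have : 0 < 1 - θ := by linarith
                       positivity) (hb x hx.le hxr).1
  have hnn : ∀ x, 0 ≤ x → x ≤ r₁ → 0 ≤ F x := fun x hx hxr =>
    le_trans (by have : 0 < 1 - θ := by linarith
                 positivity) (hb x hx hxr).1
  obtain ⟨hab1, hab2⟩ := abs_le.1 hc1
  have hsab1 : -c' ≤ s * (a - b) := by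
    nlinarith [neg_abs_le (a - b)]
  have hsab2 : s * (a - b) ≤ c' := by
    nlinarith [le_abs_self (a - b)]
  have hsa : 0 < s * a := mul_pos hs ha
  have hsb : 0 < s * b := mul_pos hs hb0
  have hsa1 : s * a ≤ a := mul_le_of_le_one_left ha.le hs1
  have hsb1 : s * b ≤ b := mul_le_of_le_one_left hb0.le hs1
  have hFa := hpos a ha har₁
  have hFb := hpos b hb0 hbr₁
  have hFsa := hpos (s * a) hsa (hsa1.trans har₁)
  have hFsb := hpos (s * b) hsb (hsb1.trans hbr₁)
  rw [hang a b c hFa.ne' hFb.ne', hang (s * a) (s * b) c' hFsa.ne' hFsb.ne'] at hcmp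
  set u := (c + (a - b)) / 2 with hu
  set v := (c - (a - b)) / 2 with hv
  set u' := (c' + (s * a - s * b)) / 2 with hu'
  set v' := (c' - (s * a - s * b)) / 2 with hv'
  have hu0 : 0 ≤ u := by simp only [hu]; linarith
  have hv0 : 0 ≤ v := by simp only [hv]; linarith
  have hu0' : 0 ≤ u' := by simp only [hu']; linarith
  have hv0' : 0 ≤ v' := by simp only [hv']; linarith
  have hua : u ≤ a := by simp only [hu]; linarith
  have hvb : v ≤ b := by simp only [hv]; linarith
  have hua' : u' ≤ s * a := by simp only [hu']; linarith
  have hvb' : v' ≤ s * b := by simp only [hv']; linarith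
  have key : F u * F v / (F a * F b) ≤ F u' * F v' / (F (s * a) * F (s * b)) := by
    by_contra hcon
    push Not at hcon
    refine absurd hcmp (not_le.2 ?_)
    have h1 : F u * F v / (F a * F b) ≤ 1 := by
      rw [div_le_one (mul_pos hFa hFb)]
      have h1 := hmono ⟨hu0, hua.trans har₀⟩ ⟨ha.le, har₀⟩ hua
      have h2 := hmono ⟨hv0, hvb.trans hbr₀⟩ ⟨hb0.le, hbr₀⟩ hvb
      exact mul_le_mul h1 h2 (hnn v hv0 (hvb.trans hbr₁)) hFa.le
    have h2 : 0 ≤ F u' * F v' / (F (s * a) * F (s * b)) := by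
      have h1 := hnn u' hu0' (hua'.trans (hsa1.trans har₁))
      have h2 := hnn v' hv0' (hvb'.trans (hsb1.trans hbr₁))
      positivity
    have e1 : 2 * (F u * F v) / (F a * F b) = 2 * (F u * F v / (F a * F b)) := mul_div_assoc ..
    have e2 : 2 * (F u' * F v') / (F (s * a) * F (s * b)) =
      2 * (F u' * F v' / (F (s * a) * F (s * b))) := mul_div_assoc ..
    rw [e1, e2]
    apply Real.strictAntiOn_arccos
    · constructor <;> linarith
    · constructor <;> linarith
    · linarith
  rw [div_le_div_iff₀ (mul_pos hFa hFb) (mul_pos hFsa hFsb)] at key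
  set m := (1 - θ) * κ with hm
  set N := (1 + θ) * κ with hN
  have hm0 : 0 < m := mul_pos (by linarith) hκ
  have hN0 : 0 < N := mul_pos (by linarith) hκ
  have L : (m * u * (m * v)) * (m * (s * a) * (m * (s * b))) ≤
      F u * F v * (F (s * a) * F (s * b)) := by
    have h1 := (hb u hu0 (hua.trans har₁)).1
    have h2 := (hb v hv0 (hvb.trans hbr₁)).1
    have h3 := (hb _ hsa.le (hsa1.trans har₁)).1
    have h4 := (hb _ hsb.le (hsb1.trans hbr₁)).1
    have hFu := hnn u hu0 (hua.trans har₁)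
    have hFv := hnn v hv0 (hvb.trans hbr₁)
    gcongr
  have U : F u' * F v' * (F a * F b) ≤ (N * u' * (N * v')) * (N * a * (N * b)) := by
    have h1 := (hb u' hu0' (hua'.trans (hsa1.trans har₁))).2
    have h2 := (hb v' hv0' (hvb'.trans (hsb1.trans hbr₁))).2
    have h3 := (hb _ ha.le har₁).2
    have h4 := (hb _ hb0.le hbr₁).2
    have := hnn v' hv0' (hvb'.trans (hsb1.trans hbr₁))
    have := hnn u' hu0' (hua'.trans (hsa1.trans har₁))
    gcongr
  have T := (L.trans key).trans U
  have T2 : m ^ 4 * s ^ 2 * (u * v) ≤ N ^ 4 * (u' * v') := by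
    have hab : 0 < a * b := mul_pos ha hb0
    refine le_of_mul_le_mul_right ?_ hab
    calc _ = (m * u * (m * v)) * (m * (s * a) * (m * (s * b))) := by ring
      _ ≤ _ := T
      _ = _ := by ring
  have huv : u * v = (c ^ 2 - (a - b) ^ 2) / 4 := by simp only [hu, hv]; ring
  have huv' : u' * v' = (c' ^ 2 - s ^ 2 * (a - b) ^ 2) / 4 := by simp only [hu', hv']; ring
  rw [huv, huv'] at T2
  have hmN : m ≤ N := by simp only [hm, hN]; gcongr; linarith
  have hmN4 : m ^ 4 ≤ N ^ 4 := by gcongr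
  have T3 : (m ^ 2 * (s * c)) ^ 2 ≤ (N ^ 2 * c') ^ 2 := by
    have : m ^ 4 * (s ^ 2 * (a - b) ^ 2) ≤ N ^ 4 * (s ^ 2 * (a - b) ^ 2) := by gcongr
    calc (m ^ 2 * (s * c)) ^ 2 = 4 * (m ^ 4 * s ^ 2 * ((c ^ 2 - (a - b) ^ 2) / 4)) +
          m ^ 4 * (s ^ 2 * (a - b) ^ 2) := by ring
      _ ≤ 4 * (N ^ 4 * ((c' ^ 2 - s ^ 2 * (a - b) ^ 2) / 4)) +
          N ^ 4 * (s ^ 2 * (a - b) ^ 2) := by gcongr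
      _ = _ := by ring
  have hc0 : 0 ≤ c := (abs_nonneg _).trans hc1
  have hc0' : 0 ≤ c' := (mul_nonneg hs.le (abs_nonneg _)).trans hc1'
  have T4 : m ^ 2 * (s * c) ≤ N ^ 2 * c' := by
    exact (sq_le_sq₀ (by positivity) (by positivity)).1 T3
  have hlN : l * N ^ 2 ≤ m ^ 2 := by
    simp only [hm, hN]
    calc l * ((1 + θ) * κ) ^ 2 = l * (1 + θ) ^ 2 * κ ^ 2 := by ring
      _ ≤ (1 - θ) ^ 2 * κ ^ 2 := by gcongr
      _ = _ := by ring
  have hN2 : 0 < N ^ 2 := by positivity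
  have hsc : 0 ≤ s * c := by positivity
  refine le_of_mul_le_mul_left ?_ hN2
  calc N ^ 2 * (l * s * c) = (l * N ^ 2) * (s * c) := by ring
    _ ≤ m ^ 2 * (s * c) := by gcongr
    _ ≤ _ := T4

/-- `z` lies on a shortest path from `x` to `y` and divides it in the ratio `s : 1 - s`. -/
def IsRatioPoint {M : Type*} [MetricSpace M] (x y : M) (s : ℝ) (z : M) : Prop :=
  dist x z = s * dist x y ∧ dist z y = (1 - s) * dist x y

section Contraction

variable {M : Type*} [MetricSpace M]

theorem IsRatioPoint.symm {x y z : M} {s : ℝ} (h : IsRatioPoint x y s z) :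
    IsRatioPoint y x (1 - s) z := by
  refine ⟨?_, ?_⟩
  · rw [dist_comm y z, dist_comm y x]; exact h.2
  · rw [dist_comm z x, dist_comm y x, sub_sub_cancel]; exact h.1

theorem exists_isRatioPoint (hM : GeodesicSpace M) (x y : M) {s : ℝ} (hs : s ∈ Icc (0 : ℝ) 1) :
    ∃ z, IsRatioPoint x y s z := by
  obtain ⟨γ, ⟨hL, hγ⟩, h0, h1⟩ := hM x y
  have hmem : s * dist x y ∈ Icc 0 (dist x y) :=
    ⟨mul_nonneg hs.1 hL, mul_le_of_le_one_left hL hs.2⟩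
  refine ⟨γ (s * dist x y), ?_, ?_⟩
  · have := hγ 0 ⟨le_rfl, hL⟩ _ hmem
    rw [h0] at this
    rw [this, zero_sub, abs_neg, abs_of_nonneg hmem.1]
  · have := hγ _ hmem (dist x y) ⟨hL, le_rfl⟩
    rw [h1] at this
    rw [this, abs_sub_comm, abs_of_nonneg (by linarith [hmem.2])]
    ring

/-- A point dividing the distance between `x` and `y` lies on a shortest path. -/
theorem IsRatioPoint.exists_geodesic (hM : GeodesicSpace M) {x y z : M} {s : ℝ}
    (hz : IsRatioPoint x y s z) :
    ∃ γ : ℝ → M, IsUnitGeodesic γ (dist x y) ∧ γ 0 = x ∧ γ (dist x y) = y ∧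
      γ (s * dist x y) = z := by
  obtain ⟨γ₁, ⟨hL₁, h₁⟩, h₁0, h₁1⟩ := hM x z
  obtain ⟨γ₂, ⟨hL₂, h₂⟩, h₂0, h₂1⟩ := hM z y
  have hsum : dist x z + dist z y = dist x y := by rw [hz.1, hz.2]; ring
  set γ : ℝ → M := fun t => if t ≤ dist x z then γ₁ t else γ₂ (t - dist x z) with hγ
  have hg0 : γ 0 = x := by simp only [hγ, if_pos hL₁, h₁0]
  have hgz : γ (s * dist x y) = z := by
    rw [← hz.1]; simp only [hγ, if_pos le_rfl, h₁1]
  have hg1 : γ (dist x y) = y := by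
    simp only [hγ]
    split_ifs with h
    · have h0 : dist z y = 0 := by linarith
      have h0' : dist x y = dist x z := by linarith
      rw [h0', h₁1, dist_eq_zero.1 h0]
    · rw [← hsum, add_sub_cancel_left, h₂1]
  have dx : ∀ t ∈ Icc 0 (dist x z), dist x (γ₁ t) = t := fun t ht => by
    have := h₁ 0 ⟨le_rfl, hL₁⟩ t ht
    rwa [h₁0, zero_sub, abs_neg, abs_of_nonneg ht.1] at this
  have dz : ∀ t ∈ Icc 0 (dist x z), dist (γ₁ t) z = dist x z - t := fun t ht => by
    have := h₁ t ht _ ⟨hL₁, le_rfl⟩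
    rwa [h₁1, abs_sub_comm, abs_of_nonneg (sub_nonneg.2 ht.2)] at this
  have dz' : ∀ t ∈ Icc 0 (dist z y), dist z (γ₂ t) = t := fun t ht => by
    have := h₂ 0 ⟨le_rfl, hL₂⟩ t ht
    rwa [h₂0, zero_sub, abs_neg, abs_of_nonneg ht.1] at this
  have dy : ∀ t ∈ Icc 0 (dist z y), dist (γ₂ t) y = dist z y - t := fun t ht => by
    have := h₂ t ht _ ⟨hL₂, le_rfl⟩
    rwa [h₂1, abs_sub_comm, abs_of_nonneg (sub_nonneg.2 ht.2)] at this
  have cross : ∀ a ∈ Icc (0 : ℝ) (dist x z), ∀ b ∈ Icc (0 : ℝ) (dist z y),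
      dist (γ₁ a) (γ₂ b) = dist x z - a + b := by
    intro a ha b hb
    apply le_antisymm
    · calc dist (γ₁ a) (γ₂ b) ≤ dist (γ₁ a) z + dist z (γ₂ b) := dist_triangle _ _ _
        _ = _ := by rw [dz a ha, dz' b hb]
    · have := dist_triangle4 x (γ₁ a) (γ₂ b) y
      rw [dx a ha, dy b hb] at this
      linarith
  refine ⟨γ, ⟨dist_nonneg, ?_⟩, hg0, hg1, hgz⟩
  intro a ha b hb
  simp only [hγ]
  split_ifs with h1 h2 h2
  · exact h₁ a ⟨ha.1, h1⟩ b ⟨hb.1, h2⟩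
  · push Not at h2
    rw [cross a ⟨ha.1, h1⟩ _ ⟨by linarith, by linarith [hb.2]⟩, abs_sub_comm,
      abs_of_nonneg (by linarith)]
    ring
  · push Not at h1
    rw [dist_comm, cross b ⟨hb.1, h2⟩ _ ⟨by linarith, by linarith [ha.2]⟩,
      abs_of_nonneg (by linarith)]
    ring
  · push Not at h1 h2
    rw [h₂ _ ⟨by linarith, by linarith [ha.2]⟩ _ ⟨by linarith, by linarith [hb.2]⟩]
    congr 1; ring

/-- In a space of curvature bounded below, the homotheties with a given centre do not shrink
distances by much more than their ratio, uniformly at small scales. -/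
theorem CurvBddBelow.exists_mul_dist_le {k : ℝ} (hM : CurvBddBelow M k) (a : M) :
    ∃ R > 0, ∀ l < (1 : ℝ), ∃ e > 0, ∀ x ∈ ball a R, ∀ y ∈ ball a R, ∀ y' ∈ ball a R,
      dist x y < e → dist x y' < e → ∀ s ∈ Icc (0 : ℝ) 1, ∀ z z',
      IsRatioPoint x y s z → IsRatioPoint x y' s z' → l * s * dist y y' ≤ dist z z' := by
  obtain ⟨U, hU, hcomp⟩ := hM.comparison a
  obtain ⟨r, hr, hrU⟩ := Metric.mem_nhds_iff.1 hU
  refine ⟨r / 3, by positivity, fun l hl => ?_⟩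
  obtain ⟨e, he, H⟩ := exists_le_of_cmpAngle_le k hl
  refine ⟨e, he, ?_⟩
  intro x hx y hy y' hy' hxy hxy' s hs z z' hz hz'
  rw [mem_ball] at hx hy hy'
  rcases hs.1.eq_or_lt with hs0 | hs0
  · rw [← hs0]; simp
  rcases (dist_nonneg (x := x) (y := y)).eq_or_lt with h0 | h0
  · have hzx : x = z := by
      have := hz.1; rw [← h0, mul_zero] at this; exact dist_eq_zero.1 this
    have hyx : x = y := dist_eq_zero.1 h0.symm
    rw [← hzx, ← hyx, hz'.1, mul_assoc]
    exact mul_le_of_le_one_left (by positivity) hl.le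
  rcases (dist_nonneg (x := x) (y := y')).eq_or_lt with h0' | h0'
  · have hzx : x = z' := by
      have := hz'.1; rw [← h0', mul_zero] at this; exact dist_eq_zero.1 this
    have hyx : x = y' := dist_eq_zero.1 h0'.symm
    rw [← hzx, ← hyx, dist_comm z x, dist_comm y x, hz.1, mul_assoc]
    exact mul_le_of_le_one_left (by positivity) hl.le
  obtain ⟨γ, hγ, g0, g1, gz⟩ := hz.exists_geodesic hM.geodesic
  obtain ⟨σ, hσ, s0, s1, sz⟩ := hz'.exists_geodesic hM.geodesic
  have inU : ∀ {w : M} {δ : ℝ → M}, dist w a < r / 3 → IsUnitGeodesic δ (dist x w) → δ 0 = x →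
      ∀ t ∈ Icc 0 (dist x w), δ t ∈ U := by
    intro w δ hw hδ h0 t ht
    apply hrU
    have h1 := hδ.2 t ht 0 ⟨le_rfl, hδ.1⟩
    rw [h0, sub_zero, abs_of_nonneg ht.1] at h1
    have h2 := dist_triangle (δ t) x a
    have h3 := dist_triangle_right x w a
    rw [mem_ball]
    linarith [ht.2]
  have h := hcomp x γ σ _ _ hγ hσ (inU hy hγ g0) (inU hy' hσ s0) g0 s0 (s * dist x y)
    (s * dist x y') (dist x y) (dist x y') (mul_pos hs0 h0) (mul_le_of_le_one_left h0.le hs.2)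
    le_rfl (mul_pos hs0 h0') (mul_le_of_le_one_left h0'.le hs.2) le_rfl
  rw [g1, s1, gz, sz] at h
  refine H _ _ _ _ _ h0 hxy.le h0' hxy'.le hs0 hs.2 ?_ (dist_triangle_left _ _ _) ?_ ?_ h
  · rw [dist_comm x y, dist_comm x y']; exact abs_dist_sub_le _ _ _
  · have := abs_dist_sub_le z z' x
    rw [dist_comm z x, dist_comm z' x, hz.1, hz'.1, ← mul_sub, abs_mul, abs_of_pos hs0] at this
    exact this
  · have := dist_triangle_left z z' x
    rw [hz.1, hz'.1, ← mul_add] at this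
    exact this

end Contraction

section SelfSimilar

variable {M : Type*} [MetricSpace M]

/-- A metric space containing a Cantor set with `N` pieces of ratio `t` at each step has
Hausdorff dimension at least `log N / log (1 / t)`. -/
theorem le_dimH_of_coding {N : ℕ} (hN : 1 < N) {t c : ℝ} (ht : 0 < t) (hc : 0 < c)
    (X : (ℕ → Fin N) → M)
    (hX : ∀ v w : ℕ → Fin N, ∀ m, (∀ i < m, v i = w i) → v m ≠ w m →
      c * t ^ m ≤ dist (X v) (X w)) {q : ℝ≥0} (hq : 0 < q) (hNq : (N : ℝ)⁻¹ ≤ t ^ (q : ℝ)) :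
    (q : ℝ≥0∞) ≤ dimH (univ : Set M) := by
  have hdist : ∀ v w : ℕ → Fin N,
      dist (Real.ofDigits v) (Real.ofDigits w) ≤ c⁻¹ ^ (q : ℝ) * dist (X v) (X w) ^ (q : ℝ) := by
    intro v w
    by_cases hvw : v = w
    · subst hvw; rw [dist_self]; positivity
    have hex : ∃ m, v m ≠ w m := by
      by_contra! h; exact hvw (funext h)
    classical
    have hlt : ∀ i < Nat.find hex, v i = w i := fun i hi => by
      simpa using Nat.find_min hex hi
    set m := Nat.find hex with hm
    have h1 := Real.abs_ofDigits_sub_ofDigits_le hlt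
    have h2 := hX v w m hlt (Nat.find_spec hex)
    have h3 : t ^ m ≤ c⁻¹ * dist (X v) (X w) := by
      rw [inv_mul_eq_div, le_div_iff₀ hc, mul_comm]; exact h2
    rw [Real.dist_eq, ← Real.mul_rpow (by positivity) dist_nonneg]
    calc _ ≤ ((N : ℝ) ^ m)⁻¹ := h1
      _ = ((N : ℝ)⁻¹) ^ m := by rw [inv_pow]
      _ ≤ (t ^ (q : ℝ)) ^ m := by gcongr
      _ = (t ^ m) ^ (q : ℝ) := by
        rw [← Real.rpow_natCast, ← Real.rpow_natCast, ← Real.rpow_mul ht.le,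
          ← Real.rpow_mul ht.le, mul_comm]
      _ ≤ _ := by gcongr
  obtain ⟨h, hh⟩ : ∃ h : M → ℝ, ∀ v, h (X v) = Real.ofDigits v := by
    classical
    refine ⟨fun x => if hx : ∃ v, X v = x then Real.ofDigits hx.choose else 0, fun v => ?_⟩
    have hx : ∃ w, X w = X v := ⟨v, rfl⟩
    simp only [dif_pos hx]
    have := hdist hx.choose v
    rw [hx.choose_spec, dist_self, Real.zero_rpow (by exact_mod_cast hq.ne'), mul_zero] at this
    exact dist_le_zero.1 this
  have hH : HolderOnWith (Real.toNNReal (c⁻¹ ^ (q : ℝ))) q h (range X) := by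
    rintro _ ⟨v, rfl⟩ _ ⟨w, rfl⟩
    rw [hh, hh, edist_dist, edist_dist, ENNReal.ofReal_rpow_of_nonneg dist_nonneg q.coe_nonneg]
    change _ ≤ ENNReal.ofReal _ * _
    rw [← ENNReal.ofReal_mul (by positivity)]
    exact ENNReal.ofReal_le_ofReal (hdist v w)
  have h1 : (1 : ℝ≥0∞) ≤ dimH (h '' range X) := by
    have : dimH (Icc (0 : ℝ) 1) = 1 := by
      rw [Real.dimH_of_nonempty_interior]
      · simp
      · rw [interior_Icc]; exact ⟨1 / 2, by norm_num, by norm_num⟩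
    rw [← this]
    apply dimH_mono
    intro y hy
    obtain ⟨v, -, hv⟩ := Real.ofDigits_SurjOn hN hy
    exact ⟨X v, ⟨v, rfl⟩, by rw [hh, hv]⟩
  have h2 := h1.trans (hH.dimH_image_le hq)
  have hq0 : (q : ℝ≥0∞) ≠ 0 := by exact_mod_cast hq.ne'
  rw [ENNReal.le_div_iff_mul_le (Or.inl hq0) (Or.inl ENNReal.coe_ne_top), one_mul] at h2
  exact h2.trans (dimH_mono (subset_univ _))

/-- Iterated homotheties of ratios `t, t², t³, …` with centres chosen among `N` separated points
code a Cantor set. -/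
theorem exists_coding (hM : GeodesicSpace M) {a : M} {r s t : ℝ}
    (hs : 0 < s) (ht : 0 < t) (ht8 : t ≤ 1 / 8) (hrt : 48 * r * t ≤ s)
    (hcpt : IsCompact (closedBall a (2 * r)))
    (hcontr : ∀ x ∈ ball a (2 * r), ∀ y ∈ ball a r, ∀ y' ∈ ball a r, ∀ l ∈ Icc (0 : ℝ) 1,
      ∀ z z', IsRatioPoint x y l z → IsRatioPoint x y' l z' → 1 / 2 * l * dist y y' ≤ dist z z')
    {N : ℕ} (P : Fin N → M) (hPa : ∀ i, P i ∈ ball a r) (hP : ∀ i j, i ≠ j → s ≤ dist (P i) (P j)) :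
    ∃ X : (ℕ → Fin N) → M, ∀ v w : ℕ → Fin N, ∀ m, (∀ i < m, v i = w i) → v m ≠ w m →
      t * s / 4 * t ^ m ≤ dist (X v) (X w) := by
  rcases Nat.eq_zero_or_pos N with rfl | hN
  · exact ⟨fun _ => a, fun v => (v 0).elim0⟩
  have hr : 0 < r := pos_of_mem_ball (hPa ⟨0, hN⟩)
  have hpow : ∀ m : ℕ, t ^ m ∈ Icc (0 : ℝ) 1 := fun m =>
    ⟨by positivity, pow_le_one₀ ht.le (by linarith)⟩
  choose T hT using fun (m : ℕ) (x : M) (i : Fin N) => exists_isRatioPoint hM x (P i) (hpow m)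
  let x : (ℕ → Fin N) → ℕ → M := fun v m => Nat.rec a (fun j z => T (j + 1) z (v j)) m
  have x0 : ∀ v, x v 0 = a := fun v => rfl
  have xs : ∀ v m, x v (m + 1) = T (m + 1) (x v m) (v m) := fun v m => rfl
  have hball : ∀ v m, dist (x v m) a ≤ 2 * r * (1 - t ^ m) := by
    intro v m
    induction m with
    | zero => simp [x0]
    | succ m ih =>
      have h1 := (hT (m + 1) (x v m) (v m)).1
      rw [← xs] at h1
      have h2 : dist (x v m) (P (v m)) ≤ 3 * r := by
        have := dist_triangle_right (x v m) (P (v m)) a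
        have := mem_ball.1 (hPa (v m))
        have : 0 ≤ 2 * r * t ^ m := by positivity
        linarith
      have h3 := dist_triangle_left (x v (m + 1)) a (x v m)
      have h4 : t ^ (m + 1) * dist (x v m) (P (v m)) ≤ t ^ (m + 1) * (3 * r) := by gcongr
      have h5 : r * t ^ m * t ≤ r * t ^ m * (1 / 8) := by gcongr
      have h6 : 0 ≤ r * t ^ m := by positivity
      rw [pow_succ] at *
      nlinarith
  have hball' : ∀ v m, x v m ∈ ball a (2 * r) := fun v m => by
    rw [mem_ball]
    have := hball v m
    have : 0 < 2 * r * t ^ m := by positivity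
    linarith
  have hstep : ∀ v m, dist (x v m) (x v (m + 1)) ≤ 3 * r * t * t ^ m := by
    intro v m
    have h1 := (hT (m + 1) (x v m) (v m)).1
    rw [← xs] at h1
    have h2 : dist (x v m) (P (v m)) ≤ 3 * r := by
      have := dist_triangle_right (x v m) (P (v m)) a
      have := mem_ball.1 (hPa (v m))
      have := mem_ball.1 (hball' v m)
      linarith
    calc _ = t ^ (m + 1) * dist (x v m) (P (v m)) := h1
      _ ≤ t ^ (m + 1) * (3 * r) := by gcongr
      _ = _ := by ring
  have ht1 : t < 1 := by linarith
  choose X hX using fun v => (cauchySeq_tendsto_of_isComplete hcpt.isComplete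
    (fun m => ball_subset_closedBall (hball' v m))
    (cauchySeq_of_le_geometric t _ ht1 (hstep v)))
  have htail : ∀ v m, dist (x v (m + 1)) (X v) ≤ t ^ m * (t * s / 8) := by
    intro v m
    refine (dist_le_of_le_geometric_of_tendsto t _ ht1 (hstep v) (hX v).2 (m + 1)).trans ?_
    rw [div_le_iff₀ (by linarith), pow_succ]
    have h1 : 0 ≤ t ^ m * t := by positivity
    have h2 : t ^ m * t * (48 * r * t) ≤ t ^ m * t * s := by gcongr
    have h3 : t ^ m * t * s * t ≤ t ^ m * t * s * (1 / 8) := by gcongr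
    have h4 : 0 ≤ t ^ m * t * s := by positivity
    nlinarith
  refine ⟨X, fun v w m hlt hne => ?_⟩
  have heq : ∀ j ≤ m, x v j = x w j := by
    intro j
    induction j with
    | zero => intro _; rfl
    | succ j ih => intro hj; rw [xs, xs, ih (by omega), hlt j (by omega)]
  have h1 := hcontr (x v m) (hball' v m) _ (hPa (v m)) _ (hPa (w m)) _ (hpow (m + 1)) _ _
    (hT (m + 1) (x v m) (v m)) (hT (m + 1) (x v m) (w m))
  rw [← xs, heq m le_rfl, ← xs] at h1
  have h2 : t ^ (m + 1) * s ≤ t ^ (m + 1) * dist (P (v m)) (P (w m)) := by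
    gcongr; exact hP _ _ hne
  have h3 := htail v m
  have h4 := htail w m
  have h5 := dist_triangle4_right (x v (m + 1)) (X v) (x w (m + 1)) (X w)
  have h6 := dist_triangle4 (x v (m + 1)) (X v) (X w) (x w (m + 1))
  rw [dist_comm (X w)] at h6
  rw [pow_succ] at *
  nlinarith

end SelfSimilar

section LocallyFinite

variable {M : Type*} [MetricSpace M]

theorem AlexandrovSpace.exists_card_le {n : ℕ} {k : ℝ} (hM : AlexandrovSpace M n k) (a : M) :
    ∃ r > 0, ∀ s, 0 < s → s ≤ r → ∀ P : Finset M, ↑P ⊆ ball a r →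
      (P : Set M).Pairwise (fun x y => s ≤ dist x y) → (P.card : ℝ) ≤ (48 * r / s) ^ n := by
  have := hM.curv.locallyCompact
  obtain ⟨R, hR, hcon⟩ := hM.curv.exists_mul_dist_le a
  obtain ⟨e, he, hcon⟩ := hcon (1 / 2) (by norm_num)
  obtain ⟨ρ, hρ, hcpt⟩ := exists_isCompact_closedBall a
  obtain ⟨r, hr, h1, h2, h3⟩ : ∃ r > 0, 2 * r ≤ R ∧ 3 * r ≤ e ∧ 2 * r ≤ ρ := by
    refine ⟨min (R / 2) (min (e / 3) (ρ / 2)), by positivity, ?_, ?_, ?_⟩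
    · linarith [min_le_left (R / 2) (min (e / 3) (ρ / 2))]
    · linarith [min_le_right (R / 2) (min (e / 3) (ρ / 2)), min_le_left (e / 3) (ρ / 2)]
    · linarith [min_le_right (R / 2) (min (e / 3) (ρ / 2)), min_le_right (e / 3) (ρ / 2)]
  refine ⟨r, hr, fun s hs hsr P hPa hP => ?_⟩
  have hone : (1 : ℝ) ≤ 48 * r / s := by rw [le_div_iff₀ hs]; linarith
  rcases le_or_gt P.card 1 with hN | hN
  · calc (P.card : ℝ) ≤ 1 := by exact_mod_cast hN
      _ ≤ _ := one_le_pow₀ hone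
  set t := s / (48 * r) with ht
  have ht0 : 0 < t := by positivity
  have ht1 : t ≤ 1 / 8 := by rw [ht, div_le_iff₀ (by positivity)]; linarith
  let p : Fin P.card → M := fun i => (P.equivFin.symm i : M)
  obtain ⟨X, hX⟩ := exists_coding hM.curv.geodesic hs ht0 ht1
    (show 48 * r * t ≤ s by rw [ht, mul_div_cancel₀ _ (by positivity)])
    (hcpt.of_isClosed_subset isClosed_closedBall (closedBall_subset_closedBall h3))
    (fun x hx y hy y' hy' l hl z z' hz hz' => by
      refine hcon x (ball_subset_ball h1 hx) y (ball_subset_ball (by linarith) hy) y'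
        (ball_subset_ball (by linarith) hy') ?_ ?_ l hl z z' hz hz'
      · have := dist_triangle_right x y a
        rw [mem_ball] at *
        linarith
      · have := dist_triangle_right x y' a
        rw [mem_ball] at *
        linarith)
    p (fun i => hPa (P.equivFin.symm i).2)
    (fun i j hij => hP (P.equivFin.symm i).2 (P.equivFin.symm j).2
      (fun h => hij (P.equivFin.symm.injective (Subtype.ext h))))
  have hN' : (1 : ℝ) < P.card := by exact_mod_cast hN
  have hlogN : 0 < Real.log P.card := Real.log_pos hN'
  have hlogt : Real.log t < 0 := Real.log_neg ht0 (by linarith)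
  have hq : 0 < Real.log P.card / -Real.log t := div_pos hlogN (by linarith)
  have hqt : ((P.card : ℝ))⁻¹ = t ^ (Real.log P.card / -Real.log t) := by
    rw [Real.rpow_def_of_pos ht0, div_neg, mul_neg, mul_div_cancel₀ _ hlogt.ne, Real.exp_neg,
      Real.exp_log (by linarith)]
  obtain ⟨q, hqv⟩ : ∃ q : ℝ≥0, (q : ℝ) = Real.log P.card / -Real.log t := ⟨⟨_, hq.le⟩, rfl⟩
  rw [← hqv] at hq hqt
  have h := le_dimH_of_coding hN ht0 (show 0 < t * s / 4 by positivity) X hX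
    (q := q) (by exact_mod_cast hq) hqt.le
  rw [hM.dim] at h
  have hqn : (q : ℝ) ≤ n := by exact_mod_cast h
  have : t ^ n ≤ (P.card : ℝ)⁻¹ := by
    rw [hqt, ← Real.rpow_natCast]
    exact Real.rpow_le_rpow_of_exponent_ge ht0 (by linarith) hqn
  calc (P.card : ℝ) ≤ (t ^ n)⁻¹ := by
        rw [le_inv_comm₀ (by linarith) (by positivity)]; exact this
    _ = _ := by rw [← inv_pow, ht, inv_div]

/-- The volume of an Alexandrov space is locally finite. -/
theorem AlexandrovSpace.exists_measure_ball_lt_top {n : ℕ} {k : ℝ} [MeasurableSpace M]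
    [BorelSpace M] (hM : AlexandrovSpace M n k) (a : M) :
    ∃ r > 0, μH[(n : ℝ)] (ball a r) < ∞ := by
  obtain ⟨r, hr, H⟩ := hM.exists_card_le a
  refine ⟨r, hr, ?_⟩
  have hcov : ∀ s, 0 < s → s ≤ r → ∃ P : Finset M, (P.card : ℝ) ≤ (48 * r / s) ^ n ∧
      ball a r ⊆ ⋃ x : P, closedBall (x : M) s := by
    intro s hs hsr
    let S : Set ℕ := {m | ∃ P : Finset M, ↑P ⊆ ball a r ∧
      (P : Set M).Pairwise (fun x y => s ≤ dist x y) ∧ P.card = m}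
    have hS0 : S.Nonempty := ⟨0, ∅, by simp⟩
    have hSb : BddAbove S := by
      refine ⟨⌊(48 * r / s) ^ n⌋₊, ?_⟩
      rintro m ⟨P, hP1, hP2, rfl⟩
      exact Nat.le_floor (H s hs hsr P hP1 hP2)
    obtain ⟨P, hP1, hP2, hP3⟩ := Nat.sSup_mem hS0 hSb
    refine ⟨P, H s hs hsr P hP1 hP2, fun x hx => ?_⟩
    by_contra hcon
    simp only [mem_iUnion, mem_closedBall, Subtype.exists, not_exists, not_le] at hcon
    classical
    have hxP : x ∉ P := fun h => by
      have := hcon x h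
      rw [dist_self] at this
      linarith
    have : P.card + 1 ∈ S := by
      refine ⟨insert x P, ?_, ?_, Finset.card_insert_of_notMem hxP⟩
      · rw [Finset.coe_insert]; exact insert_subset hx hP1
      · rw [Finset.coe_insert]
        refine hP2.insert fun y hy _ => ⟨(hcon y hy).le, ?_⟩
        rw [dist_comm]; exact (hcon y hy).le
    have := le_csSup hSb this
    omega
  have hs : ∀ j : ℕ, 0 < r / (j + 1) ∧ r / (j + 1) ≤ r := fun j =>
    ⟨by positivity, div_le_self hr.le (by linarith [(Nat.cast_nonneg j : (0 : ℝ) ≤ j)])⟩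
  choose P hP1 hP2 using fun j : ℕ => hcov _ (hs j).1 (hs j).2
  have hlim : Tendsto (fun j : ℕ => ENNReal.ofReal (2 * (r / (j + 1)))) atTop (𝓝 0) := by
    rw [← ENNReal.ofReal_zero]
    refine ENNReal.tendsto_ofReal ?_
    have : Tendsto (fun j : ℕ => 2 * r * (1 / ((j : ℝ) + 1))) atTop (𝓝 (2 * r * 0)) :=
      tendsto_one_div_add_atTop_nhds_zero_nat.const_mul _
    rw [mul_zero] at this
    refine this.congr fun j => by ring
  have hdiam : ∀ (j : ℕ) (i : P j), ediam (closedBall (i : M) (r / (j + 1))) ≤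
      ENNReal.ofReal (2 * (r / (j + 1))) := by
    intro j i
    refine ediam_le fun x hx y hy => ?_
    rw [edist_dist]
    apply ENNReal.ofReal_le_ofReal
    have := dist_triangle_right x y (i : M)
    rw [mem_closedBall] at hx hy
    linarith
  refine lt_of_le_of_lt (Measure.hausdorffMeasure_le_liminf_sum (n : ℝ) (ball a r) _ hlim
    (fun j (i : P j) => closedBall (i : M) (r / (j + 1))) (Eventually.of_forall hdiam)
    (Eventually.of_forall hP2)) ?_
  have hbound : ∀ j, ∑ i : P j, ediam (closedBall (i : M) (r / (j + 1))) ^ (n : ℝ) ≤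
      ENNReal.ofReal ((96 * r) ^ n) := by
    intro j
    calc _ ≤ ∑ i : P j, ENNReal.ofReal (2 * (r / (j + 1))) ^ (n : ℝ) :=
          Finset.sum_le_sum fun i _ => ENNReal.rpow_le_rpow (hdiam j i) (Nat.cast_nonneg n)
      _ = ENNReal.ofReal ((P j).card * (2 * (r / (j + 1))) ^ n) := by
          have := (hs j).1
          rw [Finset.sum_const, Finset.card_univ, Fintype.card_coe, nsmul_eq_mul,
            ENNReal.rpow_natCast, ENNReal.ofReal_mul (Nat.cast_nonneg _),
            ENNReal.ofReal_natCast, ENNReal.ofReal_pow (by positivity)]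
      _ ≤ ENNReal.ofReal ((48 * r / (r / (j + 1))) ^ n * (2 * (r / (j + 1))) ^ n) := by
          have := (hs j).1
          apply ENNReal.ofReal_le_ofReal
          gcongr
          exact hP1 j
      _ = _ := by
          rw [← mul_pow]
          congr 2
          field_simp
          norm_num
  refine lt_of_le_of_lt (liminf_le_liminf (Eventually.of_forall hbound)) ?_
  rw [liminf_const]
  exact ENNReal.ofReal_lt_top

end LocallyFinite

section Separable

variable {M : Type*} [MetricSpace M]

/-- A metric space of finite Hausdorff dimension is second countable. -/
theorem secondCountable_of_dimH_lt_top (h : dimH (univ : Set M) < ∞) :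
    SecondCountableTopology M := by
  borelize M
  obtain ⟨d, hd⟩ := ENNReal.lt_iff_exists_nnreal_btwn.1 h
  have h0 : μH[(d : ℝ)] (univ : Set M) = 0 := hausdorffMeasure_of_dimH_lt hd.1
  rw [Measure.hausdorffMeasure_apply] at h0
  refine secondCountable_of_almost_dense_set fun ε hε => ?_
  have hε' : 0 < ENNReal.ofReal ε := ENNReal.ofReal_pos.2 hε
  have h1 := (le_iSup₂ (f := fun (r : ℝ≥0∞) (_ : 0 < r) =>
    ⨅ (t : ℕ → Set M) (_ : (univ : Set M) ⊆ ⋃ n, t n) (_ : ∀ n, ediam (t n) ≤ r),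
      ∑' n, ⨆ _ : (t n).Nonempty, ediam (t n) ^ (d : ℝ)) _ hε').trans h0.le
  have h2 := lt_of_le_of_lt h1 ENNReal.zero_lt_top
  simp only [iInf_lt_iff] at h2
  obtain ⟨t, ht, hdiam, -⟩ := h2
  classical
  refine ⟨range fun n : {n // (t n).Nonempty} => n.2.some, countable_range _, fun x => ?_⟩
  obtain ⟨n, hn⟩ := mem_iUnion.1 (ht (mem_univ x))
  refine ⟨_, ⟨⟨n, x, hn⟩, rfl⟩, ?_⟩
  have h3 := (edist_le_ediam_of_mem hn (Nonempty.some_mem ⟨x, hn⟩)).trans (hdiam n)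
  rwa [edist_dist, ENNReal.ofReal_le_ofReal_iff hε.le] at h3

end Separable

section Selection

/-- A closed relation with values in a compact metric space has a measurable selection. -/
theorem exists_measurable_selection {W K : Type*} [TopologicalSpace W] [MeasurableSpace W]
    [OpensMeasurableSpace W] [MetricSpace K] [CompactSpace K] [Nonempty K] [MeasurableSpace K]
    [BorelSpace K] {G : Set (W × K)} (hG : IsClosed G) :
    ∃ f : W → K, Measurable f ∧ ∀ w, (∃ z, (w, z) ∈ G) → (w, f w) ∈ G := by
  obtain ⟨g₀, hg₀, hs₀⟩ := exists_nat_bool_continuous_surjective_of_compact K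
  have : CompactSpace cantorSet := isCompact_iff_compactSpace.1 isCompact_cantorSet
  let g : cantorSet → K := g₀ ∘ cantorSetHomeomorphNatToBool
  have hg : Continuous g := hg₀.comp cantorSetHomeomorphNatToBool.continuous
  have hgs : Function.Surjective g := hs₀.comp cantorSetHomeomorphNatToBool.surjective
  let C : Set (W × cantorSet) := {q | (q.1, g q.2) ∈ G}
  have hC : IsClosed C := hG.preimage (by fun_prop : Continuous fun q : W × cantorSet =>
    (q.1, g q.2))
  have hproj : ∀ t : ℝ, IsClosed {w | ∃ x : cantorSet, (x : ℝ) ≤ t ∧ (w, x) ∈ C} := by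
    intro t
    have h1 : IsClosed (C ∩ {q | (q.2 : ℝ) ≤ t}) :=
      hC.inter (isClosed_le (by fun_prop) continuous_const)
    convert isClosedMap_fst_of_compactSpace _ h1 using 1
    ext w
    constructor
    · rintro ⟨x, h1, h2⟩; exact ⟨(w, x), ⟨h2, h1⟩, rfl⟩
    · rintro ⟨⟨w', x⟩, ⟨h2, h1⟩, rfl⟩; exact ⟨x, h1, h2⟩
  obtain ⟨x₀⟩ : Nonempty cantorSet := ⟨(cantorSetHomeomorphNatToBool.symm fun _ => true)⟩
  have hmin : ∀ w, ∃ x : cantorSet, ((∃ y, (w, y) ∈ C) → (w, x) ∈ C ∧ ∀ y, (w, y) ∈ C → x ≤ y) ∧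
      ((¬ ∃ y, (w, y) ∈ C) → x = x₀) := by
    intro w
    by_cases h : ∃ y, (w, y) ∈ C
    · have hcl : IsClosed {y | (w, y) ∈ C} := hC.preimage (by fun_prop)
      obtain ⟨x, hx, hx'⟩ := hcl.isCompact.exists_isLeast h
      exact ⟨x, fun _ => ⟨hx, fun y hy => hx' hy⟩, fun hn => absurd h hn⟩
    · exact ⟨x₀, fun hn => absurd hn h, fun _ => rfl⟩
  choose ξ hξ₁ hξ₂ using hmin
  have hξ : Measurable ξ := by
    have hval : Measurable fun w => (ξ w : ℝ) := by
      refine measurable_of_Iic fun t => ?_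
      have hD : MeasurableSet {w | ∃ x, (w, x) ∈ C} := by
        have h1 := (isClosedMap_fst_of_compactSpace _ hC).measurableSet
        convert h1 using 1
        ext w
        constructor
        · rintro ⟨x, hx⟩; exact ⟨(w, x), hx, rfl⟩
        · rintro ⟨⟨w', x⟩, hx, rfl⟩; exact ⟨x, hx⟩
      have heq : (fun w => (ξ w : ℝ)) ⁻¹' Iic t =
          {w | ∃ x : cantorSet, (x : ℝ) ≤ t ∧ (w, x) ∈ C} ∪
            ({w | ∃ x, (w, x) ∈ C}ᶜ ∩ {_w | (x₀ : ℝ) ≤ t}) := by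
        ext w
        simp only [mem_preimage, mem_Iic, mem_union, mem_inter_iff, mem_compl_iff, mem_ofPred_eq]
        by_cases h : ∃ x, (w, x) ∈ C
        · constructor
          · exact fun hle => Or.inl ⟨ξ w, hle, (hξ₁ w h).1⟩
          · rintro (⟨x, hx, hxC⟩ | ⟨hn, -⟩)
            · exact le_trans (Subtype.coe_le_coe.2 ((hξ₁ w h).2 x hxC)) hx
            · exact absurd h hn
        · rw [hξ₂ w h]
          constructor
          · exact fun hle => Or.inr ⟨h, hle⟩
          · rintro (⟨x, hx, hxC⟩ | ⟨-, hle⟩)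
            · exact absurd ⟨x, hxC⟩ h
            · exact hle
      rw [heq]
      exact (hproj t).measurableSet.union (hD.compl.inter (MeasurableSet.const _))
    exact hval.subtype_mk
  refine ⟨g ∘ ξ, hg.measurable.comp hξ, fun w ⟨z, hz⟩ => ?_⟩
  obtain ⟨y, rfl⟩ := hgs z
  exact (hξ₁ w ⟨y, hz⟩).1

variable {M : Type*} [MetricSpace M] [SecondCountableTopology M] [MeasurableSpace M]
  [BorelSpace M]

theorem exists_measurable_ratioPoint (hM : GeodesicSpace M) {a : M} {R s : ℝ} (hR : 0 ≤ R)
    (hK : IsCompact (closedBall a R)) (hs : s ∈ Icc (0 : ℝ) 1) :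
    ∃ S : M × M → M, Measurable S ∧ ∀ x ∈ closedBall a (R / 3), ∀ y ∈ closedBall a (R / 3),
      IsRatioPoint x y s (S (x, y)) := by
  have : CompactSpace (closedBall a R) := isCompact_iff_compactSpace.1 hK
  have : Nonempty (closedBall a R) := ⟨⟨a, mem_closedBall_self hR⟩⟩
  let G : Set ((M × M) × closedBall a R) := {q | IsRatioPoint q.1.1 q.1.2 s q.2}
  have hG : IsClosed G := by
    simp only [G, IsRatioPoint]
    exact (isClosed_eq (by fun_prop) (by fun_prop)).inter (isClosed_eq (by fun_prop) (by fun_prop))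
  obtain ⟨f, hf, hfG⟩ := exists_measurable_selection hG
  refine ⟨fun w => f w, measurable_subtype_coe.comp hf, fun x hx y hy => ?_⟩
  obtain ⟨z, hz⟩ := exists_isRatioPoint hM x y hs
  refine hfG (x, y) ⟨⟨z, ?_⟩, hz⟩
  rw [mem_closedBall] at *
  have h1 := dist_triangle_left z a x
  have h2 := dist_triangle_right x y a
  have h3 := mul_le_of_le_one_left (dist_nonneg (x := x) (y := y)) hs.2
  rw [hz.1] at h1
  linarith

end Selection

section MeasureContraction

variable {M : Type*} [MetricSpace M] [MeasurableSpace M] [BorelSpace M]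

/-- Change of variables inequality for an expanding map and the Hausdorff measure. -/
theorem setLIntegral_comp_le_of_expanding (n : ℕ) {c : ℝ} (hc : 0 < c) {T : M → M}
    (hT : Measurable T) {A B : Set M} (hAB : MapsTo T A B)
    (hexp : ∀ y ∈ A, ∀ y' ∈ A, c * dist y y' ≤ dist (T y) (T y')) {f : M → ℝ≥0∞}
    (hf : Measurable f) :
    ∫⁻ y in A, f (T y) ∂μH[(n : ℝ)] ≤
      ENNReal.ofReal (c⁻¹ ^ n) * ∫⁻ z in B, f z ∂μH[(n : ℝ)] := by
  rcases isEmpty_or_nonempty M with hM | hM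
  · have : (A : Set M) = ∅ := Set.eq_empty_of_isEmpty A
    simp [this]
  have hle : (Measure.map T ((μH[(n : ℝ)] : Measure M).restrict A)) ≤
      ENNReal.ofReal (c⁻¹ ^ n) • (μH[(n : ℝ)] : Measure M).restrict B := by
    refine Measure.le_iff.2 fun E hE => ?_
    rw [Measure.map_apply hT hE, Measure.restrict_apply (hT hE), Measure.smul_apply,
      Measure.restrict_apply hE, smul_eq_mul]
    set V := T ⁻¹' E ∩ A with hV
    have hinj : InjOn T V := by
      intro y hy y' hy' h
      have := hexp y hy.2 y' hy'.2
      rw [h, dist_self] at this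
      exact dist_le_zero.1 (nonpos_of_mul_nonpos_right this hc)
    have hLip : LipschitzOnWith (Real.toNNReal c⁻¹) (Function.invFunOn T V) (T '' V) := by
      refine LipschitzOnWith.of_dist_le_mul ?_
      rintro _ ⟨y, hy, rfl⟩ _ ⟨y', hy', rfl⟩
      rw [hinj.leftInvOn_invFunOn hy, hinj.leftInvOn_invFunOn hy',
        Real.coe_toNNReal _ (inv_nonneg.2 hc.le), inv_mul_eq_div, le_div_iff₀ hc, mul_comm]
      exact hexp y hy.2 y' hy'.2
    have h := hLip.hausdorffMeasure_image_le (d := (n : ℝ)) (Nat.cast_nonneg n)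
    rw [hinj.leftInvOn_invFunOn.image_image, ENNReal.rpow_natCast] at h
    refine h.trans ?_
    rw [ENNReal.ofReal_pow (inv_nonneg.2 hc.le)]
    refine mul_le_mul_right (measure_mono ?_) _
    rintro _ ⟨y, hy, rfl⟩
    exact ⟨hy.1, hAB hy.2⟩
  calc _ = ∫⁻ z, f z ∂(Measure.map T ((μH[(n : ℝ)] : Measure M).restrict A)) :=
        (lintegral_map hf hT).symm
    _ ≤ _ := lintegral_mono' hle le_rfl
    _ = _ := by rw [lintegral_smul_measure, smul_eq_mul]

/-- Pairs of points at distance less than `r` whose first point is in `B`. -/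
def nearPairs (B : Set M) (r : ℝ) : Set (M × M) := {q | q.1 ∈ B ∧ dist q.1 q.2 < r}

variable [SecondCountableTopology M]

theorem measurableSet_nearPairs {B : Set M} (hB : MeasurableSet B) (r : ℝ) :
    MeasurableSet (nearPairs B r) :=
  (measurable_fst hB).inter (measurableSet_lt (measurable_fst.dist measurable_snd) measurable_const)

theorem setLIntegral_nearPairs {μ : Measure M} [SFinite μ] {B : Set M} (hB : MeasurableSet B)
    (r : ℝ) {F : M × M → ℝ≥0∞} (hF : Measurable F) :
    ∫⁻ q in nearPairs B r, F q ∂(μ.prod μ) = ∫⁻ x in B, ∫⁻ y in ball x r, F (x, y) ∂μ ∂μ := by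
  rw [← lintegral_indicator (measurableSet_nearPairs hB r),
    lintegral_prod _ (hF.indicator (measurableSet_nearPairs hB r)).aemeasurable,
    ← lintegral_indicator hB]
  congr 1 with x
  by_cases hx : x ∈ B
  · rw [indicator_of_mem hx, ← lintegral_indicator measurableSet_ball]
    congr 1 with y
    simp only [indicator, nearPairs, mem_ofPred_eq, hx, true_and, mem_ball, dist_comm y x]
  · rw [indicator_of_notMem hx]
    simp [indicator, nearPairs, hx]

theorem setLIntegral_nearPairs_symm {μ : Measure M} [SFinite μ] {B : Set M}
    (hB : MeasurableSet B) (r : ℝ) {F : M × M → ℝ≥0∞} (hF : Measurable F) :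
    ∫⁻ q in nearPairs B r, F q ∂(μ.prod μ) =
      ∫⁻ y, ∫⁻ x in B ∩ ball y r, F (x, y) ∂μ ∂μ := by
  rw [← lintegral_indicator (measurableSet_nearPairs hB r),
    lintegral_prod_symm _ (hF.indicator (measurableSet_nearPairs hB r)).aemeasurable]
  congr 1 with y
  rw [← lintegral_indicator (hB.inter measurableSet_ball)]
  rfl

end MeasureContraction

section Chains

variable {M : Type*} [MetricSpace M]

theorem IsRatioPoint.trans {x y z w : M} {s t : ℝ} (hz : IsRatioPoint x y t z)
    (hw : IsRatioPoint x z s w) : IsRatioPoint x y (s * t) w := by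
  have h1 : dist x w = s * t * dist x y := by rw [hw.1, hz.1, mul_assoc]
  refine ⟨h1, le_antisymm ?_ ?_⟩
  · calc dist w y ≤ dist w z + dist z y := dist_triangle _ _ _
      _ = _ := by rw [hw.2, hz.2, hz.1]; ring
  · have := dist_triangle x w y
    linarith

variable [MeasurableSpace M] [BorelSpace M] [SecondCountableTopology M]

theorem setLIntegral_nearPairs_fst_comp_le (n : ℕ) [SFinite (μH[(n : ℝ)] : Measure M)] {c : ℝ}
    (hc : 0 < c) {T : M × M → M} (hT : Measurable T) {B : Set M} (hB : MeasurableSet B)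
    {r r' : ℝ} (hmap : ∀ x ∈ B, ∀ y, dist x y < r → dist x (T (x, y)) < r')
    (hexp : ∀ x ∈ B, ∀ y y', dist x y < r → dist x y' < r →
      c * dist y y' ≤ dist (T (x, y)) (T (x, y'))) {F : M × M → ℝ≥0∞} (hF : Measurable F) :
    ∫⁻ q in nearPairs B r, F (q.1, T q) ∂((μH[(n : ℝ)]).prod μH[(n : ℝ)]) ≤
      ENNReal.ofReal (c⁻¹ ^ n) *
        ∫⁻ q in nearPairs B r', F q ∂((μH[(n : ℝ)]).prod μH[(n : ℝ)]) := by
  rw [setLIntegral_nearPairs hB r (by fun_prop), setLIntegral_nearPairs hB r' hF,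
    ← lintegral_const_mul _ (by
      have : Measurable fun x => ∫⁻ y, (nearPairs univ r').indicator F (x, y) ∂μH[(n : ℝ)] :=
        (hF.indicator (measurableSet_nearPairs .univ r')).lintegral_prod_right'
      convert this using 2 with x
      rw [← lintegral_indicator measurableSet_ball]
      congr 1 with y
      simp [indicator, nearPairs, dist_comm])]
  refine setLIntegral_mono' hB fun x hx => ?_
  refine setLIntegral_comp_le_of_expanding n hc (f := fun z => F (x, z)) (T := fun y => T (x, y))
    (by fun_prop) (fun y hy => ?_) (fun y hy y' hy' => ?_) (by fun_prop)
  · rw [mem_ball'] at *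
    exact hmap x hx y hy
  · rw [mem_ball'] at *
    exact hexp x hx y y' hy hy'

theorem setLIntegral_nearPairs_snd_comp_le (n : ℕ) [SFinite (μH[(n : ℝ)] : Measure M)] {c : ℝ}
    (hc : 0 < c) {T : M × M → M} (hT : Measurable T) {B : Set M} (hB : MeasurableSet B)
    {r r' : ℝ} (hmap : ∀ x ∈ B, ∀ y, dist x y < r → dist (T (x, y)) y < r')
    (hexp : ∀ x ∈ B, ∀ x' ∈ B, ∀ y, dist x y < r → dist x' y < r →
      c * dist x x' ≤ dist (T (x, y)) (T (x', y))) {F : M × M → ℝ≥0∞} (hF : Measurable F) :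
    ∫⁻ q in nearPairs B r, F (T q, q.2) ∂((μH[(n : ℝ)]).prod μH[(n : ℝ)]) ≤
      ENNReal.ofReal (c⁻¹ ^ n) *
        ∫⁻ q in nearPairs univ r', F q ∂((μH[(n : ℝ)]).prod μH[(n : ℝ)]) := by
  rw [setLIntegral_nearPairs_symm hB r (by fun_prop), setLIntegral_nearPairs_symm .univ r' hF,
    ← lintegral_const_mul _ (by
      have : Measurable fun y => ∫⁻ x, (nearPairs univ r').indicator F (x, y) ∂μH[(n : ℝ)] :=
        (hF.indicator (measurableSet_nearPairs .univ r')).lintegral_prod_left'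
      convert this using 2 with y
      rw [← lintegral_indicator (MeasurableSet.univ.inter measurableSet_ball)]
      rfl)]
  refine lintegral_mono fun y => ?_
  refine setLIntegral_comp_le_of_expanding n hc (f := fun z => F (z, y)) (T := fun x => T (x, y))
    (by fun_prop) (fun x hx => ?_) (fun x hx x' hx' => ?_) (by fun_prop)
  · exact ⟨mem_univ _, hmap x hx.1 y hx.2⟩
  · exact hexp x hx.1 x' hx'.1 y hx.2 hx'.2

end Chains

section ChainFamily

theorem IsRatioPoint.dist_lt {M : Type*} [MetricSpace M] {x y z : M} {s r : ℝ}
    (h : IsRatioPoint x y s z) (hs : 0 < s)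
    (hr : dist x y < r) : dist x z < s * r := by
  rw [h.1]; exact mul_lt_mul_of_pos_left hr hs

variable {M : Type*} [MetricSpace M] [MeasurableSpace M] [BorelSpace M]

/-- A measurable choice of subdivisions `x = Z 0, Z 1, …, Z k = y` of shortest paths from `x` to
`y` into `k` equal pieces, for `x ∈ B` and `y` at distance less than `e` from `x`, such that the
volume distortion of the associated maps on pairs of points is controlled by `l < 1`. -/
structure IsChainFamily (n : ℕ) (B : Set M) (e l : ℝ) (k : ℕ) (Z : ℕ → M × M → M) : Prop where
  meas : ∀ j, Measurable (Z j)
  last : ∀ q, Z k q = q.2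
  ratio : ∀ j ≤ k, ∀ x ∈ B, ∀ y, dist x y < e → IsRatioPoint x y ((j : ℝ) / k) (Z j (x, y))
  step : ∀ j < k, ∀ x ∈ B, ∀ y, dist x y < e →
    dist (Z j (x, y)) (Z (j + 1) (x, y)) = dist x y / k
  fst_comp : ∀ r ≤ e, ∀ j ≤ k, 0 < j → ∀ F : M × M → ℝ≥0∞, Measurable F →
    ∫⁻ q in nearPairs B r, F (q.1, Z j q) ∂((μH[(n : ℝ)]).prod μH[(n : ℝ)]) ≤
      ENNReal.ofReal ((l * (j / k))⁻¹ ^ n) *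
        ∫⁻ q in nearPairs B (j / k * r), F q ∂((μH[(n : ℝ)]).prod μH[(n : ℝ)])
  snd_comp : ∀ r ≤ e, ∀ j < k, ∀ F : M × M → ℝ≥0∞, Measurable F →
    ∫⁻ q in nearPairs B r, F (Z j q, q.2) ∂((μH[(n : ℝ)]).prod μH[(n : ℝ)]) ≤
      ENNReal.ofReal ((l * (1 - j / k))⁻¹ ^ n) *
        ∫⁻ q in nearPairs univ ((1 - j / k) * r), F q ∂((μH[(n : ℝ)]).prod μH[(n : ℝ)])
  step_comp : ∀ r ≤ e, ∀ j < k, ∀ F : M × M → ℝ≥0∞, Measurable F →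
    ∫⁻ q in nearPairs B r, F (Z j q, Z (j + 1) q) ∂((μH[(n : ℝ)]).prod μH[(n : ℝ)]) ≤
      ENNReal.ofReal ((l ^ 2 / k)⁻¹ ^ n) *
        ∫⁻ q in nearPairs univ (r / k), F q ∂((μH[(n : ℝ)]).prod μH[(n : ℝ)])

theorem exists_isChainFamily [SecondCountableTopology M] {n : ℕ} {κ : ℝ}
    (hM : CurvBddBelow M κ) [SFinite (μH[(n : ℝ)] : Measure M)] (a : M) :
    ∃ R > 0, ∀ l, 0 < l → l < (1 : ℝ) → ∃ e > 0, ∀ k : ℕ, 0 < k →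
      ∃ Z, IsChainFamily n (ball a R) e l k Z := by
  have := hM.locallyCompact
  obtain ⟨R₀, hR₀, hcon⟩ := hM.exists_mul_dist_le a
  obtain ⟨ρ, hρ, hcpt⟩ := exists_isCompact_closedBall a
  obtain ⟨R, hR, hR1, hR2⟩ : ∃ R > 0, 2 * R ≤ R₀ ∧ 2 * R ≤ ρ / 3 :=
    ⟨min (R₀ / 2) (ρ / 6), by positivity, by linarith [min_le_left (R₀ / 2) (ρ / 6)],
      by linarith [min_le_right (R₀ / 2) (ρ / 6)]⟩
  refine ⟨R, hR, fun l hl0 hl1 => ?_⟩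
  obtain ⟨e₀, he₀, hcon⟩ := hcon l hl1
  refine ⟨min e₀ R, by positivity, fun k hk => ?_⟩
  have he1 : min e₀ R ≤ e₀ := min_le_left _ _
  have he2 : min e₀ R ≤ R := min_le_right _ _
  set e := min e₀ R with he
  have hbig : ∀ x ∈ ball a R, ∀ y, dist x y < e → y ∈ ball a (2 * R) := by
    intro x hx y hxy
    have := dist_triangle_left y a x
    rw [mem_ball] at *
    linarith
  have hR0 : ball a (2 * R) ⊆ ball a R₀ := ball_subset_ball hR1
  have hRR : ball a R ⊆ ball a (2 * R) := ball_subset_ball (by linarith)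
  have hρ' : ball a (2 * R) ⊆ closedBall a (ρ / 3) :=
    ball_subset_closedBall.trans (closedBall_subset_closedBall hR2)
  have hunit : ∀ j : ℕ, (j : ℝ) / (j + 1) ∈ Icc (0 : ℝ) 1 := fun j =>
    ⟨by positivity, (div_le_one (by positivity)).2 (by linarith)⟩
  choose S hSm hS using fun j : ℕ =>
    exists_measurable_ratioPoint hM.geodesic hρ.le hcpt (hunit j)
  let W : ℕ → M × M → M := fun i => Nat.rec Prod.snd (fun i w q => S (k - (i + 1)) (q.1, w q)) i
  let Z : ℕ → M × M → M := fun j => W (k - j)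
  have hZk : ∀ q, Z k q = q.2 := fun q => by simp [Z, W]
  have hZs : ∀ j < k, ∀ q, Z j q = S j (q.1, Z (j + 1) q) := by
    intro j hj q
    have h1 : k - j = (k - (j + 1)) + 1 := by omega
    have h2 : k - ((k - (j + 1)) + 1) = j := by omega
    simp only [Z]
    conv_lhs => rw [h1]
    change S (k - ((k - (j + 1)) + 1)) (q.1, W (k - (j + 1)) q) = _
    rw [h2]
  have hmeas : ∀ j, Measurable (Z j) := by
    have : ∀ i, Measurable (W i) := by
      intro i
      induction i with
      | zero => exact measurable_snd
      | succ i ih => exact (hSm _).comp (measurable_fst.prodMk ih)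
    exact fun j => this _
  have hk' : (0 : ℝ) < k := by exact_mod_cast hk
  have hratio : ∀ j ≤ k, ∀ x ∈ ball a R, ∀ y, dist x y < e →
      IsRatioPoint x y ((j : ℝ) / k) (Z j (x, y)) := by
    intro j hj x hx y hxy
    induction hj using Nat.decreasingInduction with
    | self =>
      rw [hZk, div_self hk'.ne']
      exact ⟨by rw [one_mul], by rw [dist_self]; ring⟩
    | of_succ j hj ih =>
      have hlt : dist x (Z (j + 1) (x, y)) < e := by
        refine lt_of_le_of_lt ?_ hxy
        rw [ih.1]
        refine mul_le_of_le_one_left dist_nonneg ((div_le_one hk').2 ?_)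
        exact_mod_cast hj
      have h1 := hS j x (hρ' (hRR hx)) _ (hρ' (hbig x hx _ hlt))
      have h2 := ih.trans h1
      rw [hZs j hj]
      convert h2 using 1
      push_cast
      field_simp
  have hlt : ∀ j ≤ k, ∀ x ∈ ball a R, ∀ y, dist x y < e → dist x (Z j (x, y)) < e := by
    intro j hj x hx y hxy
    refine lt_of_le_of_lt ?_ hxy
    rw [(hratio j hj x hx y hxy).1]
    refine mul_le_of_le_one_left dist_nonneg ((div_le_one hk').2 ?_)
    exact_mod_cast hj
  have hexpand : ∀ s ∈ Icc (0 : ℝ) 1, ∀ x ∈ ball a R, ∀ y y', dist x y < e → dist x y' < e →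
      ∀ z z', IsRatioPoint x y s z → IsRatioPoint x y' s z' → l * s * dist y y' ≤ dist z z' := by
    intro s hs x hx y y' hxy hxy' z z' hz hz'
    exact hcon x (hR0 (hRR hx)) y (hR0 (hbig x hx y hxy)) y' (hR0 (hbig x hx y' hxy'))
      (hxy.trans_le he1) (hxy'.trans_le he1) s hs z z' hz hz'
  have hexpand' : ∀ s ∈ Icc (0 : ℝ) 1, ∀ x ∈ ball a R, ∀ x' ∈ ball a R, ∀ y, dist x y < e →
      dist x' y < e → ∀ z z', IsRatioPoint x y s z → IsRatioPoint x' y s z' →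
      l * (1 - s) * dist x x' ≤ dist z z' := by
    intro s hs x hx x' hx' y hxy hxy' z z' hz hz'
    exact hcon y (hR0 (hbig x hx y hxy)) x (hR0 (hRR hx)) x' (hR0 (hRR hx'))
      (by rw [dist_comm]; exact hxy.trans_le he1) (by rw [dist_comm]; exact hxy'.trans_le he1)
      (1 - s) ⟨by linarith [hs.2], by linarith [hs.1]⟩ z z' hz.symm hz'.symm
  have hjk : ∀ j ≤ k, (j : ℝ) / k ∈ Icc (0 : ℝ) 1 := fun j hj =>
    ⟨by positivity, (div_le_one hk').2 (by exact_mod_cast hj)⟩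
  have hfst : ∀ r ≤ e, ∀ j ≤ k, 0 < j → ∀ F : M × M → ℝ≥0∞, Measurable F →
      ∫⁻ q in nearPairs (ball a R) r, F (q.1, Z j q) ∂((μH[(n : ℝ)]).prod μH[(n : ℝ)]) ≤
      ENNReal.ofReal ((l * (j / k))⁻¹ ^ n) *
        ∫⁻ q in nearPairs (ball a R) (j / k * r), F q ∂((μH[(n : ℝ)]).prod μH[(n : ℝ)]) := by
    intro r hr j hj hj0 F hF
    have hj0' : (0 : ℝ) < j / k := by positivity
    refine setLIntegral_nearPairs_fst_comp_le n (by positivity) (hmeas j) measurableSet_ball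
      (fun x hx y hy => ?_) (fun x hx y y' hy hy' => ?_) hF
    · exact (hratio j hj x hx y (hy.trans_le hr)).dist_lt hj0' hy
    · exact hexpand _ (hjk j hj) x hx y y' (hy.trans_le hr) (hy'.trans_le hr) _ _
        (hratio j hj x hx y (hy.trans_le hr)) (hratio j hj x hx y' (hy'.trans_le hr))
  refine ⟨Z, hmeas, hZk, hratio, ?_, hfst, ?_, ?_⟩
  · intro j hj x hx y hxy
    have h1 := hS j x (hρ' (hRR hx)) _ (hρ' (hbig x hx _ (hlt (j + 1) hj x hx y hxy)))
    rw [hZs j hj, h1.2, (hratio (j + 1) hj x hx y hxy).1]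
    push_cast
    field_simp
    ring
  · intro r hr j hj F hF
    have hj0' : (0 : ℝ) < 1 - j / k := by
      rw [sub_pos, div_lt_one hk']; exact_mod_cast hj
    refine setLIntegral_nearPairs_snd_comp_le n (by positivity) (hmeas j) measurableSet_ball
      (fun x hx y hy => ?_) (fun x hx x' hx' y hy hy' => ?_) hF
    · rw [(hratio j hj.le x hx y (hy.trans_le hr)).2]
      exact mul_lt_mul_of_pos_left hy hj0'
    · exact hexpand' _ (hjk j hj.le) x hx x' hx' y (hy.trans_le hr) (hy'.trans_le hr) _ _
        (hratio j hj.le x hx y (hy.trans_le hr)) (hratio j hj.le x' hx' y (hy'.trans_le hr))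
  · intro r hr j hj F hF
    have h1 := hfst r hr (j + 1) hj (Nat.succ_pos j) (fun q => F (S j q, q.2))
      (hF.comp ((hSm j).prodMk measurable_snd))
    have hle : ((j + 1 : ℕ) : ℝ) / k * r ≤ e := by
      rcases le_or_gt 0 r with h0 | h0
      · exact (mul_le_of_le_one_left h0 (hjk (j + 1) hj).2).trans hr
      · exact (mul_nonpos_of_nonneg_of_nonpos (hjk (j + 1) hj).1 h0.le).trans
          (by positivity : 0 ≤ e)
    have hS' : ∀ x ∈ ball a R, ∀ y, dist x y < e → IsRatioPoint x y ((j : ℝ) / (j + 1))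
        (S j (x, y)) := fun x hx y hxy => hS j x (hρ' (hRR hx)) y (hρ' (hbig x hx y hxy))
    have hpos : (0 : ℝ) < 1 - j / (j + 1) := by
      rw [sub_pos, div_lt_one (by positivity)]; linarith
    have h2 := setLIntegral_nearPairs_snd_comp_le n (c := l * (1 - j / (j + 1))) (by positivity)
      (hSm j) (measurableSet_ball (x := a) (ε := R)) (r := ((j + 1 : ℕ) : ℝ) / k * r)
      (r' := r / k)
      (fun x hx y hy => by
        rw [(hS' x hx y (hy.trans_le hle)).2]
        refine (mul_lt_mul_of_pos_left hy hpos).trans_eq ?_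
        push_cast
        field_simp
        ring)
      (fun x hx x' hx' y hy hy' => hexpand' _ (hunit j) x hx x' hx' y (hy.trans_le hle)
        (hy'.trans_le hle) _ _ (hS' x hx y (hy.trans_le hle)) (hS' x' hx' y (hy'.trans_le hle)))
      hF
    have h3 : ∀ q, F (Z j q, Z (j + 1) q) = F (S j (q.1, Z (j + 1) q), Z (j + 1) q) := fun q => by
      rw [hZs j hj]
    simp only [h3]
    refine h1.trans ((mul_le_mul_right h2 _).trans_eq ?_)
    rw [← mul_assoc, ← ENNReal.ofReal_mul (by positivity), ← mul_pow, ← mul_inv]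
    congr 4
    push_cast
    field_simp
    ring

end ChainFamily

section RpowInequalities

theorem exists_rpow_sub_le {p : ℝ} (hp : 1 < p) {κ : ℝ} (hκ : 0 < κ) :
    ∃ C, 0 ≤ C ∧ ∀ a b : ℝ, 0 ≤ a → 0 ≤ b →
      max 0 (a ^ p - b ^ p) ≤ κ * a ^ p + C * (b ^ p - a ^ p - p * a ^ (p - 1) * (b - a)) := by
  have hp0 : 0 < p := by linarith
  have hQ : ∀ t : ℝ, 0 ≤ t → 0 ≤ t ^ p - 1 - p * (t - 1) := fun t ht => by
    have := one_add_mul_self_le_rpow_one_add (s := t - 1) (by linarith) hp.le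
    rw [add_sub_cancel] at this
    linarith
  obtain ⟨C, hC, h⟩ : ∃ C, 0 ≤ C ∧ ∀ t : ℝ, 0 ≤ t → t ≤ 1 - κ / p →
      1 - t ^ p ≤ C * (t ^ p - 1 - p * (t - 1)) := by
    rcases lt_or_ge (1 - κ / p) 0 with hneg | hpos
    · exact ⟨0, le_rfl, fun t ht ht' => absurd (ht.trans ht') (not_le.2 hneg)⟩
    obtain ⟨t₀, ht₀, hmin⟩ := (isCompact_Icc (a := (0 : ℝ)) (b := 1 - κ / p)).exists_isMinOn
      (nonempty_Icc.2 hpos) (f := fun t : ℝ => t ^ p - 1 - p * (t - 1))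
      (by
        have : Continuous fun t : ℝ => t ^ p := Real.continuous_rpow_const hp0.le
        fun_prop)
    have hκp : 0 < κ / p := by positivity
    have hq : 0 < t₀ ^ p - 1 - p * (t₀ - 1) := by
      have := one_add_mul_self_lt_rpow_one_add (s := t₀ - 1) (by linarith [ht₀.1])
        (by linarith [ht₀.2]) hp
      rw [add_sub_cancel] at this
      linarith
    refine ⟨(t₀ ^ p - 1 - p * (t₀ - 1))⁻¹, by positivity, fun t ht ht' => ?_⟩
    have h1 : t₀ ^ p - 1 - p * (t₀ - 1) ≤ t ^ p - 1 - p * (t - 1) := hmin ⟨ht, ht'⟩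
    have h2 : 1 ≤ (t₀ ^ p - 1 - p * (t₀ - 1))⁻¹ * (t ^ p - 1 - p * (t - 1)) := by
      rw [inv_mul_eq_div]; exact (one_le_div hq).2 h1
    linarith [Real.rpow_nonneg ht p]
  refine ⟨C, hC, fun a b ha hb => ?_⟩
  rcases ha.eq_or_lt with rfl | ha
  · rw [Real.zero_rpow hp0.ne', Real.zero_rpow (by linarith)]
    have := Real.rpow_nonneg hb p
    simp only [zero_sub, mul_zero, sub_zero, zero_add, zero_mul]
    exact max_le (by positivity) (by linarith [mul_nonneg hC this])
  obtain ⟨t, rfl⟩ : ∃ t, b = a * t := ⟨b / a, by field_simp⟩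
  have ht : 0 ≤ t := nonneg_of_mul_nonneg_right hb ha
  have hap : 0 < a ^ p := Real.rpow_pos_of_pos ha p
  have h1 : a ^ (p - 1) * a = a ^ p := by
    rw [Real.rpow_sub_one ha.ne', div_mul_cancel₀ _ ha.ne']
  have key : max 0 (1 - t ^ p) ≤ κ + C * (t ^ p - 1 - p * (t - 1)) := by
    have hQt := mul_nonneg hC (hQ t ht)
    refine max_le (by linarith) ?_
    rcases le_or_gt t (1 - κ / p) with h' | h'
    · linarith [h t ht h']
    · have := hQ t ht
      have h3 : p * (1 - t) < κ := by
        have : 1 - t < κ / p := by linarith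
        rwa [lt_div_iff₀' hp0] at this
      linarith
  rw [Real.mul_rpow ha.le ht]
  calc max 0 (a ^ p - a ^ p * t ^ p) = a ^ p * max 0 (1 - t ^ p) := by
        rw [mul_max_of_nonneg _ _ hap.le]; congr 1 <;> ring
    _ ≤ a ^ p * (κ + C * (t ^ p - 1 - p * (t - 1))) := mul_le_mul_of_nonneg_left key hap.le
    _ = _ := by rw [← h1]; ring

theorem exists_sum_rpow_sub_le {p : ℝ} (hp : 1 < p) {κ : ℝ} (hκ : 0 < κ) :
    ∃ C, 0 ≤ C ∧ ∀ (k : ℕ) (a : ℝ) (b : ℕ → ℝ), 0 ≤ a → (∀ i, 0 ≤ b i) →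
      k * a ≤ ∑ i ∈ Finset.range k, b i →
      ∑ i ∈ Finset.range k, max 0 (a ^ p - b i ^ p) + C * k * a ^ p ≤
        κ * k * a ^ p + C * ∑ i ∈ Finset.range k, b i ^ p := by
  obtain ⟨C, hC, h⟩ := exists_rpow_sub_le hp hκ
  refine ⟨C, hC, fun k a b ha hb hab => ?_⟩
  have h1 := Finset.sum_le_sum fun i (_ : i ∈ Finset.range k) => h a (b i) ha (hb i)
  have h2 : ∑ i ∈ Finset.range k,
      (κ * a ^ p + C * (b i ^ p - a ^ p - p * a ^ (p - 1) * (b i - a))) =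
      κ * k * a ^ p + C * ∑ i ∈ Finset.range k, b i ^ p - C * k * a ^ p -
        C * (p * a ^ (p - 1)) * (∑ i ∈ Finset.range k, b i - k * a) := by
    simp only [Finset.sum_add_distrib, ← Finset.mul_sum, Finset.sum_sub_distrib,
      Finset.sum_const, Finset.card_range, nsmul_eq_mul]
    ring
  have h3 : 0 ≤ C * (p * a ^ (p - 1)) * (∑ i ∈ Finset.range k, b i - k * a) := by
    have := Real.rpow_nonneg ha (p - 1)
    have : 0 < p := by linarith
    exact mul_nonneg (by positivity) (by linarith)
  linarith

theorem exists_add_rpow_le {p : ℝ} (hp : 1 < p) {τ : ℝ} (hτ : 0 < τ) :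
    ∃ C, 0 ≤ C ∧ ∀ b c : ℝ, 0 ≤ b → 0 ≤ c → (b + c) ^ p ≤ (1 + τ) * b ^ p + C * c ^ p := by
  obtain ⟨s, ⟨hs0, hs1⟩, hs⟩ : ∃ s ∈ Ioo (0 : ℝ) 1, (1 - s) ^ (1 - p) < 1 + τ := by
    have h : Tendsto (fun s : ℝ => (1 - s) ^ (1 - p)) (𝓝[>] 0) (𝓝 1) := by
      have : ContinuousAt (fun s : ℝ => (1 - s) ^ (1 - p)) 0 :=
        (continuousAt_const.sub continuousAt_id).rpow_const (by simp)
      simpa using this.tendsto.mono_left nhdsWithin_le_nhds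
    exact (Filter.Eventually.and (Ioo_mem_nhdsGT one_pos)
      (h.eventually_lt_const (by linarith))).exists
  refine ⟨s ^ (1 - p), by positivity, fun b c hb hc => ?_⟩
  have hs' : 0 < 1 - s := by linarith
  have h := (convexOn_rpow hp.le).2 (x := b / (1 - s)) (y := c / s) (mem_Ici.2 (by positivity))
    (mem_Ici.2 (by positivity)) hs'.le hs0.le (by ring)
  have hone : ∀ t > (0 : ℝ), ∀ d ≥ (0 : ℝ), t * (d / t) ^ p = t ^ (1 - p) * d ^ p := by
    intro t ht d hd
    rw [Real.div_rpow hd ht.le, Real.rpow_sub ht, Real.rpow_one]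
    ring
  simp only [smul_eq_mul] at h
  rw [mul_div_cancel₀ _ hs'.ne', mul_div_cancel₀ _ hs0.ne', hone _ hs' _ hb, hone _ hs0 _ hc] at h
  refine h.trans ?_
  gcongr

theorem mul_le_of_cutoff {φx φz v ψ ω τ C A A' β ρ : ℝ} (hφx : 0 ≤ φx) (h1 : φx ≤ φz + ω * ψ)
    (h2 : φz ≤ φx + ω * ψ) (h3 : φx ≤ ψ) (hv : 0 ≤ v) (hvφ : v ≤ φz) (hω : 0 ≤ ω) (hω1 : ω ≤ 1)
    (hC : 0 ≤ C) (hA : 0 ≤ A) (hA' : 0 ≤ A') (hρ : 0 ≤ ρ)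
    (h : A ≤ (1 + τ) * β + C * ρ) :
    φx * A ≤ (1 + τ) * ((φz - v) * β) + 2 * C * (ψ * ρ) + v * A' + φx * max 0 (A - A') +
      2 * ω * (ψ * A) := by
  have hψ : 0 ≤ ψ := hφx.trans h3
  have hωψ : ω * ψ ≤ ψ := mul_le_of_le_one_left hψ hω1
  have e1 : φx * A ≤ (φz - v) * A + v * A + ω * (ψ * A) := by
    linarith [mul_le_mul_of_nonneg_right h1 hA]
  have e2 : (φz - v) * A ≤ (1 + τ) * ((φz - v) * β) + 2 * C * (ψ * ρ) := by
    have := mul_le_mul_of_nonneg_left h (sub_nonneg.2 hvφ)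
    have h5 : (φz - v) * (C * ρ) ≤ (2 * ψ) * (C * ρ) :=
      mul_le_mul_of_nonneg_right (by linarith) (by positivity)
    linarith
  have hm0 : 0 ≤ max 0 (A - A') := le_max_left _ _
  have hmA : max 0 (A - A') ≤ A := max_le hA (by linarith)
  have e3 : v * A ≤ v * A' + φx * max 0 (A - A') + ω * (ψ * A) := by
    have h6 : v * (A - A') ≤ v * max 0 (A - A') :=
      mul_le_mul_of_nonneg_left (le_max_right _ _) hv
    have h7 : v * max 0 (A - A') ≤ (φx + ω * ψ) * max 0 (A - A') :=
      mul_le_mul_of_nonneg_right (hvφ.trans h2) hm0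
    have h8 : ω * ψ * max 0 (A - A') ≤ ω * ψ * A :=
      mul_le_mul_of_nonneg_left hmA (by positivity)
    linarith
  linarith

end RpowInequalities

section PairEnergy

variable {M : Type*} [MetricSpace M] [MeasurableSpace M] [BorelSpace M]

omit [MeasurableSpace M] [BorelSpace M] in
theorem nearPairs_subset {B B' : Set M} (h : B ⊆ B') {r r' : ℝ} (hr : r ≤ r') :
    nearPairs B r ⊆ nearPairs B' r' := fun _ hq => And.intro (h hq.1) (hq.2.trans_le hr)

/-- The normalizing factor `(n + p) / (c_{n,p} r ^ (n + p))` of the approximating energy. -/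
def energyFactor (n : ℕ) (p r : ℝ) : ℝ := ((n : ℝ) + p) / (cnp n p * r ^ ((n : ℝ) + p))

theorem cnp_pos (n : ℕ) {p : ℝ} (hp : 0 < p) : 0 < cnp n p := by
  have h1 : 0 < Real.Gamma ((p + 1) / 2) := Real.Gamma_pos_of_pos (by positivity)
  have h2 : 0 < Real.Gamma (((n : ℝ) + p) / 2) := Real.Gamma_pos_of_pos (by positivity)
  have := Real.pi_pos
  unfold cnp
  positivity

theorem energyFactor_nonneg (n : ℕ) {p : ℝ} (hp : 0 < p) {r : ℝ} (hr : 0 < r) :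
    0 ≤ energyFactor n p r := by
  have := cnp_pos n hp
  unfold energyFactor
  positivity

theorem energyFactor_mul (n : ℕ) {p : ℝ} {r s : ℝ} (hr : 0 < r) (hs : 0 < s) :
    energyFactor n p r = energyFactor n p (s * r) * (s ^ n * s ^ p) := by
  have h : (0 : ℝ) < s ^ n * s ^ p := by positivity
  unfold energyFactor
  rw [Real.mul_rpow hs.le hr.le, Real.rpow_add hs, Real.rpow_natCast, div_mul_eq_mul_div,
    mul_left_comm (cnp n p), mul_comm _ (s ^ n * s ^ p), mul_div_mul_left _ _ h.ne']

/-- The measure on pairs of nearby points defining the approximating energy. -/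
def pairMeasure (n : ℕ) (p : ℝ) (B : Set M) (r : ℝ) : Measure (M × M) :=
  ENNReal.ofReal (energyFactor n p r) •
    ((μH[(n : ℝ)] : Measure M).prod μH[(n : ℝ)]).restrict (nearPairs B r)

theorem lintegral_pairMeasure (n : ℕ) (p : ℝ) (B : Set M) (r : ℝ) (F : M × M → ℝ≥0∞) :
    ∫⁻ q, F q ∂pairMeasure n p B r = ENNReal.ofReal (energyFactor n p r) *
      ∫⁻ q in nearPairs B r, F q ∂((μH[(n : ℝ)] : Measure M).prod μH[(n : ℝ)]) := by
  rw [pairMeasure, lintegral_smul_measure, smul_eq_mul]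

theorem pairMeasure_mono (n : ℕ) (p : ℝ) {B B' : Set M} (h : B ⊆ B') (r : ℝ) :
    pairMeasure n p B r ≤ pairMeasure n p B' r := by
  unfold pairMeasure
  gcongr
  exact nearPairs_subset h le_rfl

variable {Y : Type*} [MetricSpace Y]

/-- The approximating energy as a double integral over pairs of nearby points. -/
def pairEnergy (n : ℕ) (p : ℝ) (u : M → Y) (h : M → ℝ) (r : ℝ) : ℝ≥0∞ :=
  ∫⁻ q, ENNReal.ofReal (h q.1 * dist (u q.1) (u q.2) ^ p) ∂pairMeasure n p univ r

variable {n : ℕ} {p : ℝ} {u : M → Y} {B : Set M} {e l : ℝ} {k : ℕ} {Z : ℕ → M × M → M}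

omit [MetricSpace M] [BorelSpace M] in
theorem measurable_pairEnergy_integrand
    (hu : Measurable fun q : M × M => dist (u q.1) (u q.2)) {h : M → ℝ} (hh : Measurable h) :
    Measurable fun q : M × M => ENNReal.ofReal (h q.1 * dist (u q.1) (u q.2) ^ p) :=
  ((hh.comp measurable_fst).mul (hu.pow_const p)).ennreal_ofReal

theorem IsChainFamily.lintegral_snd_le (hZ : IsChainFamily n B e l k Z)
    (hu : Measurable fun q : M × M => dist (u q.1) (u q.2)) {h : M → ℝ} (hh : Measurable h)
    {r : ℝ} (hr : 0 < r) (hre : r ≤ e) {j : ℕ} (hj : j < k) :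
    ∫⁻ q, ENNReal.ofReal (h (Z j q) * dist (u (Z j q)) (u q.2) ^ p) ∂pairMeasure n p B r ≤
      ENNReal.ofReal ((l * (1 - j / k))⁻¹ ^ n) * pairEnergy n p u h r := by
  rw [lintegral_pairMeasure, pairEnergy, lintegral_pairMeasure, mul_left_comm]
  refine mul_le_mul_right ((hZ.snd_comp r hre j hj _
    (measurable_pairEnergy_integrand hu hh)).trans ?_) _
  refine mul_le_mul_right (lintegral_mono_set (nearPairs_subset subset_rfl ?_)) _
  have : (0 : ℝ) ≤ j / k := by positivity
  nlinarith

theorem IsChainFamily.lintegral_fst_le (hZ : IsChainFamily n B e l k Z) (hp : 0 < p) (hl : 0 < l)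
    (hu : Measurable fun q : M × M => dist (u q.1) (u q.2)) {h : M → ℝ} (hh : Measurable h)
    {r : ℝ} (hr : 0 < r) (hre : r ≤ e) {j : ℕ} (hj : j ≤ k) (hj0 : 0 < j) :
    ∫⁻ q, ENNReal.ofReal (h q.1 * dist (u q.1) (u (Z j q)) ^ p) ∂pairMeasure n p B r ≤
      ENNReal.ofReal (l⁻¹ ^ n * ((j : ℝ) / k) ^ p) * pairEnergy n p u h (j / k * r) := by
  have hk : (0 : ℝ) < k := by exact_mod_cast hj0.trans_le hj
  have hs : (0 : ℝ) < j / k := by positivity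
  refine le_trans ?_ (mul_le_mul_right (lintegral_mono' (pairMeasure_mono n p (subset_univ B) _)
    le_rfl) _)
  rw [lintegral_pairMeasure, lintegral_pairMeasure]
  refine (mul_le_mul_right (hZ.fst_comp r hre j hj hj0 _
    (measurable_pairEnergy_integrand hu hh)) _).trans_eq ?_
  rw [← mul_assoc, ← mul_assoc, ← ENNReal.ofReal_mul (energyFactor_nonneg n hp hr),
    ← ENNReal.ofReal_mul (by positivity), energyFactor_mul n (p := p) hr hs]
  congr 2
  rw [mul_inv, mul_pow, inv_pow ((j : ℝ) / k)]
  field_simp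

theorem IsChainFamily.lintegral_step_le (hZ : IsChainFamily n B e l k Z) (hp : 0 < p)
    (hl : 0 < l) (hu : Measurable fun q : M × M => dist (u q.1) (u q.2)) {h : M → ℝ}
    (hh : Measurable h) {r : ℝ} (hr : 0 < r) (hre : r ≤ e) {j : ℕ} (hj : j < k) :
    ∫⁻ q, ENNReal.ofReal (h (Z j q) * (k * dist (u (Z j q)) (u (Z (j + 1) q))) ^ p)
        ∂pairMeasure n p B r ≤
      ENNReal.ofReal ((l ^ 2)⁻¹ ^ n) * pairEnergy n p u h (r / k) := by
  have hk : (0 : ℝ) < k := by exact_mod_cast (Nat.zero_le j).trans_lt hj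
  have hm := measurable_pairEnergy_integrand (p := p) hu hh
  have h1 : ∀ q, ENNReal.ofReal (h (Z j q) * (k * dist (u (Z j q)) (u (Z (j + 1) q))) ^ p) =
      ENNReal.ofReal ((k : ℝ) ^ p) *
        ENNReal.ofReal (h (Z j q) * dist (u (Z j q)) (u (Z (j + 1) q)) ^ p) := fun q => by
    rw [← ENNReal.ofReal_mul (by positivity), Real.mul_rpow hk.le dist_nonneg, mul_left_comm]
  simp only [h1]
  have hm' : Measurable fun q =>
      ENNReal.ofReal (h (Z j q) * dist (u (Z j q)) (u (Z (j + 1) q)) ^ p) :=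
    hm.comp ((hZ.meas j).prodMk (hZ.meas (j + 1)))
  rw [lintegral_const_mul _ hm', lintegral_pairMeasure, pairEnergy, lintegral_pairMeasure]
  refine (mul_le_mul_right (mul_le_mul_right (hZ.step_comp r hre j hj _ hm) _) _).trans_eq ?_
  rw [← mul_assoc, ← mul_assoc, ← mul_assoc, ← ENNReal.ofReal_mul (by positivity),
    ← ENNReal.ofReal_mul (mul_nonneg (by positivity) (energyFactor_nonneg n hp hr)),
    ← ENNReal.ofReal_mul (by positivity), energyFactor_mul n (p := p) hr (inv_pos.2 hk)]
  congr 2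
  rw [Real.inv_rpow hk.le, div_eq_mul_inv, mul_inv, inv_inv, mul_pow, inv_pow (k : ℝ),
    inv_mul_eq_div]
  have : (0 : ℝ) < (k : ℝ) ^ p := by positivity
  field_simp

end PairEnergy

section OneStep

variable {M : Type*} [MetricSpace M] [MeasurableSpace M] [BorelSpace M]
  [SecondCountableTopology M] {Y : Type*} [MetricSpace Y] {n : ℕ} {p : ℝ} {u : M → Y} {B : Set M}
  {e l r : ℝ} {k : ℕ} {Z : ℕ → M × M → M}

theorem ae_pairMeasure {B : Set M} (hB : MeasurableSet B) {P : M × M → Prop}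
    (h : ∀ q, q.1 ∈ B → dist q.1 q.2 < r → P q) : ∀ᵐ q ∂pairMeasure n p B r, P q := by
  unfold pairMeasure
  refine Measure.ae_smul_measure ?_ _
  filter_upwards [ae_restrict_mem (measurableSet_nearPairs hB r)] with q hq using h q hq.1 hq.2

omit [SecondCountableTopology M] in
theorem IsChainFamily.zero (hZ : IsChainFamily n B e l k Z) (hk : 0 < k) {x y : M} (hx : x ∈ B)
    (hxy : dist x y < e) : Z 0 (x, y) = x := by
  have := (hZ.ratio 0 hk.le x hx y hxy).1
  rw [Nat.cast_zero, zero_div, zero_mul] at this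
  exact (dist_eq_zero.1 this).symm

omit [SecondCountableTopology M] in
theorem IsChainFamily.dist_lt (hZ : IsChainFamily n B e l k Z) {j : ℕ} (hj : j < k) {x y : M}
    (hx : x ∈ B) (hxr : dist x y < r) (hre : r ≤ e) : dist x (Z j (x, y)) < r := by
  have hk : (0 : ℝ) < k := by exact_mod_cast (Nat.zero_le j).trans_lt hj
  refine lt_of_le_of_lt ?_ hxr
  rw [(hZ.ratio j hj.le x hx y (hxr.trans_le hre)).1]
  exact mul_le_of_le_one_left dist_nonneg ((div_le_one hk).2 (by exact_mod_cast hj.le))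

/-- Integral of the excess of the map over the `i`-th piece of the chains. -/
def chainExcess (n : ℕ) (p : ℝ) (u : M → Y) (B : Set M) (k : ℕ) (Z : ℕ → M × M → M) (φ : M → ℝ)
    (r : ℝ) (i : ℕ) : ℝ≥0∞ :=
  ∫⁻ q, ENNReal.ofReal (φ q.1 * max 0 (dist (u q.1) (u q.2) ^ p -
    (k * dist (u (Z i q)) (u (Z (i + 1) q))) ^ p)) ∂pairMeasure n p B r

theorem lintegral_pairMeasure_eq_pairEnergy (hB : MeasurableSet B) {φ : M → ℝ}
    (hφB : ∀ x ∉ B, φ x = 0) :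
    ∫⁻ q, ENNReal.ofReal (φ q.1 * dist (u q.1) (u q.2) ^ p) ∂pairMeasure n p B r =
      pairEnergy n p u φ r := by
  rw [pairEnergy, lintegral_pairMeasure, lintegral_pairMeasure]
  congr 1
  rw [← lintegral_indicator (measurableSet_nearPairs hB r),
    ← lintegral_indicator (measurableSet_nearPairs .univ r)]
  congr 1 with q
  by_cases hq : q.1 ∈ B
  · simp [indicator, nearPairs, hq]
  · simp [indicator, nearPairs, hq, hφB _ hq]

theorem IsChainFamily.sum_chainExcess_le (hZ : IsChainFamily n B e l k Z) (hB : MeasurableSet B)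
    (hp : 1 < p) (hl : 0 < l) (hk : 0 < k)
    (hu : Measurable fun q : M × M => dist (u q.1) (u q.2)) (hr : 0 < r) (hre : r ≤ e)
    {κ C : ℝ} (hκ : 0 ≤ κ) (hC : 0 ≤ C)
    (hineq : ∀ (a : ℝ) (b : ℕ → ℝ), 0 ≤ a → (∀ i, 0 ≤ b i) →
      k * a ≤ ∑ i ∈ Finset.range k, b i →
      ∑ i ∈ Finset.range k, max 0 (a ^ p - b i ^ p) + C * k * a ^ p ≤
        κ * k * a ^ p + C * ∑ i ∈ Finset.range k, b i ^ p)
    {φ φ' : M → ℝ} (hφ : Measurable φ) (hφ' : Measurable φ') (hφ0 : ∀ x, 0 ≤ φ x)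
    (hφB : ∀ x ∉ B, φ x = 0) (hφφ' : ∀ x z, dist x z < r → φ x ≤ φ' z) :
    ∑ i ∈ Finset.range k, chainExcess n p u B k Z φ r i +
        ENNReal.ofReal (C * k) * pairEnergy n p u φ r ≤
      ENNReal.ofReal (κ * k) * pairEnergy n p u φ r +
        ENNReal.ofReal (C * k * (l ^ 2)⁻¹ ^ n) * pairEnergy n p u φ' (r / k) := by
  have hk' : (0 : ℝ) < k := by exact_mod_cast hk
  have hmd : ∀ i, Measurable fun q => dist (u (Z i q)) (u (Z (i + 1) q)) := fun i =>
    hu.comp ((hZ.meas i).prodMk (hZ.meas (i + 1)))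
  have hφm : Measurable fun q : M × M => φ q.1 := hφ.comp measurable_fst
  have hφm' : ∀ i, Measurable fun q : M × M => φ' (Z i q) := fun i => hφ'.comp (hZ.meas i)
  have hm1 : ∀ i, Measurable fun q => ENNReal.ofReal (φ q.1 * max 0 (dist (u q.1) (u q.2) ^ p -
      (k * dist (u (Z i q)) (u (Z (i + 1) q))) ^ p)) := fun i =>
    (hφm.mul (measurable_const.max ((hu.pow_const p).sub
      (((hmd i).const_mul _).pow_const p)))).ennreal_ofReal
  have hm2 := measurable_pairEnergy_integrand (p := p) hu hφ
  have hm3 : ∀ i, Measurable fun q =>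
      ENNReal.ofReal (φ' (Z i q) * (k * dist (u (Z i q)) (u (Z (i + 1) q))) ^ p) := fun i =>
    ((hφm' i).mul (((hmd i).const_mul _).pow_const p)).ennreal_ofReal
  have hstep : ∑ i ∈ Finset.range k, ∫⁻ q, ENNReal.ofReal
      (φ' (Z i q) * (k * dist (u (Z i q)) (u (Z (i + 1) q))) ^ p) ∂pairMeasure n p B r ≤
      k * (ENNReal.ofReal ((l ^ 2)⁻¹ ^ n) * pairEnergy n p u φ' (r / k)) := by
    refine (Finset.sum_le_card_nsmul _ _ _ fun i hi =>
      hZ.lintegral_step_le (by linarith) hl hu hφ' hr hre (Finset.mem_range.1 hi)).trans_eq ?_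
    rw [Finset.card_range, nsmul_eq_mul]
  have hconst : ENNReal.ofReal (C * k * (l ^ 2)⁻¹ ^ n) * pairEnergy n p u φ' (r / k) =
      ENNReal.ofReal C * (k * (ENNReal.ofReal ((l ^ 2)⁻¹ ^ n) * pairEnergy n p u φ' (r / k))) := by
    rw [ENNReal.ofReal_mul (by positivity), ENNReal.ofReal_mul hC, ENNReal.ofReal_natCast]
    ring
  rw [hconst]
  refine le_trans ?_ (add_le_add_right (mul_le_mul_right hstep _) _)
  unfold chainExcess
  rw [← lintegral_pairMeasure_eq_pairEnergy hB hφB, ← lintegral_finsetSum _ fun i _ => hm1 i,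
    ← lintegral_finsetSum _ fun i _ => hm3 i, ← lintegral_const_mul _ hm2,
    ← lintegral_const_mul _ hm2, ← lintegral_const_mul _ (Finset.measurable_sum _ fun i _ => hm3 i),
    ← lintegral_add_right _ (hm2.const_mul _), ← lintegral_add_left (hm2.const_mul _)]
  refine lintegral_mono_ae (ae_pairMeasure hB ?_)
  rintro ⟨x, y⟩ hx hxy
  have hsub : k * dist (u x) (u y) ≤
      ∑ i ∈ Finset.range k, k * dist (u (Z i (x, y))) (u (Z (i + 1) (x, y))) := by
    rw [← Finset.mul_sum]
    have := dist_le_range_sum_dist (fun i => u (Z i (x, y))) k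
    rw [hZ.zero hk hx (hxy.trans_le hre), hZ.last] at this
    exact mul_le_mul_of_nonneg_left this hk'.le
  have h1 := mul_le_mul_of_nonneg_left (hineq (dist (u x) (u y))
    (fun i => k * dist (u (Z i (x, y))) (u (Z (i + 1) (x, y)))) dist_nonneg
    (fun i => by positivity) hsub) (hφ0 x)
  have h2 : φ x * (C * ∑ i ∈ Finset.range k,
        (k * dist (u (Z i (x, y))) (u (Z (i + 1) (x, y)))) ^ p) ≤
      C * ∑ i ∈ Finset.range k,
        φ' (Z i (x, y)) * (k * dist (u (Z i (x, y))) (u (Z (i + 1) (x, y)))) ^ p := by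
    rw [mul_left_comm, Finset.mul_sum]
    refine mul_le_mul_of_nonneg_left (Finset.sum_le_sum fun i hi => ?_) hC
    exact mul_le_mul_of_nonneg_right
      (hφφ' _ _ (hZ.dist_lt (Finset.mem_range.1 hi) hx hxy hre)) (by positivity)
  have hφ'0 : ∀ i ∈ Finset.range k,
      0 ≤ φ' (Z i (x, y)) * (k * dist (u (Z i (x, y))) (u (Z (i + 1) (x, y)))) ^ p :=
    fun i hi => mul_nonneg ((hφ0 x).trans
      (hφφ' _ _ (hZ.dist_lt (Finset.mem_range.1 hi) hx hxy hre))) (by positivity)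
  have hnn : ∀ i ∈ Finset.range k, 0 ≤ φ x * max 0 (dist (u x) (u y) ^ p -
      (k * dist (u (Z i (x, y))) (u (Z (i + 1) (x, y)))) ^ p) :=
    fun i _ => mul_nonneg (hφ0 x) (le_max_left _ _)
  have hφ0x := hφ0 x
  simp only
  rw [← ENNReal.ofReal_sum_of_nonneg hnn, ← ENNReal.ofReal_sum_of_nonneg hφ'0,
    ← ENNReal.ofReal_mul (by positivity), ← ENNReal.ofReal_mul (by positivity),
    ← ENNReal.ofReal_mul hC, ← ENNReal.ofReal_add (Finset.sum_nonneg hnn) (by positivity),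
    ← ENNReal.ofReal_add (by positivity) (mul_nonneg hC (Finset.sum_nonneg hφ'0)),
    ← Finset.mul_sum]
  refine ENNReal.ofReal_le_ofReal ?_
  linarith

theorem IsChainFamily.pairEnergy_le (hZ : IsChainFamily n B e l k Z) (hB : MeasurableSet B)
    (hp : 1 < p) (hl : 0 < l)
    (hu : Measurable fun q : M × M => dist (u q.1) (u q.2)) (hr : 0 < r) (hre : r ≤ e)
    {τ C ω : ℝ} (hτ : 0 ≤ τ) (hC : 0 ≤ C) (hω : 0 ≤ ω) (hω1 : ω ≤ 1)
    (hineq : ∀ b c : ℝ, 0 ≤ b → 0 ≤ c → (b + c) ^ p ≤ (1 + τ) * b ^ p + C * c ^ p)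
    {φ ψ v : M → ℝ} (hφ : Measurable φ) (hψ : Measurable ψ) (hv : Measurable v)
    (hφ0 : ∀ x, 0 ≤ φ x) (hφψ : ∀ x, φ x ≤ ψ x) (hφB : ∀ x ∉ B, φ x = 0)
    (h1 : ∀ x z, dist x z < r → φ x ≤ φ z + ω * ψ x)
    (h2 : ∀ x z, dist x z < r → φ z ≤ φ x + ω * ψ x)
    (hv0 : ∀ x, 0 ≤ v x) (hvφ : ∀ x, v x ≤ φ x) {i : ℕ} (hi : i < k) (hi0 : 0 < i) :
    pairEnergy n p u φ r ≤
      ENNReal.ofReal ((1 + τ) * (l * (1 - i / k))⁻¹ ^ n) *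
          pairEnergy n p u (fun x => φ x - v x) r +
        ENNReal.ofReal (2 * C * (l⁻¹ ^ n * ((i : ℝ) / k) ^ p)) *
          pairEnergy n p u ψ (i / k * r) +
        ENNReal.ofReal ((l ^ 2)⁻¹ ^ n) * pairEnergy n p u v (r / k) +
        chainExcess n p u B k Z φ r i +
        ENNReal.ofReal (2 * ω) * pairEnergy n p u ψ r := by
  have hp0 : 0 < p := by linarith
  have hw : Measurable fun x => φ x - v x := hφ.sub hv
  have hmd : Measurable fun q => dist (u (Z i q)) (u (Z (i + 1) q)) :=
    hu.comp ((hZ.meas i).prodMk (hZ.meas (i + 1)))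
  have hψ0 : ∀ x, 0 ≤ ψ x := fun x => (hφ0 x).trans (hφψ x)
  have hs : (0 : ℝ) ≤ 1 - i / k := by
    rw [sub_nonneg]
    exact div_le_one_of_le₀ (by exact_mod_cast hi.le) (Nat.cast_nonneg k)
  have m1 : Measurable fun q => ENNReal.ofReal ((φ (Z i q) - v (Z i q)) *
      dist (u (Z i q)) (u q.2) ^ p) :=
    ((hw.comp (hZ.meas i)).mul
      ((hu.comp ((hZ.meas i).prodMk measurable_snd)).pow_const p)).ennreal_ofReal
  have m2 : Measurable fun q => ENNReal.ofReal (ψ q.1 * dist (u q.1) (u (Z i q)) ^ p) :=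
    ((hψ.comp measurable_fst).mul
      ((hu.comp (measurable_fst.prodMk (hZ.meas i))).pow_const p)).ennreal_ofReal
  have m3 : Measurable fun q => ENNReal.ofReal (v (Z i q) *
      (k * dist (u (Z i q)) (u (Z (i + 1) q))) ^ p) :=
    ((hv.comp (hZ.meas i)).mul ((hmd.const_mul _).pow_const p)).ennreal_ofReal
  have m4 : Measurable fun q => ENNReal.ofReal (φ q.1 * max 0 (dist (u q.1) (u q.2) ^ p -
      (k * dist (u (Z i q)) (u (Z (i + 1) q))) ^ p)) :=
    ((hφ.comp measurable_fst).mul (measurable_const.max ((hu.pow_const p).sub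
      ((hmd.const_mul _).pow_const p)))).ennreal_ofReal
  have m5 := measurable_pairEnergy_integrand (p := p) hu hψ
  rw [ENNReal.ofReal_mul (by linarith : (0 : ℝ) ≤ 1 + τ), mul_assoc,
    ENNReal.ofReal_mul (by positivity : (0 : ℝ) ≤ 2 * C), mul_assoc]
  refine le_trans ?_ (add_le_add (add_le_add (add_le_add (add_le_add
    (mul_le_mul_right (hZ.lintegral_snd_le hu hw hr hre hi) _)
    (mul_le_mul_right (hZ.lintegral_fst_le hp0 hl hu hψ hr hre hi.le hi0) _))
    (hZ.lintegral_step_le hp0 hl hu hv hr hre hi)) le_rfl)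
    (mul_le_mul_right (lintegral_mono' (pairMeasure_mono n p (subset_univ B) r) le_rfl) _))
  rw [← lintegral_pairMeasure_eq_pairEnergy hB hφB, chainExcess, ← lintegral_const_mul _ m1,
    ← lintegral_const_mul _ m2, ← lintegral_const_mul _ m5,
    ← lintegral_add_right _ (m2.const_mul _), ← lintegral_add_right _ m3,
    ← lintegral_add_right _ m4, ← lintegral_add_right _ (m5.const_mul _)]
  refine lintegral_mono_ae (ae_pairMeasure hB ?_)
  rintro ⟨x, y⟩ hx hxy
  have hxz := hZ.dist_lt hi hx hxy hre
  simp only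
  set z := Z i (x, y)
  have hA : dist (u x) (u y) ^ p ≤
      (1 + τ) * dist (u z) (u y) ^ p + C * dist (u x) (u z) ^ p :=
    (Real.rpow_le_rpow dist_nonneg ((dist_triangle _ (u z) _).trans_eq (add_comm _ _))
      hp0.le).trans (hineq _ _ dist_nonneg dist_nonneg)
  have hmain := mul_le_of_cutoff (hφ0 x) (h1 x z hxz) (h2 x z hxz) (hφψ x) (hv0 z) (hvφ z) hω hω1
    hC (by positivity) (A' := (k * dist (u z) (u (Z (i + 1) (x, y)))) ^ p) (by positivity)
    (by positivity) hA
  have n1 : 0 ≤ (φ z - v z) * dist (u z) (u y) ^ p :=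
    mul_nonneg (sub_nonneg.2 (hvφ z)) (by positivity)
  have n2 : 0 ≤ ψ x * dist (u x) (u z) ^ p := mul_nonneg (hψ0 x) (by positivity)
  have n3 : 0 ≤ v z * (k * dist (u z) (u (Z (i + 1) (x, y)))) ^ p :=
    mul_nonneg (hv0 z) (by positivity)
  have n4 : 0 ≤ φ x * max 0 (dist (u x) (u y) ^ p -
      (k * dist (u z) (u (Z (i + 1) (x, y)))) ^ p) := mul_nonneg (hφ0 x) (le_max_left _ _)
  have n5 : 0 ≤ ψ x * dist (u x) (u y) ^ p := mul_nonneg (hψ0 x) (by positivity)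
  rw [← ENNReal.ofReal_mul (by linarith), ← ENNReal.ofReal_mul (by positivity),
    ← ENNReal.ofReal_mul (by positivity), ← ENNReal.ofReal_add (by positivity) (by positivity),
    ← ENNReal.ofReal_add (by positivity) n3, ← ENNReal.ofReal_add (by positivity) n4,
    ← ENNReal.ofReal_add (by positivity) (by positivity)]
  exact ENNReal.ofReal_le_ofReal hmain

end OneStep

section OneStepReal

variable {M : Type*} [MetricSpace M] [MeasurableSpace M] [BorelSpace M]
  {Y : Type*} [MetricSpace Y] {n : ℕ} {p : ℝ} {u : M → Y} {B : Set M}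
  {e l r : ℝ} {Z : ℕ → M × M → M}

theorem pairEnergy_mono {h h' : M → ℝ} (hle : ∀ x, h x ≤ h' x) (r : ℝ) :
    pairEnergy n p u h r ≤ pairEnergy n p u h' r := by
  refine lintegral_mono fun q => ENNReal.ofReal_le_ofReal ?_
  exact mul_le_mul_of_nonneg_right (hle _) (by positivity)

theorem pairEnergy_add (hu : Measurable fun q : M × M => dist (u q.1) (u q.2)) {h h' : M → ℝ}
    (hh : Measurable h) (h0 : ∀ x, 0 ≤ h x) (h0' : ∀ x, 0 ≤ h' x) (r : ℝ) :
    pairEnergy n p u (fun x => h x + h' x) r = pairEnergy n p u h r + pairEnergy n p u h' r := by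
  unfold pairEnergy
  rw [← lintegral_add_left (measurable_pairEnergy_integrand hu hh)]
  refine lintegral_congr fun q => ?_
  rw [← ENNReal.ofReal_add (mul_nonneg (h0 _) (by positivity))
    (mul_nonneg (h0' _) (by positivity)), add_mul]

theorem pairEnergy_const_mul {h : M → ℝ} {c : ℝ} (hc : 0 ≤ c) (r : ℝ) :
    pairEnergy n p u (fun x => c * h x) r = ENNReal.ofReal c * pairEnergy n p u h r := by
  unfold pairEnergy
  rw [← lintegral_const_mul' _ _ ENNReal.ofReal_ne_top]
  refine lintegral_congr fun q => ?_
  rw [← ENNReal.ofReal_mul hc, mul_assoc]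

variable [SecondCountableTopology M]

theorem IsChainFamily.toReal_pairEnergy_le {L m : ℕ} (hL : 2 ≤ L) (hm : 0 < m)
    (hZ : IsChainFamily n B e l (L * m) Z) (hB : MeasurableSet B)
    (hp : 1 < p) (hl : 0 < l) (hl1 : l ≤ 1)
    (hu : Measurable fun q : M × M => dist (u q.1) (u q.2)) (hr : 0 < r) (hre : r ≤ e)
    {τ C₁ κ C₂ ω T : ℝ} (hτ : 0 ≤ τ) (hC₁ : 0 ≤ C₁) (hκ : 0 ≤ κ) (hC₂ : 0 ≤ C₂) (hω : 0 ≤ ω)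
    (hω1 : ω ≤ 1)
    (hineq₁ : ∀ b c : ℝ, 0 ≤ b → 0 ≤ c → (b + c) ^ p ≤ (1 + τ) * b ^ p + C₁ * c ^ p)
    (hineq₂ : ∀ (k : ℕ) (a : ℝ) (b : ℕ → ℝ), 0 ≤ a → (∀ i, 0 ≤ b i) →
      k * a ≤ ∑ i ∈ Finset.range k, b i →
      ∑ i ∈ Finset.range k, max 0 (a ^ p - b i ^ p) + C₂ * k * a ^ p ≤
        κ * k * a ^ p + C₂ * ∑ i ∈ Finset.range k, b i ^ p)
    {φ ψ v : M → ℝ} (hφ : Measurable φ) (hψ : Measurable ψ) (hv : Measurable v)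
    (hφ0 : ∀ x, 0 ≤ φ x) (hφψ : ∀ x, φ x ≤ ψ x) (hφB : ∀ x ∉ B, φ x = 0)
    (hcut : ∀ x z, dist x z < r → φ x ≤ φ z + ω * ψ x ∧ φ z ≤ φ x + ω * ψ x)
    (hT0 : 0 ≤ T) (hT : ∀ s, 0 < s → s ≤ r → pairEnergy n p u ψ s ≤ ENNReal.ofReal T)
    (hv0 : ∀ x, 0 ≤ v x) (hvφ : ∀ x, v x ≤ φ x) :
    (pairEnergy n p u v r).toReal ≤
      (l ^ 2)⁻¹ ^ n * (pairEnergy n p u v (r / (L * m : ℕ))).toReal +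
      ((1 + τ) * (l * (1 - 1 / L))⁻¹ ^ n - 1) * T +
      2 * C₁ * (l⁻¹ ^ n * (1 / (L : ℝ)) ^ p) * T +
      L * (κ * T + C₂ * ((l ^ 2)⁻¹ ^ n *
        (pairEnergy n p u (fun x => φ x + ω * ψ x) (r / (L * m : ℕ))).toReal -
          (pairEnergy n p u φ r).toReal)) +
      2 * ω * T := by
  set k := L * m with hk
  have hk0 : 0 < k := Nat.mul_pos (by omega) hm
  have hk' : (0 : ℝ) < k := by exact_mod_cast hk0
  have hL' : (2 : ℝ) ≤ L := by exact_mod_cast hL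
  have hkLm : (k : ℝ) = L * m := by rw [hk, Nat.cast_mul]
  have hm' : (0 : ℝ) < m := by exact_mod_cast hm
  have hψ0 : ∀ x, 0 ≤ ψ x := fun x => (hφ0 x).trans (hφψ x)
  have hrk : r / k ≤ r := div_le_self hr.le (by exact_mod_cast hk0)
  have hrk0 : 0 < r / k := by positivity
  have hfin : ∀ h : M → ℝ, (∀ x, h x ≤ 2 * ψ x) → ∀ s, 0 < s → s ≤ r →
      pairEnergy n p u h s ≠ ∞ := by
    intro h hh s hs hsr
    refine ((pairEnergy_mono hh s).trans_lt ?_).ne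
    rw [pairEnergy_const_mul zero_le_two]
    exact ENNReal.mul_lt_top ENNReal.ofReal_lt_top ((hT s hs hsr).trans_lt ENNReal.ofReal_lt_top)
  have hφ2 : ∀ x, φ x ≤ 2 * ψ x := fun x => by linarith [hφψ x, hψ0 x]
  have hφ'2 : ∀ x, φ x + ω * ψ x ≤ 2 * ψ x := fun x => by
    linarith [hφψ x, mul_le_of_le_one_left (hψ0 x) hω1]
  have hexc := hZ.sum_chainExcess_le hB hp hl hk0 hu hr hre hκ hC₂ (hineq₂ k) hφ
    (φ' := fun x => φ x + ω * ψ x) (hφ.add (hψ.const_mul ω)) hφ0 hφB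
    (fun x z hxz => (hcut z x (by rwa [dist_comm])).2)
  have heq : ∀ {a : ℝ≥0∞}, a ≠ ∞ → a = ENNReal.ofReal a.toReal := fun h =>
    (ENNReal.ofReal_toReal h).symm
  have hfφ := hfin φ hφ2 r hr le_rfl
  have hfφ' := hfin _ hφ'2 (r / k) hrk0 hrk
  have hsumfin : ∑ i ∈ Finset.range k, chainExcess n p u B k Z φ r i ≠ ∞ := by
    refine ((le_self_add.trans hexc).trans_lt ?_).ne
    exact ENNReal.add_lt_top.2 ⟨ENNReal.mul_lt_top ENNReal.ofReal_lt_top hfφ.lt_top,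
      ENNReal.mul_lt_top ENNReal.ofReal_lt_top hfφ'.lt_top⟩
  have hexfin : ∀ i ∈ Finset.range k, chainExcess n p u B k Z φ r i ≠ ∞ :=
    ENNReal.sum_ne_top.1 hsumfin
  have hexc' : ∑ i ∈ Finset.range k, (chainExcess n p u B k Z φ r i).toReal ≤
      k * (κ * T + C₂ * ((l ^ 2)⁻¹ ^ n *
        (pairEnergy n p u (fun x => φ x + ω * ψ x) (r / k)).toReal -
          (pairEnergy n p u φ r).toReal)) := by
    have h := hexc
    rw [heq hsumfin, heq hfφ, heq hfφ', ← ENNReal.ofReal_mul (by positivity),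
      ← ENNReal.ofReal_mul (by positivity), ← ENNReal.ofReal_mul (by positivity),
      ← ENNReal.ofReal_add (by positivity) (by positivity),
      ← ENNReal.ofReal_add (by positivity) (by positivity),
      ENNReal.ofReal_le_ofReal_iff (by positivity), ENNReal.toReal_sum hexfin] at h
    have hφT : (pairEnergy n p u φ r).toReal ≤ T :=
      ENNReal.toReal_le_of_le_ofReal hT0 ((pairEnergy_mono hφψ r).trans (hT r hr le_rfl))
    have := mul_le_mul_of_nonneg_left hφT (by positivity : 0 ≤ κ * k)
    linarith
  set s := κ * T + C₂ * ((l ^ 2)⁻¹ ^ n *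
        (pairEnergy n p u (fun x => φ x + ω * ψ x) (r / k)).toReal -
          (pairEnergy n p u φ r).toReal) with hs
  obtain ⟨i, hi, his⟩ : ∃ i ∈ Finset.Icc 1 m, (chainExcess n p u B k Z φ r i).toReal ≤ L * s := by
    refine Finset.exists_le_of_sum_le (Finset.nonempty_Icc.2 hm) ?_
    rw [Finset.sum_const, Nat.card_Icc, add_tsub_cancel_right, nsmul_eq_mul]
    refine (Finset.sum_le_sum_of_subset_of_nonneg (fun i hi => ?_) fun i _ _ =>
      ENNReal.toReal_nonneg).trans (hexc'.trans_eq ?_)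
    · rw [Finset.mem_Icc] at hi
      rw [Finset.mem_range, hk]
      nlinarith
    · rw [hkLm]; ring
  rw [Finset.mem_Icc] at hi
  have hik : i < k := by rw [hk]; nlinarith
  have hi0' : (0 : ℝ) < i := by exact_mod_cast hi.1
  have hiL : (i : ℝ) / k ≤ 1 / L := by
    rw [hkLm, div_le_div_iff₀ (by positivity) (by positivity)]
    have : (i : ℝ) ≤ m := by exact_mod_cast hi.2
    nlinarith
  have hik0 : (0 : ℝ) < i / k := by positivity
  have hL1 : 1 / (L : ℝ) < 1 := by rw [div_lt_one (by positivity)]; linarith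
  have hmain := hZ.pairEnergy_le hB hp hl hu hr hre hτ hC₁ hω hω1 hineq₁ hφ hψ hv hφ0 hφψ hφB
    (fun x z h => (hcut x z h).1) (fun x z h => (hcut x z h).2) hv0 hvφ hik hi.1
  have hfw := hfin (fun x => φ x - v x) (fun x => by linarith [hφ2 x, hv0 x]) r hr le_rfl
  have hfv := hfin v (fun x => (hvφ x).trans (hφ2 x)) r hr le_rfl
  have hfv' := hfin v (fun x => (hvφ x).trans (hφ2 x)) (r / k) hrk0 hrk
  have hψT : pairEnergy n p u ψ (i / k * r) ≤ ENNReal.ofReal T :=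
    hT _ (by positivity) (mul_le_of_le_one_left hr.le (hiL.trans hL1.le))
  have hmain' := hmain.trans (add_le_add (add_le_add (add_le_add (add_le_add le_rfl
    (mul_le_mul_right hψT _)) le_rfl) le_rfl) (mul_le_mul_right (hT r hr le_rfl) _))
  have hsplit : pairEnergy n p u φ r =
      pairEnergy n p u v r + pairEnergy n p u (fun x => φ x - v x) r := by
    rw [← pairEnergy_add hu hv hv0 (fun x => sub_nonneg.2 (hvφ x))]
    simp
  have h1ik : 0 < 1 - (i : ℝ) / k := by linarith
  rw [hsplit, heq hfw, heq hfv, heq hfv', heq (hexfin i (Finset.mem_range.2 hik)),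
    ← ENNReal.ofReal_mul (by positivity), ← ENNReal.ofReal_mul (by positivity),
    ← ENNReal.ofReal_mul (by positivity), ← ENNReal.ofReal_mul (by positivity),
    ← ENNReal.ofReal_add (by positivity) (by positivity),
    ← ENNReal.ofReal_add (by positivity) (by positivity),
    ← ENNReal.ofReal_add (by positivity) (by positivity),
    ← ENNReal.ofReal_add (by positivity) (by positivity),
    ← ENNReal.ofReal_add (by positivity) (by positivity),
    ENNReal.ofReal_le_ofReal_iff (by positivity)] at hmain'
  have hwT : (pairEnergy n p u (fun x => φ x - v x) r).toReal ≤ T :=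
    ENNReal.toReal_le_of_le_ofReal hT0
      ((pairEnergy_mono (fun x => by linarith [hφψ x, hv0 x]) r).trans (hT r hr le_rfl))
  have hΛi : (l * (1 - (i : ℝ) / k))⁻¹ ^ n ≤ (l * (1 - 1 / L))⁻¹ ^ n := by
    have : 0 < 1 - 1 / (L : ℝ) := by linarith
    gcongr
  have hΛ1 : 1 ≤ (l * (1 - 1 / (L : ℝ)))⁻¹ ^ n := by
    have h3 : 0 < 1 - 1 / (L : ℝ) := by linarith
    have h4 : 1 - 1 / (L : ℝ) ≤ 1 := by
      have : 0 < 1 / (L : ℝ) := by positivity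
      linarith
    exact one_le_pow₀ ((one_le_inv₀ (by positivity)).2 (mul_le_one₀ hl1 h3.le h4))
  have hw0 : 0 ≤ (pairEnergy n p u (fun x => φ x - v x) r).toReal := ENNReal.toReal_nonneg
  have e1 : (1 + τ) * (l * (1 - (i : ℝ) / k))⁻¹ ^ n *
      (pairEnergy n p u (fun x => φ x - v x) r).toReal ≤
      (1 + τ) * (l * (1 - 1 / L))⁻¹ ^ n * (pairEnergy n p u (fun x => φ x - v x) r).toReal := by
    gcongr
  have e2 : ((1 + τ) * (l * (1 - 1 / (L : ℝ)))⁻¹ ^ n - 1) *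
      (pairEnergy n p u (fun x => φ x - v x) r).toReal ≤
      ((1 + τ) * (l * (1 - 1 / L))⁻¹ ^ n - 1) * T := by
    refine mul_le_mul_of_nonneg_left hwT ?_
    nlinarith
  have e3 : 2 * C₁ * (l⁻¹ ^ n * ((i : ℝ) / k) ^ p) * T ≤
      2 * C₁ * (l⁻¹ ^ n * (1 / (L : ℝ)) ^ p) * T := by
    gcongr
  linarith

end OneStepReal

section UniformBound

variable {M : Type*} [MetricSpace M] [MeasurableSpace M] [BorelSpace M]
  [SecondCountableTopology M] {Y : Type*} [MetricSpace Y] {n : ℕ} {p : ℝ} {u : M → Y} {B : Set M}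

theorem eventually_pairEnergy_le (hp : 1 < p) (hB : MeasurableSet B)
    (hchain : ∀ l, 0 < l → l < (1 : ℝ) → ∃ e > 0, ∀ k : ℕ, 0 < k →
      ∃ Z, IsChainFamily n B e l k Z)
    (hu : Measurable fun q : M × M => dist (u q.1) (u q.2))
    {φ ψ : M → ℝ} (hφ : Continuous φ) (hψ : Continuous ψ)
    (hφ0 : ∀ x, 0 ≤ φ x) (hφψ : ∀ x, φ x ≤ ψ x) (hφB : ∀ x ∉ B, φ x = 0) {ϱ : ℝ} (hϱ : 0 < ϱ)
    (hcut : ∀ r, 0 < r → r ≤ ϱ → ∀ x z, dist x z < r →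
      φ x ≤ φ z + r / ϱ * ψ x ∧ φ z ≤ φ x + r / ϱ * ψ x)
    {ν : Measure M} (hψν : Integrable ψ ν)
    (hfin : ∀ᶠ r in 𝓝[>] (0 : ℝ), pairEnergy n p u ψ r ≠ ∞)
    (hlim : ∀ v : M → ℝ, Continuous v → (∀ x, 0 ≤ v x) → (∀ x, v x ≤ 2 * ψ x) →
      Tendsto (fun r => (pairEnergy n p u v r).toReal) (𝓝[>] 0) (𝓝 (∫ x, v x ∂ν)))
    {κ : ℝ} (hκ : 0 < κ) :
    ∀ᶠ r in 𝓝[>] (0 : ℝ), ∀ v : M → ℝ, Continuous v → (∀ x, 0 ≤ v x) → (∀ x, v x ≤ φ x) →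
      (pairEnergy n p u v r).toReal ≤ ∫ x, v x ∂ν + κ := by
  have hp0 : 0 < p := by linarith
  have hψ0 : ∀ x, 0 ≤ ψ x := fun x => (hφ0 x).trans (hφψ x)
  have hvν : ∀ v : M → ℝ, Continuous v → (∀ x, 0 ≤ v x) → (∀ x, v x ≤ ψ x) → Integrable v ν :=
    fun v hv hv0 hvψ => hψν.mono' hv.aestronglyMeasurable
      (.of_forall fun x => by rw [Real.norm_of_nonneg (hv0 x)]; exact hvψ x)
  set Ψ := ∫ x, ψ x ∂ν with hΨ
  set Φ := ∫ x, φ x ∂ν with hΦ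
  have hΨ0 : 0 ≤ Ψ := integral_nonneg hψ0
  set T := Ψ + 1 with hT
  have hT0 : 0 < T := by linarith
  have hlimψ := hlim ψ hψ hψ0 (fun x => by linarith [hψ0 x])
  have hlimφ := hlim φ hφ hφ0 (fun x => by linarith [hφψ x, hψ0 x])
  obtain ⟨r₁, hr₁, hTr⟩ : ∃ r₁ > 0, ∀ s, 0 < s → s ≤ r₁ →
      pairEnergy n p u ψ s ≤ ENNReal.ofReal T := by
    have h := hfin.and (hlimψ.eventually_le_const (show Ψ < T by linarith))
    obtain ⟨r₁, hr₁, h⟩ := (mem_nhdsGT_iff_exists_Ioc_subset).1 h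
    exact ⟨r₁, hr₁, fun s hs hs' => (ENNReal.le_ofReal_iff_toReal_le (h ⟨hs, hs'⟩).1 hT0.le).2
      (h ⟨hs, hs'⟩).2⟩
  have hTτ : κ / (4 * T) * T = κ / 4 := by field_simp
  obtain ⟨C₁, hC₁, hineq₁⟩ := exists_add_rpow_le hp (show 0 < κ / (4 * T) by positivity)
  set τ := κ / (4 * T) with hτ
  have hτ0 : 0 < τ := by positivity
  obtain ⟨L, hL2, hL⟩ : ∃ L : ℕ, 2 ≤ L ∧
      ((1 + τ) * (1 * (1 - 1 / (L : ℝ)))⁻¹ ^ n - 1) * T +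
        2 * C₁ * ((1 : ℝ)⁻¹ ^ n * (1 / (L : ℝ)) ^ p) * T < κ / 2 := by
    have h : Tendsto (fun L : ℕ => ((1 + τ) * (1 * (1 - 1 / (L : ℝ)))⁻¹ ^ n - 1) * T +
        2 * C₁ * ((1 : ℝ)⁻¹ ^ n * (1 / (L : ℝ)) ^ p) * T) atTop
        (𝓝 (((1 + τ) * (1 * (1 - 0))⁻¹ ^ n - 1) * T +
          2 * C₁ * ((1 : ℝ)⁻¹ ^ n * 0 ^ p) * T)) := by
      have h0 : Tendsto (fun L : ℕ => 1 / (L : ℝ)) atTop (𝓝 0) := tendsto_one_div_atTop_nhds_zero_nat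
      refine Tendsto.add ?_ ?_
      · exact (((((((h0.const_sub 1).const_mul 1).inv₀ (by norm_num)).pow n).const_mul
          (1 + τ))).sub_const 1).mul_const T
      · exact (((h0.rpow_const (Or.inr hp0.le)).const_mul _).const_mul _).mul_const T
    obtain ⟨L, hL⟩ := ((h.eventually_lt_const (u := κ / 2) (by
      rw [Real.zero_rpow hp0.ne']
      simp only [sub_zero, mul_one, inv_one, one_pow, mul_zero, zero_mul, add_zero,
        add_sub_cancel_left]
      linarith)).and (eventually_ge_atTop 2)).exists
    exact ⟨L, hL.2, hL.1⟩
  have hL0 : (0 : ℝ) < L := by exact_mod_cast (by omega : 0 < L)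
  set κ₁ := κ / (4 * L * T) with hκ₁
  have hκ₁0 : 0 < κ₁ := by positivity
  have hLκ : L * (κ₁ * T) = κ / 4 := by rw [hκ₁]; field_simp
  obtain ⟨C₂, hC₂, hineq₂⟩ := exists_sum_rpow_sub_le hp hκ₁0
  let b : ℝ → ℝ → ℝ → ℝ := fun l ω γ =>
    ((l ^ 2)⁻¹ ^ n - 1) * T + ((1 + τ) * (l * (1 - 1 / L))⁻¹ ^ n - 1) * T +
      2 * C₁ * (l⁻¹ ^ n * (1 / (L : ℝ)) ^ p) * T +
      L * (κ₁ * T + C₂ * ((l ^ 2)⁻¹ ^ n * (Φ + ω * Ψ) - γ)) + 2 * ω * T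
  have hb1 : b 1 0 Φ < κ := by
    have : b 1 0 Φ = (((1 + τ) * (1 * (1 - 1 / (L : ℝ)))⁻¹ ^ n - 1) * T +
        2 * C₁ * ((1 : ℝ)⁻¹ ^ n * (1 / (L : ℝ)) ^ p) * T) + L * (κ₁ * T) := by
      simp only [b]
      rw [one_pow, inv_one, one_pow]
      ring
    linarith
  obtain ⟨l, ⟨hl0, hl1⟩, hbl⟩ : ∃ l ∈ Ioo (0 : ℝ) 1, b l 0 Φ < κ := by
    have hc : ContinuousAt (fun l => b l 0 Φ) 1 := by
      have hL1 : (1 : ℝ) * (1 - 1 / L) ≠ 0 := by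
        have : (2 : ℝ) ≤ L := by exact_mod_cast hL2
        have : 1 / (L : ℝ) < 1 := by rw [div_lt_one hL0]; linarith
        exact (by linarith : (0 : ℝ) < 1 * (1 - 1 / L)).ne'
      have c1 : ContinuousAt (fun l : ℝ => (l ^ 2)⁻¹ ^ n) 1 :=
        ((continuousAt_id.pow 2).inv₀ (by norm_num)).pow n
      have c2 : ContinuousAt (fun l : ℝ => (l * (1 - 1 / L))⁻¹ ^ n) 1 :=
        ((continuousAt_id.mul continuousAt_const).inv₀ hL1).pow n
      have c3 : ContinuousAt (fun l : ℝ => l⁻¹ ^ n) 1 :=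
        (continuousAt_id.inv₀ (by norm_num)).pow n
      simp only [b]
      fun_prop
    exact (Filter.Eventually.and (Ioo_mem_nhdsLT one_pos)
      ((hc.tendsto.mono_left nhdsWithin_le_nhds).eventually_lt_const hb1)).exists
  obtain ⟨e, he, hZ⟩ := hchain l hl0 hl1
  have hbr : ∀ᶠ r in 𝓝[>] (0 : ℝ), b l (r / ϱ) (pairEnergy n p u φ r).toReal < κ := by
    have h0 : Tendsto (fun r : ℝ => r / ϱ) (𝓝[>] 0) (𝓝 0) := by
      have : Tendsto (fun r : ℝ => r / ϱ) (𝓝 0) (𝓝 (0 / ϱ)) := tendsto_id.div_const ϱ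
      rw [zero_div] at this
      exact this.mono_left nhdsWithin_le_nhds
    have : Tendsto (fun r => b l (r / ϱ) (pairEnergy n p u φ r).toReal) (𝓝[>] 0)
        (𝓝 (b l 0 Φ)) := by
      simp only [b]
      exact (((((((h0.mul_const Ψ).const_add Φ).const_mul _).sub hlimφ).const_mul C₂).const_add
        _).const_mul _ |>.const_add _).add ((h0.const_mul 2).mul_const T)
    exact this.eventually_lt_const hbl
  filter_upwards [hbr, self_mem_nhdsWithin,
    Ioc_mem_nhdsGT (show (0 : ℝ) < min (min r₁ ϱ) e by positivity)] with r hbr hr hre v hv hv0 hvφ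
  rw [mem_Ioi] at hr
  have hr1 : r ≤ r₁ := hre.2.trans ((min_le_left _ _).trans (min_le_left _ _))
  have hr2 : r ≤ ϱ := hre.2.trans ((min_le_left _ _).trans (min_le_right _ _))
  have hr3 : r ≤ e := hre.2.trans (min_le_right _ _)
  have hω0 : 0 ≤ r / ϱ := by positivity
  have hω1 : r / ϱ ≤ 1 := (div_le_one hϱ).2 hr2
  have hstep : ∀ᶠ m : ℕ in atTop, _ := (eventually_gt_atTop 0).mono fun m hm => by
    obtain ⟨Z, hZ⟩ := hZ (L * m) (Nat.mul_pos (by omega) hm)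
    exact hZ.toReal_pairEnergy_le hL2 hm hB hp hl0 hl1.le hu hr hr3 hτ0.le hC₁ hκ₁0.le hC₂ hω0
      hω1 hineq₁ hineq₂ hφ.measurable hψ.measurable hv.measurable hφ0 hφψ hφB (hcut r hr hr2) hT0.le
      (fun s hs hsr => hTr s hs (hsr.trans hr1)) hv0 hvφ
  have hδ : Tendsto (fun m : ℕ => r / (L * m : ℕ)) atTop (𝓝[>] 0) := by
    refine tendsto_nhdsWithin_iff.2 ⟨?_, (eventually_gt_atTop 0).mono fun m hm => ?_⟩
    · have h1 : Tendsto (fun m : ℕ => L * m) atTop atTop :=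
        tendsto_id.const_mul_atTop' (by omega)
      exact (tendsto_const_div_atTop_nhds_zero_nat r).comp h1
    · have : (0 : ℝ) < (L * m : ℕ) := by exact_mod_cast Nat.mul_pos (by omega) hm
      exact div_pos hr this
  have hωψ : ∀ x, 0 ≤ r / ϱ * ψ x := fun x => mul_nonneg hω0 (hψ0 x)
  have hlim1 := (hlim v hv hv0 (fun x => by linarith [hvφ x, hφψ x, hψ0 x])).comp hδ
  have hlim2 := (hlim (fun x => φ x + r / ϱ * ψ x) (by fun_prop)
    (fun x => add_nonneg (hφ0 x) (hωψ x))
    (fun x => by linarith [hφψ x, mul_le_of_le_one_left (hψ0 x) hω1])).comp hδ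
  rw [integral_add (hvν φ hφ hφ0 hφψ) (hψν.const_mul _), integral_const_mul] at hlim2
  have hfinal := ge_of_tendsto (((((hlim1.const_mul _).add_const _).add_const _).add
    (((((hlim2.const_mul _).sub_const _).const_mul C₂).const_add _).const_mul _)).add_const _) hstep
  have hvT : ∫ x, v x ∂ν ≤ T := by
    refine (integral_mono (hvν v hv hv0 fun x => (hvφ x).trans (hφψ x)) hψν
      fun x => (hvφ x).trans (hφψ x)).trans ?_
    linarith
  have hΛ : 1 ≤ (l ^ 2)⁻¹ ^ n :=
    one_le_pow₀ ((one_le_inv₀ (by positivity)).2 (pow_le_one₀ hl0.le hl1.le))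
  have hΛv := mul_le_mul_of_nonneg_left hvT (sub_nonneg.2 hΛ)
  simp only [b] at hbr
  linarith

end UniformBound

section AbsolutelyContinuousPart

variable {M : Type*} [MetricSpace M] [MeasurableSpace M] [BorelSpace M]

theorem measure_le_add_of_forall_lintegral_le {α β : Measure M} [IsFiniteMeasure α]
    [IsFiniteMeasure β] {c : ℝ≥0∞}
    (h : ∀ f : M → ℝ≥0, Continuous f → (∀ x, f x ≤ 1) →
      ∫⁻ x, f x ∂α ≤ ∫⁻ x, f x ∂β + c) {D : Set M} (hD : MeasurableSet D) :
    α D ≤ β D + c := by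
  have hclosed : ∀ K : Set M, IsClosed K → α K ≤ β K + c := by
    intro K hK
    have hδ : ∀ j : ℕ, (0 : ℝ) < 1 / ((j : ℝ) + 1) := fun j => by positivity
    have hlim := tendsto_lintegral_thickenedIndicator_of_isClosed β hK hδ
      tendsto_one_div_add_atTop_nhds_zero_nat
    refine ge_of_tendsto (hlim.add_const c) (Eventually.of_forall fun j => ?_)
    refine (measure_le_lintegral_thickenedIndicator α hK.measurableSet (hδ j)).trans ?_
    exact h _ (thickenedIndicator (hδ j) K).continuous fun x => thickenedIndicator_le_one _ _ x
  refine ENNReal.le_of_forall_pos_le_add fun ε hε _ => ?_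
  obtain ⟨K, hKD, hK, hlt⟩ := hD.exists_isClosed_lt_add (measure_ne_top α D)
    (ENNReal.coe_ne_zero.2 hε.ne')
  calc α D ≤ α K + ε := hlt.le
    _ ≤ β K + c + ε := by gcongr; exact hclosed K hK
    _ ≤ _ := by gcongr

theorem lintegral_mul_tsub_rnDeriv_le {μ ν : Measure M} [SigmaFinite μ] [IsFiniteMeasure ν]
    {φ : M → ℝ≥0} (hφ : Continuous φ) (hφ1 : ∀ x, φ x ≤ 1) {d : M → ℝ≥0∞} (hd : Measurable d)
    {κ : ℝ≥0∞} (hκ : κ ≠ ∞)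
    (h : ∀ v : M → ℝ≥0, Continuous v → (∀ x, v x ≤ φ x) →
      ∫⁻ x, v x * d x ∂μ ≤ ∫⁻ x, v x ∂ν + κ) :
    ∫⁻ x, φ x * (d x - ν.rnDeriv μ x) ∂μ ≤ κ := by
  set g := ν.rnDeriv μ with hg
  have hgm : Measurable g := ν.measurable_rnDeriv μ
  have hφm : Measurable fun x => (φ x : ℝ≥0∞) := hφ.measurable.coe_nnreal_ennreal
  have hφν : ∫⁻ x, φ x ∂ν ≠ ∞ := by
    refine ne_top_of_le_ne_top (measure_ne_top ν univ) ?_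
    calc ∫⁻ x, φ x ∂ν ≤ ∫⁻ _, 1 ∂ν := lintegral_mono fun x => ENNReal.coe_le_one_iff.2 (hφ1 x)
      _ = _ := by simp
  have hfinα : ∫⁻ x, φ x * d x ∂μ ≠ ∞ :=
    ne_top_of_le_ne_top (ENNReal.add_ne_top.2 ⟨hφν, hκ⟩) (h φ hφ fun _ => le_rfl)
  have := isFiniteMeasure_withDensity hfinα
  have := isFiniteMeasure_withDensity hφν
  have hD : ∀ D, MeasurableSet D → ∫⁻ x in D, φ x * d x ∂μ ≤ ∫⁻ x in D, φ x ∂ν + κ := by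
    intro D hD
    rw [← withDensity_apply _ hD, ← withDensity_apply _ hD]
    refine measure_le_add_of_forall_lintegral_le (fun f hf hf1 => ?_) hD
    have hfm : Measurable fun x => (f x : ℝ≥0∞) := hf.measurable.coe_nnreal_ennreal
    rw [lintegral_withDensity_eq_lintegral_mul _ (hφm.fun_mul hd) hfm,
      lintegral_withDensity_eq_lintegral_mul _ hφm hfm]
    have hv := h (fun x => φ x * f x) (hφ.mul hf) (fun x => mul_le_of_le_one_right' (hf1 x))
    simp only [ENNReal.coe_mul, mul_right_comm _ _ (d _)] at hv
    exact hv
  obtain ⟨S, hS, hS1, hS2⟩ := ν.mutuallySingular_singularPart μ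
  have hgD : ∀ D ⊆ S, MeasurableSet D → ∫⁻ x in D, φ x ∂ν = ∫⁻ x in D, φ x * g x ∂μ := by
    intro D hDS hD
    conv_lhs => rw [← ν.rnDeriv_add_singularPart μ]
    rw [Measure.restrict_add, lintegral_add_measure,
      Measure.restrict_eq_zero.2 (measure_mono_null hDS hS1), lintegral_zero_measure, add_zero,
      setLIntegral_withDensity_eq_setLIntegral_mul _ hgm hφm hD]
    exact lintegral_congr fun x => mul_comm _ _
  set D := S ∩ {x | g x < d x} with hDdef
  have hDm : MeasurableSet D := hS.inter (measurableSet_lt hgm hd)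
  have hkey : ∫⁻ x in D, φ x * (d x - g x) ∂μ ≤ κ := by
    have hne : ∫⁻ x in D, φ x * g x ∂μ ≠ ∞ := by
      rw [← hgD D inter_subset_left hDm]
      exact ne_top_of_le_ne_top hφν (setLIntegral_le_lintegral _ _)
    refine (ENNReal.add_le_add_iff_left hne).1 ?_
    rw [← lintegral_add_left (hφm.fun_mul hgm)]
    calc _ = ∫⁻ x in D, φ x * d x ∂μ := by
          refine setLIntegral_congr_fun hDm fun x hx => ?_
          rw [← mul_add, add_tsub_cancel_of_le hx.2.le]
      _ ≤ _ := hD D hDm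
      _ = _ := by rw [hgD D inter_subset_left hDm]
  refine le_trans (le_of_eq ?_) hkey
  rw [← lintegral_indicator hDm]
  refine lintegral_congr_ae ?_
  filter_upwards [measure_eq_zero_iff_ae_notMem.1 hS2] with x hx
  by_cases hxD : x ∈ D
  · rw [indicator_of_mem hxD]
  · rw [indicator_of_notMem hxD, tsub_eq_zero_of_le, mul_zero]
    by_contra hcon
    exact hxD ⟨not_not.1 hx, not_le.1 hcon⟩

theorem tendsto_lintegral_mul_sub_rnDeriv {μ ν : Measure M} [SigmaFinite μ] [IsFiniteMeasure ν]
    {φ : M → ℝ≥0} (hφ : Continuous φ) (hφ1 : ∀ x, φ x ≤ 1) {ι : Type*} {L : Filter ι}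
    {d : ι → M → ℝ≥0∞} (hd : ∀ᶠ i in L, Measurable (d i))
    (h : ∀ κ : ℝ≥0∞, 0 < κ → κ ≠ ∞ → ∀ᶠ i in L, ∀ v : M → ℝ≥0, Continuous v →
      (∀ x, v x ≤ φ x) → ∫⁻ x, v x * d i x ∂μ ≤ ∫⁻ x, v x ∂ν + κ)
    (hlim : Tendsto (fun i => ∫⁻ x, φ x * d i x ∂μ) L (𝓝 (∫⁻ x, φ x ∂ν))) :
    Tendsto (fun i => ∫⁻ x, φ x * ((d i x - ν.rnDeriv μ x) + (ν.rnDeriv μ x - d i x)) ∂μ)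
      L (𝓝 0) := by
  set g := ν.rnDeriv μ with hg
  have hgm : Measurable g := ν.measurable_rnDeriv μ
  have hφm : Measurable fun x => (φ x : ℝ≥0∞) := hφ.measurable.coe_nnreal_ennreal
  have hφν : ∫⁻ x, φ x ∂ν ≠ ∞ := by
    refine ne_top_of_le_ne_top (measure_ne_top ν univ) ?_
    calc ∫⁻ x, φ x ∂ν ≤ ∫⁻ _, 1 ∂ν := lintegral_mono fun x => ENNReal.coe_le_one_iff.2 (hφ1 x)
      _ = _ := by simp
  have hφg : ∫⁻ x, φ x * g x ∂μ ≤ ∫⁻ x, φ x ∂ν := by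
    calc ∫⁻ x, φ x * g x ∂μ = ∫⁻ x, φ x ∂(μ.withDensity g) := by
          rw [lintegral_withDensity_eq_lintegral_mul _ hgm hφm]
          exact lintegral_congr fun x => mul_comm _ _
      _ ≤ _ := lintegral_mono' (ν.withDensity_rnDeriv_le μ) le_rfl
  rw [ENNReal.tendsto_nhds_zero]
  intro κ hκ
  rcases eq_or_ne κ ∞ with rfl | hκt
  · exact Eventually.of_forall fun _ => le_top
  have hκ3 : 0 < κ / 3 := ENNReal.div_pos hκ.ne' (by simp)
  have hκ3t : κ / 3 ≠ ∞ := ENNReal.div_ne_top hκt (by simp)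
  have hlow : ∀ᶠ i in L, ∫⁻ x, φ x ∂ν ≤ ∫⁻ x, φ x * d i x ∂μ + κ / 3 := by
    filter_upwards [(ENNReal.tendsto_nhds hφν).1 hlim _ hκ3] with i hi
    exact tsub_le_iff_right.1 hi.1
  filter_upwards [hd, h _ hκ3 hκ3t, hlow] with i hdi hi hlowi
  have h1 := lintegral_mul_tsub_rnDeriv_le hφ hφ1 hdi hκ3t hi
  have hfin : ∫⁻ x, φ x * d i x ∂μ ≠ ∞ :=
    ne_top_of_le_ne_top (ENNReal.add_ne_top.2 ⟨hφν, hκ3t⟩) (hi φ hφ fun _ => le_rfl)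
  have h2 : ∫⁻ x, φ x * (g x - d i x) ∂μ ≤ κ / 3 + κ / 3 := by
    refine (ENNReal.add_le_add_iff_left hfin).1 ?_
    calc ∫⁻ x, φ x * d i x ∂μ + ∫⁻ x, φ x * (g x - d i x) ∂μ
        = ∫⁻ x, φ x * g x ∂μ + ∫⁻ x, φ x * (d i x - g x) ∂μ := by
          rw [← lintegral_add_left (hφm.fun_mul hdi), ← lintegral_add_left (hφm.fun_mul hgm)]
          refine lintegral_congr fun x => ?_
          rw [← mul_add, ← mul_add, add_tsub_eq_max, add_tsub_eq_max, max_comm]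
      _ ≤ (∫⁻ x, φ x * d i x ∂μ + κ / 3) + κ / 3 := by
          gcongr
          exact hφg.trans hlowi
      _ = _ := add_assoc _ _ _
  calc _ = ∫⁻ x, φ x * (d i x - g x) ∂μ + ∫⁻ x, φ x * (g x - d i x) ∂μ := by
        rw [← lintegral_add_left (hφm.fun_mul (hdi.fun_sub hgm))]
        exact lintegral_congr fun x => mul_add _ _ _
    _ ≤ κ / 3 + (κ / 3 + κ / 3) := by gcongr
    _ = κ := by rw [← add_assoc, ENNReal.add_thirds]

end AbsolutelyContinuousPart

section NearDensity

variable {M : Type*} [MetricSpace M] [MeasurableSpace M] [BorelSpace M]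
  {Y : Type*} [MetricSpace Y] {n : ℕ} {p : ℝ} {u : M → Y}

/-- The approximating energy density of a map on the whole space, as an extended number. -/
def nearDensity (n : ℕ) (p : ℝ) (u : M → Y) (r : ℝ) (x : M) : ℝ≥0∞ :=
  ENNReal.ofReal (energyFactor n p r) *
    ∫⁻ y in ball x r, ENNReal.ofReal (dist (u x) (u y) ^ p) ∂μH[(n : ℝ)]

variable [SecondCountableTopology M]

theorem measurable_nearDensity [SFinite (μH[(n : ℝ)] : Measure M)]
    (hu : Measurable fun q : M × M => dist (u q.1) (u q.2)) (r : ℝ) :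
    Measurable (nearDensity n p u r) := by
  refine Measurable.const_mul ?_ _
  have hF : Measurable fun q : M × M => ENNReal.ofReal (dist (u q.1) (u q.2) ^ p) :=
    (hu.pow_const p).ennreal_ofReal
  have : Measurable fun x => ∫⁻ y, (nearPairs univ r).indicator
      (fun q : M × M => ENNReal.ofReal (dist (u q.1) (u q.2) ^ p)) (x, y) ∂μH[(n : ℝ)] :=
    (hF.indicator (measurableSet_nearPairs .univ r)).lintegral_prod_right'
  convert this using 2 with x
  rw [← lintegral_indicator measurableSet_ball]
  congr 1 with y
  simp [indicator, nearPairs, dist_comm]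

theorem pairEnergy_eq_lintegral [SFinite (μH[(n : ℝ)] : Measure M)]
    (hu : Measurable fun q : M × M => dist (u q.1) (u q.2)) {h : M → ℝ} (hh : Measurable h)
    (h0 : ∀ x, 0 ≤ h x) (r : ℝ) :
    pairEnergy n p u h r = ∫⁻ x, ENNReal.ofReal (h x) * nearDensity n p u r x ∂μH[(n : ℝ)] := by
  rw [pairEnergy, lintegral_pairMeasure, setLIntegral_nearPairs .univ r
    (measurable_pairEnergy_integrand hu hh), Measure.restrict_univ,
    ← lintegral_const_mul' _ _ ENNReal.ofReal_ne_top]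
  refine lintegral_congr fun x => ?_
  simp only [nearDensity, ENNReal.ofReal_mul (h0 x)]
  rw [lintegral_const_mul' _ _ ENNReal.ofReal_ne_top, mul_left_comm]

theorem tendsto_lintegral_nearDensity_sub [SigmaFinite (μH[(n : ℝ)] : Measure M)] (hp : 1 < p)
    {B : Set M} (hB : MeasurableSet B)
    (hchain : ∀ l, 0 < l → l < (1 : ℝ) → ∃ e > 0, ∀ k : ℕ, 0 < k →
      ∃ Z, IsChainFamily n B e l k Z)
    (hu : Measurable fun q : M × M => dist (u q.1) (u q.2))
    {φ ψ : M → ℝ} (hφ : Continuous φ) (hψ : Continuous ψ)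
    (hφ0 : ∀ x, 0 ≤ φ x) (hφ1 : ∀ x, φ x ≤ 1) (hφψ : ∀ x, φ x ≤ ψ x) (hφB : ∀ x ∉ B, φ x = 0)
    {ϱ : ℝ} (hϱ : 0 < ϱ)
    (hcut : ∀ r, 0 < r → r ≤ ϱ → ∀ x z, dist x z < r →
      φ x ≤ φ z + r / ϱ * ψ x ∧ φ z ≤ φ x + r / ϱ * ψ x)
    {ν : Measure M} [IsFiniteMeasure ν] (hψν : Integrable ψ ν)
    (hfin : ∀ᶠ r in 𝓝[>] 0, pairEnergy n p u ψ r ≠ ∞)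
    (hlim : ∀ v, Continuous v → (∀ x, 0 ≤ v x) → (∀ x, v x ≤ 2 * ψ x) →
      Tendsto (fun r => (pairEnergy n p u v r).toReal) (𝓝[>] 0) (𝓝 (∫ x, v x ∂ν))) :
    Tendsto (fun r => ∫⁻ x, ENNReal.ofReal (φ x) *
      ((nearDensity n p u r x - ν.rnDeriv μH[(n : ℝ)] x) +
        (ν.rnDeriv μH[(n : ℝ)] x - nearDensity n p u r x)) ∂μH[(n : ℝ)]) (𝓝[>] 0) (𝓝 0) := by
  have hψ0 : ∀ x, 0 ≤ ψ x := fun x => (hφ0 x).trans (hφψ x)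
  have h_int : ∀ v : M → ℝ≥0, Continuous v → (∀ x, (v x : ℝ) ≤ φ x) →
      ∫⁻ x, v x ∂ν = ENNReal.ofReal (∫ x, (v x : ℝ) ∂ν) := fun v hv hvφ =>
    lintegral_coe_eq_integral _ (hψν.mono' (by fun_prop)
      (Eventually.of_forall fun x => by
        rw [Real.norm_of_nonneg (v x).coe_nonneg]
        exact (hvφ x).trans (hφψ x)))
  have hpair : ∀ (v : M → ℝ≥0), Continuous v → ∀ r, pairEnergy n p u (fun x => v x) r =
      ∫⁻ x, v x * nearDensity n p u r x ∂μH[(n : ℝ)] := fun v hv r => by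
    rw [pairEnergy_eq_lintegral hu (by fun_prop) fun x => (v x).coe_nonneg]
    simp only [ENNReal.ofReal_coe_nnreal]
  set φ' : M → ℝ≥0 := fun x => (φ x).toNNReal with hφ'
  have hφ'c : Continuous φ' := continuous_real_toNNReal.comp hφ
  have hφφ' : ∀ x, (φ' x : ℝ) = φ x := fun x => Real.coe_toNNReal _ (hφ0 x)
  have hle : ∀ r, pairEnergy n p u ψ r ≠ ∞ → ∀ v : M → ℝ≥0, (∀ x, v x ≤ φ' x) →
      pairEnergy n p u (fun x => v x) r ≠ ∞ := fun r hr v hv =>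
    ne_top_of_le_ne_top hr (pairEnergy_mono (fun x =>
      ((NNReal.coe_le_coe.2 (hv x)).trans_eq (hφφ' x)).trans (hφψ x)) r)
  refine tendsto_lintegral_mul_sub_rnDeriv hφ'c
    (fun x => by rw [← NNReal.coe_le_coe, hφφ']; exact hφ1 x)
    (Eventually.of_forall fun r => measurable_nearDensity hu r) (fun κ hκ hκt => ?_) ?_
  · filter_upwards [hfin, eventually_pairEnergy_le hp hB hchain hu hφ hψ hφ0 hφψ hφB hϱ hcut hψν
      hfin hlim (ENNReal.toReal_pos hκ.ne' hκt)] with r hr h v hv hvφ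
    have hvφ' : ∀ x, (v x : ℝ) ≤ φ x := fun x =>
      (NNReal.coe_le_coe.2 (hvφ x)).trans_eq (hφφ' x)
    rw [← hpair v hv, h_int v hv hvφ', ← ENNReal.ofReal_toReal (hle r hr v hvφ),
      ← ENNReal.ofReal_toReal hκt, ← ENNReal.ofReal_add (by positivity) (by positivity)]
    exact ENNReal.ofReal_le_ofReal (h _ (by fun_prop) (fun x => (v x).coe_nonneg) hvφ')
  · rw [h_int φ' hφ'c fun x => (hφφ' x).le]
    refine (ENNReal.tendsto_ofReal (hlim (fun x => φ' x) (by fun_prop) (fun x => (φ' x).coe_nonneg)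
      fun x => ?_)).congr' ?_
    · rw [hφφ']
      linarith [hφψ x, hψ0 x]
    · filter_upwards [hfin] with r hr
      rw [← hpair φ' hφ'c, ENNReal.ofReal_toReal (hle r hr φ' fun _ => le_rfl)]

end NearDensity

section ApproximatingEnergy

variable {M : Type*} [MetricSpace M] [MeasurableSpace M] {Y : Type*} [MetricSpace Y]
  {n : ℕ} {p : ℝ} {u : M → Y}

omit [MetricSpace M] in
theorem measurable_dist_pair (h : ∀ P : Y, Measurable fun x => dist (u x) P)
    (hs : TopologicalSpace.IsSeparable (range u)) :
    Measurable fun q : M × M => dist (u q.1) (u q.2) := by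
  obtain ⟨c, hc, hcd⟩ := hs
  have heq : ∀ x y, edist (u x) (u y) = ⨅ P ∈ c, edist (u x) P + edist (u y) P := by
    intro x y
    refine le_antisymm (le_iInf₂ fun P _ => edist_triangle_right _ _ _) ?_
    refine ENNReal.le_of_forall_pos_le_add fun ε hε _ => ?_
    have hε2 : (0 : ℝ≥0∞) < ε / 2 := ENNReal.half_pos (ENNReal.coe_ne_zero.2 hε.ne')
    obtain ⟨P, hP, hlt⟩ := EMetric.mem_closure_iff.1 (hcd (mem_range_self x)) _ hε2
    refine (iInf₂_le P hP).trans ?_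
    calc edist (u x) P + edist (u y) P
        ≤ edist (u x) P + (edist (u y) (u x) + edist (u x) P) := by
          gcongr
          exact edist_triangle _ _ _
      _ = edist (u x) (u y) + (edist (u x) P + edist (u x) P) := by
          rw [edist_comm (u y)]
          ring
      _ ≤ edist (u x) (u y) + (ε / 2 + ε / 2) := by gcongr
      _ = _ := by rw [ENNReal.add_halves]
  have hm : ∀ P, Measurable fun x => edist (u x) P := fun P => by
    simp only [edist_dist]
    exact (h P).ennreal_ofReal
  have : Measurable fun q : M × M => edist (u q.1) (u q.2) := by
    simp only [heq]
    exact Measurable.biInf c hc fun P _ =>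
      ((hm P).comp measurable_fst).add ((hm P).comp measurable_snd)
  simp only [dist_edist]
  exact this.ennreal_toReal

theorem ofReal_dist_rpow_le (hp : 0 ≤ p) (a b P : Y) :
    ENNReal.ofReal (dist a b ^ p) ≤
      ENNReal.ofReal (2 ^ p) * (ENNReal.ofReal (dist a P ^ p) + ENNReal.ofReal (dist b P ^ p)) := by
  rw [← ENNReal.ofReal_add (by positivity) (by positivity), ← ENNReal.ofReal_mul (by positivity)]
  refine ENNReal.ofReal_le_ofReal ?_
  have h1 : dist a b ≤ 2 * max (dist a P) (dist b P) := by
    linarith [dist_triangle_right a b P, le_max_left (dist a P) (dist b P),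
      le_max_right (dist a P) (dist b P)]
  calc dist a b ^ p ≤ (2 * max (dist a P) (dist b P)) ^ p := by gcongr
    _ = 2 ^ p * max (dist a P) (dist b P) ^ p :=
        Real.mul_rpow zero_le_two (dist_nonneg.trans (le_max_left _ _))
    _ ≤ _ := by
        gcongr
        have ha : 0 ≤ dist a P ^ p := by positivity
        have hb : 0 ≤ dist b P ^ p := by positivity
        rcases max_choice (dist a P) (dist b P) with h | h <;> rw [h] <;> linarith

variable [BorelSpace M] [SecondCountableTopology M]

theorem pairEnergy_ne_top [SFinite (μH[(n : ℝ)] : Measure M)] (hp : 0 ≤ p)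
    (hu : Measurable fun q : M × M => dist (u q.1) (u q.2)) {K : Set M} (hK : MeasurableSet K)
    (hμK : μH[(n : ℝ)] K ≠ ∞) {P : Y}
    (h_int : IntegrableOn (fun x => dist (u x) P ^ p) K μH[(n : ℝ)])
    {ψ : M → ℝ} (hψ : Measurable ψ) (hψ0 : ∀ x, 0 ≤ ψ x) (hψ1 : ∀ x, ψ x ≤ 1) {r : ℝ}
    (hr : 0 < r) (hψK : ∀ x, ψ x ≠ 0 → ball x r ⊆ K) :
    pairEnergy n p u ψ r ≠ ∞ := by
  set F : M → ℝ≥0∞ := fun x => ENNReal.ofReal (dist (u x) P ^ p) with hF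
  have hFi : ∫⁻ x in K, F x ∂μH[(n : ℝ)] ≠ ∞ := by
    have := h_int.2
    rw [hasFiniteIntegral_iff_ofReal (Eventually.of_forall fun x => by positivity)] at this
    exact this.ne
  rw [pairEnergy_eq_lintegral hu hψ hψ0]
  have hle : ∀ x, ENNReal.ofReal (ψ x) * nearDensity n p u r x ≤
      K.indicator (fun x => ENNReal.ofReal (energyFactor n p r) * (ENNReal.ofReal (2 ^ p) *
        (F x * μH[(n : ℝ)] K + ∫⁻ y in K, F y ∂μH[(n : ℝ)]))) x := by
    intro x
    by_cases hx : ψ x = 0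
    · simp [hx]
    rw [indicator_of_mem (hψK x hx (mem_ball_self hr))]
    refine (mul_le_of_le_one_left' (ENNReal.ofReal_le_one.2 (hψ1 x))).trans ?_
    refine mul_le_mul_right ?_ _
    calc ∫⁻ y in ball x r, ENNReal.ofReal (dist (u x) (u y) ^ p) ∂μH[(n : ℝ)]
        ≤ ∫⁻ y in K, ENNReal.ofReal (2 ^ p) * (F x + F y) ∂μH[(n : ℝ)] :=
          (lintegral_mono fun y => ofReal_dist_rpow_le hp _ _ P).trans
            (lintegral_mono_set (hψK x hx))
      _ = _ := by
          rw [lintegral_const_mul' _ _ ENNReal.ofReal_ne_top, lintegral_add_left measurable_const,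
            setLIntegral_const]
  refine ne_top_of_le_ne_top ?_ (lintegral_mono hle)
  rw [lintegral_indicator hK, lintegral_const_mul' _ _ ENNReal.ofReal_ne_top,
    lintegral_const_mul' _ _ ENNReal.ofReal_ne_top, lintegral_add_right _ measurable_const,
    setLIntegral_const, lintegral_mul_const' _ _ hμK]
  finiteness

theorem ksApproxEnergy_eq_toReal [SFinite (μH[(n : ℝ)] : Measure M)]
    (hu : Measurable fun q : M × M => dist (u q.1) (u q.2)) {Ω : Set M} {v : M → ℝ}
    (hv : Measurable v) (hv0 : ∀ x, 0 ≤ v x) {r : ℝ} (hr : 0 < r)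
    (hf : 0 ≤ energyFactor n p r)
    (hvΩ : ∀ x, v x ≠ 0 → ball x r ⊆ Ω) (hfin : pairEnergy n p u v r ≠ ∞) :
    ksApproxEnergy n p μH[(n : ℝ)] Ω u v r = (pairEnergy n p u v r).toReal := by
  have hdens : ∀ x, v x * ksDensity n p μH[(n : ℝ)] Ω u r x =
      (ENNReal.ofReal (v x) * nearDensity n p u r x).toReal := by
    intro x
    by_cases hx : v x = 0
    · simp [hx]
    rw [ENNReal.toReal_mul, ENNReal.toReal_ofReal (hv0 x), nearDensity, ENNReal.toReal_mul,
      ENNReal.toReal_ofReal hf, ksDensity, inter_eq_left.2 (hvΩ x hx),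
      integral_eq_lintegral_of_nonneg_ae (Eventually.of_forall fun y => by positivity)]
    · rfl
    · exact ((hu.comp measurable_prodMk_left).pow_const p).aestronglyMeasurable
  have hm := hv.ennreal_ofReal.fun_mul (measurable_nearDensity (n := n) (p := p) hu r)
  rw [pairEnergy_eq_lintegral hu hv hv0] at hfin ⊢
  rw [ksApproxEnergy, ← integral_toReal hm.aemeasurable (ae_lt_top hm hfin)]
  simp only [hdens]
  refine setIntegral_eq_integral_of_forall_compl_eq_zero fun x hx => ?_
  by_cases hx0 : v x = 0
  · simp [hx0]
  · exact absurd (hvΩ x hx0 (mem_ball_self hr)) hx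

end ApproximatingEnergy

section LocalConvergence

variable {M : Type*} [MetricSpace M]

/-- A cutoff function which is `1` on `ball a (s * ϱ)` and vanishes off `ball a ((s + 1) * ϱ)`. -/
def cutoff (a : M) (ϱ s : ℝ) (x : M) : ℝ := max 0 (min 1 (s + 1 - dist x a / ϱ))

variable {a : M} {ϱ s : ℝ}

theorem continuous_cutoff : Continuous (cutoff a ϱ s) := by
  unfold cutoff
  fun_prop

theorem cutoff_nonneg (x : M) : 0 ≤ cutoff a ϱ s x := le_max_left _ _

theorem cutoff_le_one (x : M) : cutoff a ϱ s x ≤ 1 :=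
  max_le zero_le_one (min_le_left _ _)

theorem cutoff_eq_zero (hϱ : 0 < ϱ) {x : M} (hx : (s + 1) * ϱ ≤ dist x a) :
    cutoff a ϱ s x = 0 := by
  refine max_eq_left ((min_le_right _ _).trans ?_)
  rw [sub_nonpos, le_div_iff₀ hϱ]
  exact hx

theorem cutoff_eq_one (hϱ : 0 < ϱ) {x : M} (hx : dist x a ≤ s * ϱ) : cutoff a ϱ s x = 1 := by
  have : dist x a / ϱ ≤ s := (div_le_iff₀ hϱ).2 hx
  rw [cutoff, min_eq_left (by linarith), max_eq_right zero_le_one]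

theorem cutoff_mono {s' : ℝ} (h : s ≤ s') (x : M) : cutoff a ϱ s x ≤ cutoff a ϱ s' x := by
  unfold cutoff
  gcongr

theorem cutoff_le_add (hϱ : 0 < ϱ) (x z : M) :
    cutoff a ϱ s x ≤ cutoff a ϱ s z + dist x z / ϱ := by
  have h : dist z a / ϱ ≤ dist x a / ϱ + dist x z / ϱ := by
    rw [← add_div]
    gcongr
    linarith [dist_triangle_left z a x]
  have h0 : 0 ≤ dist x z / ϱ := by positivity
  unfold cutoff
  refine max_le (by positivity) ?_
  have h1 := le_max_right 0 (min 1 (s + 1 - dist z a / ϱ))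
  rcases min_choice 1 (s + 1 - dist z a / ϱ) with h2 | h2 <;> rw [h2] at h1 ⊢
  · linarith [min_le_left 1 (s + 1 - dist x a / ϱ)]
  · linarith [min_le_right 1 (s + 1 - dist x a / ϱ)]

theorem cutoff_zero_le_add_mul (hϱ : 0 < ϱ) {r : ℝ} (hr : r ≤ ϱ) {x z : M} (hxz : dist x z < r) :
    cutoff a ϱ 0 x ≤ cutoff a ϱ 0 z + r / ϱ * cutoff a ϱ 2 x ∧
      cutoff a ϱ 0 z ≤ cutoff a ϱ 0 x + r / ϱ * cutoff a ϱ 2 x := by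
  have hr0 : 0 < r := dist_nonneg.trans_lt hxz
  rcases le_or_gt (dist x a) (2 * ϱ) with hx | hx
  · rw [cutoff_eq_one hϱ hx, mul_one]
    have h : dist x z / ϱ ≤ r / ϱ := by gcongr
    have h1 := cutoff_le_add (a := a) (s := 0) hϱ x z
    have h2 := cutoff_le_add (a := a) (s := 0) hϱ z x
    rw [dist_comm z x] at h2
    constructor <;> linarith
  · have hz : ϱ ≤ dist z a := by linarith [dist_triangle x z a]
    rw [cutoff_eq_zero (s := 0) hϱ (by linarith), cutoff_eq_zero (s := 0) hϱ (by linarith)]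
    have := cutoff_nonneg (a := a) (ϱ := ϱ) (s := 2) x
    constructor <;> positivity

variable [MeasurableSpace M] [BorelSpace M] {Y : Type*} [MetricSpace Y] {n : ℕ} {p : ℝ}
  {u : M → Y} [SecondCountableTopology M]

theorem exists_tendsto_lintegral_cutoff [SigmaFinite (μH[(n : ℝ)] : Measure M)]
    [IsLocallyFiniteMeasure (μH[(n : ℝ)] : Measure M)] (hp : 1 < p) {κ : ℝ}
    (hM : CurvBddBelow M κ) {Ω : Set M} (hΩ : IsOpen Ω) (hu : MemKS n p μH[(n : ℝ)] Ω u)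
    {ν : Measure M} (hν : IsEnergyMeasure n p μH[(n : ℝ)] Ω u ν) {a : M} (ha : a ∈ Ω) :
    ∃ ϱ > 0, Tendsto (fun r => ∫⁻ x, ENNReal.ofReal (cutoff a ϱ 0 x) *
      ((nearDensity n p u r x - ν.rnDeriv μH[(n : ℝ)] x) +
        (ν.rnDeriv μH[(n : ℝ)] x - nearDensity n p u r x)) ∂μH[(n : ℝ)]) (𝓝[>] 0) (𝓝 0) := by
  have := hM.locallyCompact
  have := hν.1
  have hum := measurable_dist_pair hu.1 hu.2.1
  obtain ⟨P, hP⟩ := hu.2.2.1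
  have hp0 : 0 < p := by linarith
  obtain ⟨R, hR, hchain⟩ := exists_isChainFamily (n := n) hM a
  obtain ⟨ρ₁, hρ₁, hcpt⟩ := exists_isCompact_closedBall a
  obtain ⟨ρ₂, hρ₂, hsub⟩ := Metric.isOpen_iff.1 hΩ a ha
  obtain ⟨ϱ, hϱ, h1, h2, h3⟩ : ∃ ϱ > 0, ϱ ≤ R ∧ 4 * ϱ ≤ ρ₁ ∧ 4 * ϱ < ρ₂ := by
    refine ⟨min R (min (ρ₁ / 4) (ρ₂ / 5)), by positivity, min_le_left _ _, ?_, ?_⟩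
    · linarith [min_le_right R (min (ρ₁ / 4) (ρ₂ / 5)), min_le_left (ρ₁ / 4) (ρ₂ / 5)]
    · linarith [min_le_right R (min (ρ₁ / 4) (ρ₂ / 5)), min_le_right (ρ₁ / 4) (ρ₂ / 5)]
  set K := closedBall a (4 * ϱ) with hK
  have hKc : IsCompact K := hcpt.of_isClosed_subset isClosed_closedBall
    (closedBall_subset_closedBall h2)
  have hKΩ : K ⊆ Ω := (closedBall_subset_ball h3).trans hsub
  have hball : ∀ r ≤ ϱ, ∀ x, cutoff a ϱ 2 x ≠ 0 → ball x r ⊆ K := by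
    intro r hr x hx y hy
    have : dist x a < (2 + 1) * ϱ := by
      by_contra h
      exact hx (cutoff_eq_zero hϱ (not_lt.1 h))
    rw [mem_ball] at hy
    rw [mem_closedBall]
    linarith [dist_triangle y x a]
  have hfin : ∀ r, 0 < r → r ≤ ϱ → pairEnergy n p u (cutoff a ϱ 2) r ≠ ∞ := fun r hr hrϱ =>
    pairEnergy_ne_top hp0.le hum hKc.measurableSet hKc.measure_lt_top.ne (hP.mono_set hKΩ)
      continuous_cutoff.measurable cutoff_nonneg cutoff_le_one hr (hball r hrϱ)
  have hr : ∀ᶠ r in 𝓝[>] (0 : ℝ), 0 < r ∧ r ≤ ϱ := Ioc_mem_nhdsGT hϱ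
  refine ⟨ϱ, hϱ, tendsto_lintegral_nearDensity_sub (ψ := cutoff a ϱ 2) hp measurableSet_ball hchain
    hum continuous_cutoff continuous_cutoff cutoff_nonneg cutoff_le_one (cutoff_mono zero_le_two)
    (fun x hx => cutoff_eq_zero hϱ ?_) hϱ (fun r hr hrϱ x z hxz => cutoff_zero_le_add_mul hϱ hrϱ hxz)
    ?_ (hr.mono fun r hr => hfin r hr.1 hr.2) fun v hv hv0 hvψ => ?_⟩
  · rw [mem_ball, not_lt] at hx
    linarith
  · refine (integrable_const (1 : ℝ)).mono' continuous_cutoff.aestronglyMeasurable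
      (Eventually.of_forall fun x => ?_)
    rw [Real.norm_of_nonneg (cutoff_nonneg x)]
    exact cutoff_le_one x
  · have hvne : ∀ x, v x ≠ 0 → cutoff a ϱ 2 x ≠ 0 := fun x hx h =>
      hx (le_antisymm ((hvψ x).trans_eq (by rw [h, mul_zero])) (hv0 x))
    have hsupp : tsupport v ⊆ K := closure_minimal
      (fun x hx => hball ϱ le_rfl x (hvne x hx) (mem_ball_self hϱ)) isClosed_closedBall
    refine (hν.2 v ⟨hv, hKc.of_isClosed_subset (isClosed_tsupport v) hsupp, hsupp.trans hKΩ⟩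
      hv0).congr' (hr.mono fun r hr => ?_)
    refine ksApproxEnergy_eq_toReal hum hv.measurable hv0 hr.1 (energyFactor_nonneg n hp0 hr.1)
      (fun x hx => (hball r hr.2 x (hvne x hx)).trans hKΩ) ?_
    refine ne_top_of_le_ne_top ?_ (pairEnergy_mono hvψ r)
    rw [pairEnergy_const_mul zero_le_two]
    exact ENNReal.mul_ne_top ENNReal.ofReal_ne_top (hfin r hr.1 hr.2)

end LocalConvergence

section Subsequence

theorem exists_subseq_ae_tendsto_zero {α : Type*} [MeasurableSpace α] {μ : Measure α}
    {F : ℕ → ℕ → α → ℝ≥0∞} (hF : ∀ i j, Measurable (F i j))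
    (hlim : ∀ i, Tendsto (fun j => ∫⁻ x, F i j x ∂μ) atTop (𝓝 0)) :
    ∃ φ : ℕ → ℕ, StrictMono φ ∧ ∀ᵐ x ∂μ, ∀ i, Tendsto (fun l => F i (φ l) x) atTop (𝓝 0) := by
  have hev : ∀ l : ℕ, ∀ᶠ j in atTop, ∀ i ≤ l, ∫⁻ x, F i j x ∂μ ≤ 2⁻¹ ^ l := by
    intro l
    have := fun i => (hlim i).eventually_le_const (ENNReal.pow_pos (by simp) l :
      (0 : ℝ≥0∞) < 2⁻¹ ^ l)
    exact (Set.finite_le_nat l).eventually_all.2 fun i _ => this i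
  obtain ⟨φ, hφ, hφF⟩ := extraction_forall_of_eventually hev
  refine ⟨φ, hφ, ae_all_iff.2 fun i => ?_⟩
  have hsum : ∫⁻ x, ∑' l, F i (φ (l + i)) x ∂μ ≠ ∞ := by
    rw [lintegral_tsum fun l => (hF i _).aemeasurable]
    refine ne_top_of_le_ne_top (b := ∑' l : ℕ, (2⁻¹ : ℝ≥0∞) ^ l) ?_ (ENNReal.tsum_le_tsum fun l => ?_)
    · rw [ENNReal.tsum_geometric, ENNReal.one_sub_inv_two, inv_inv]
      exact ENNReal.ofNat_ne_top
    · refine (hφF (l + i) i (Nat.le_add_left i l)).trans ?_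
      exact pow_le_pow_right_of_le_one' (by simp) (Nat.le_add_right l i)
  filter_upwards [ae_lt_top (Measurable.tsum fun l => hF i _) hsum] with x hx
  exact (tendsto_add_atTop_iff_nat i).1 (ENNReal.tendsto_atTop_zero_of_tsum_ne_top hx.ne)

theorem tendsto_of_tendsto_sub_add_sub {ι : Type*} {l : Filter ι} {f : ι → ℝ≥0∞} {b : ℝ≥0∞}
    (hb : b ≠ ∞) (h : Tendsto (fun i => (f i - b) + (b - f i)) l (𝓝 0)) : Tendsto f l (𝓝 b) := by
  refine (ENNReal.tendsto_nhds hb).2 fun δ hδ => ?_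
  filter_upwards [h.eventually_le_const hδ] with i hi
  exact ⟨tsub_le_iff_tsub_le.1 (le_add_self.trans hi),
    tsub_le_iff_left.1 (le_self_add.trans hi)⟩

variable {M : Type*} [MetricSpace M] [MeasurableSpace M] [BorelSpace M] {Y : Type*}
  [MetricSpace Y] {n : ℕ} {p : ℝ} {u : M → Y} [SecondCountableTopology M]

theorem exists_subseq_ae_tendsto_nearDensity [SigmaFinite (μH[(n : ℝ)] : Measure M)]
    [IsLocallyFiniteMeasure (μH[(n : ℝ)] : Measure M)] (hp : 1 < p) {κ : ℝ}
    (hM : CurvBddBelow M κ) {Ω : Set M} (hΩ : IsOpen Ω) (hΩne : Ω.Nonempty)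
    (hu : MemKS n p μH[(n : ℝ)] Ω u)
    {ν : Measure M} (hν : IsEnergyMeasure n p μH[(n : ℝ)] Ω u ν) {ε : ℕ → ℝ}
    (hε : Tendsto ε atTop (𝓝[>] 0)) :
    ∃ φ : ℕ → ℕ, StrictMono φ ∧ ∀ᵐ x ∂(μH[(n : ℝ)] : Measure M), x ∈ Ω →
      Tendsto (fun j => nearDensity n p u (ε (φ j)) x) atTop (𝓝 (ν.rnDeriv μH[(n : ℝ)] x)) := by
  have := hν.1
  choose! ϱ hϱ hlim using fun a (ha : a ∈ Ω) => exists_tendsto_lintegral_cutoff hp hM hΩ hu hν ha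
  obtain ⟨t, htΩ, htc, ht⟩ := TopologicalSpace.countable_cover_nhdsWithin
    (f := fun a => ball a (ϱ a)) fun a ha => mem_nhdsWithin_of_mem_nhds (ball_mem_nhds a (hϱ a ha))
  have htne : t.Nonempty := by
    obtain ⟨x, hx⟩ := hΩne
    obtain ⟨a, ha, -⟩ := mem_iUnion₂.1 (ht hx)
    exact ⟨a, ha⟩
  obtain ⟨f, rfl⟩ := htc.exists_eq_range htne
  have hfΩ : ∀ i, f i ∈ Ω := fun i => htΩ (mem_range_self i)
  obtain ⟨φ, hφ, hae⟩ := exists_subseq_ae_tendsto_zero (μ := μH[(n : ℝ)])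
    (F := fun i j x => ENNReal.ofReal (cutoff (f i) (ϱ (f i)) 0 x) *
      ((nearDensity n p u (ε j) x - ν.rnDeriv μH[(n : ℝ)] x) +
        (ν.rnDeriv μH[(n : ℝ)] x - nearDensity n p u (ε j) x)))
    (fun i j => by
      have h1 := measurable_nearDensity (n := n) (p := p)
        (measurable_dist_pair hu.1 hu.2.1) (ε j)
      have h2 := ν.measurable_rnDeriv μH[(n : ℝ)]
      exact continuous_cutoff.measurable.ennreal_ofReal.fun_mul
        ((h1.fun_sub h2).fun_add (h2.fun_sub h1)))
    (fun i => (hlim _ (hfΩ i)).comp hε)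
  refine ⟨φ, hφ, ?_⟩
  filter_upwards [hae, ν.rnDeriv_lt_top μH[(n : ℝ)]] with x hx hxν hxΩ
  obtain ⟨_, ⟨i, rfl⟩, hi⟩ := mem_iUnion₂.1 (ht hxΩ)
  have hc : 0 < cutoff (f i) (ϱ (f i)) 0 x := by
    refine lt_max_of_lt_right (lt_min one_pos ?_)
    rw [zero_add, sub_pos, div_lt_one (hϱ _ (hfΩ i))]
    exact hi
  have hc0 : ENNReal.ofReal (cutoff (f i) (ϱ (f i)) 0 x) ≠ 0 := (ENNReal.ofReal_pos.2 hc).ne'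
  refine tendsto_of_tendsto_sub_add_sub hxν.ne ?_
  have h := ENNReal.Tendsto.const_mul (hx i) (Or.inr (ENNReal.inv_ne_top.2 hc0))
  rw [mul_zero] at h
  refine h.congr fun j => ?_
  rw [← mul_assoc, ENNReal.inv_mul_cancel hc0 ENNReal.ofReal_ne_top, one_mul]

end Subsequence

end Paper

namespace Paper

/-- Corollary 4.7. `Ω` a bounded domain of an `n`-dimensional
Alexandrov space with curvature `≥ k`, `p > 1`, `Y` complete, `u ∈ W^{1,p}(Ω,Y)`. Every
sequence `ε_j → 0` has a subsequence `ε'_j` such that for a.e. `x₀ ∈ Ω` the mean value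
property holds:
`∫_{B_{x₀}(ε'_j)} d_Y^p(u(x₀),u(x)) dvol = (c_{n,p}/(n+p))·|∇u|_p(x₀)·(ε'_j)^{n+p} + o((ε'_j)^{n+p})`. -/
theorem statement_10 (n : ℕ) (k : ℝ) (p : ℝ) (hp : 1 < p)
    {M : Type*} [MetricSpace M] [MeasurableSpace M] [BorelSpace M]
    (hM : AlexandrovSpace M n k)
    {Y : Type*} [MetricSpace Y] (hYc : CompleteSpace Y)
    (Ω : Set M) (hΩo : IsOpen Ω) (hΩc : IsConnected Ω) (hΩb : Bornology.IsBounded Ω)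
    (u : M → Y) (hu : MemKS n p (μH[(n : ℝ)]) Ω u)
    (ν : Measure M) (hν : IsEnergyMeasure n p (μH[(n : ℝ)]) Ω u ν)
    (ε : ℕ → ℝ) (hεpos : ∀ j, 0 < ε j) (hε : Tendsto ε atTop (𝓝 0)) :
    ∃ φ : ℕ → ℕ, StrictMono φ ∧
      ∀ᵐ x₀ ∂((μH[(n : ℝ)] : Measure M).restrict Ω),
        ∃ err : ℕ → ℝ, err =o[atTop] (fun j => ε (φ j) ^ ((n : ℝ) + p)) ∧
          ∀ j : ℕ,
            ∫ x in Metric.ball x₀ (ε (φ j)) ∩ Ω,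
                dist (u x₀) (u x) ^ p ∂(μH[(n : ℝ)]) =
              cnp n p / ((n : ℝ) + p) * ksDens (μH[(n : ℝ)]) ν x₀
                  * ε (φ j) ^ ((n : ℝ) + p)
                + err j := by
  have hp0 : 0 < p := by linarith
  have : SecondCountableTopology M :=
    secondCountable_of_dimH_lt_top (by rw [hM.dim]; exact ENNReal.natCast_lt_top n)
  have : IsLocallyFiniteMeasure (μH[(n : ℝ)] : Measure M) := ⟨fun a => by
    obtain ⟨r, hr, h⟩ := hM.exists_measure_ball_lt_top a
    exact ⟨ball a r, ball_mem_nhds a hr, h⟩⟩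
  obtain ⟨φ, hφ, hae⟩ := exists_subseq_ae_tendsto_nearDensity hp hM.curv hΩo hΩc.nonempty hu hν
    (tendsto_nhdsWithin_iff.2 ⟨hε, Eventually.of_forall hεpos⟩)
  have := hν.1
  refine ⟨φ, hφ, (ae_restrict_iff' hΩo.measurableSet).2 ?_⟩
  filter_upwards [hae, ν.rnDeriv_lt_top μH[(n : ℝ)]] with x hx hxν hxΩ
  refine ⟨_, ?_, fun j => (add_sub_cancel _ _).symm⟩
  have hlim := ((ENNReal.tendsto_toReal hxν.ne).comp (hx hxΩ)).sub_const
    (ksDens μH[(n : ℝ)] ν x)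
  rw [ksDens, sub_self] at hlim
  refine isLittleO_iff_exists_eq_mul.2 ⟨_, by
    simpa only [mul_zero] using hlim.const_mul (cnp n p / ((n : ℝ) + p)), ?_⟩
  obtain ⟨δ, hδ, hsub⟩ := Metric.isOpen_iff.1 hΩo x hxΩ
  filter_upwards [(hε.comp hφ.tendsto_atTop).eventually_lt_const hδ] with j hj
  have hr := hεpos (φ j)
  have hj : ε (φ j) < δ := hj
  have hm : Measurable fun y => dist (u x) (u y) ^ p :=
    ((measurable_dist_pair hu.1 hu.2.1).comp measurable_prodMk_left).pow_const p
  rw [inter_eq_left.2 ((ball_subset_ball hj.le).trans hsub),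
    integral_eq_lintegral_of_nonneg_ae (Eventually.of_forall fun y => by positivity)
      hm.aestronglyMeasurable]
  have hc := cnp_pos n hp0
  have hrp : 0 < ε (φ j) ^ ((n : ℝ) + p) := by positivity
  simp only [Pi.mul_apply, Function.comp_apply, nearDensity, ENNReal.toReal_mul, energyFactor,
    ksDens]
  rw [ENNReal.toReal_ofReal (by positivity)]
  field_simp

end Paper
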